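/- arXiv:1503.02056 — 8 statements merged into one kernel-verified Lean document; each statement's English description precedes it below -/
import Mathlib

section
/- Let R be a ring and I a two-sided ideal of R with I contained in the Jacobson radical of R. Let P and Q be projective left R-modules. Then P ≅ Q as R-modules if and only if P/IP ≅ Q/IQ as R/I-modules. In particular, P is a free R-module if and only if P/IP is a free R/I-module. -/
section Congruence

variable {R : Type*} [Ring R] {I : Ideal R}
variable {M N : Type*} [AddCommGroup M] [Module R M] [AddCommGroup N] [Module R N]

theorem LinearMap.apply_mem_ideal_smul_top (f : M →ₗ[R] N) {x : M}
    (hx : x ∈ (I • ⊤ : Submodule R M)) : f x ∈ (I • ⊤ : Submodule R N) := by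
  have h := Submodule.mem_map_of_mem (f := f) hx
  rw [Submodule.map_smul''] at h
  exact Submodule.smul_mono le_rfl le_top h

/-- Nakayama's lemma for an endomorphism congruent to the identity. -/
theorem Module.End.surjective_one_sub (hI : I ≤ Ring.jacobson R)
    [Module.Finite R M] (h : Module.End R M) (hh : ∀ x, h x ∈ (I • ⊤ : Submodule R M)) :
    Function.Surjective (1 - h : Module.End R M) := by
  set K := LinearMap.range (1 - h : Module.End R M)
  have key : (⊤ : Submodule R (M ⧸ K)) = ⊥ := by
    refine Submodule.FG.eq_bot_of_le_jacobson_smul Module.Finite.fg_top fun y _ => ?_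
    obtain ⟨x, rfl⟩ := K.mkQ_surjective y
    have hx : K.mkQ x = K.mkQ (h x) := by
      rw [← sub_eq_zero, ← map_sub, Submodule.mkQ_apply, Submodule.Quotient.mk_eq_zero]
      exact ⟨x, rfl⟩
    rw [hx]
    exact Submodule.smul_mono_left hI (K.mkQ.apply_mem_ideal_smul_top (hh x))
  have hKtop : K = ⊤ := by
    rw [← Submodule.ker_mkQ K, LinearMap.ker_eq_top]
    ext x
    exact (Submodule.eq_bot_iff _).1 key _ trivial
  exact LinearMap.range_eq_top.1 hKtop

theorem Module.End.isUnit_one_sub (hI : I ≤ Ring.jacobson R)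
    [Module.Finite R M] [Module.Projective R M] (h : Module.End R M)
    (hh : ∀ x, h x ∈ (I • ⊤ : Submodule R M)) : IsUnit (1 - h) := by
  obtain ⟨k, hk⟩ := Module.projective_lifting_property (1 - h : Module.End R M)
    (1 : Module.End R M) (Module.End.surjective_one_sub hI h hh)
  have hk1 : (1 - h) * k = 1 := hk
  have hk_eq : k = 1 - (-(h * k)) := by
    rw [sub_mul, one_mul] at hk1
    rw [← hk1]; abel
  have hk_surj : Function.Surjective k := by
    rw [hk_eq]
    exact Module.End.surjective_one_sub hI _ fun x => neg_mem (hh _)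
  have hk_inj : Function.Injective k :=
    Function.LeftInverse.injective (g := (1 - h : Module.End R M)) (DFunLike.congr_fun hk1)
  obtain ⟨u, rfl⟩ := (Module.End.isUnit_iff k).2 ⟨hk_inj, hk_surj⟩
  have h_eq : 1 - h = ↑u⁻¹ := Units.eq_inv_of_mul_eq_one_right hk1
  exact h_eq ▸ Units.isUnit _

/-- Every finite subset of a projective module is fixed pointwise by an endomorphism factoring
through a finite free module. -/
theorem Module.Projective.exists_finite_factor [Module.Projective R M] (X : Finset M) :
    ∃ (T : Finset M) (a : M →ₗ[R] (T →₀ R)) (b : (T →₀ R) →ₗ[R] M), ∀ x ∈ X, b (a x) = x := by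
  classical
  obtain ⟨s, hs⟩ := Module.projective_def.1 ‹Module.Projective R M›
  let T : Finset M := X.biUnion fun x => (s x).support
  refine ⟨T, Finsupp.lcomapDomain (Subtype.val : T → M) Subtype.val_injective ∘ₗ s,
    Finsupp.linearCombination R (Subtype.val : T → M), fun x hx => ?_⟩
  have hsupp : (s x).support ⊆ T := Finset.subset_biUnion_of_mem (fun x => (s x).support) hx
  conv_rhs => rw [← hs x]
  have h : Finsupp.linearCombination R (Subtype.val : T → M) =
      Finsupp.linearCombination R id ∘ₗ Finsupp.lmapDomain R R (Subtype.val : T → M) := by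
    ext; simp
  rw [h, LinearMap.comp_apply]
  congr 1
  exact Finsupp.mapDomain_comapDomain (Subtype.val : T → M) Subtype.val_injective (s x)
    (by simpa using hsupp)

/-- An endomorphism of a projective module congruent to the identity modulo the radical agrees
on any finite set with an automorphism congruent to the identity. -/
theorem Module.Projective.exists_equiv_eqOn (hI : I ≤ Ring.jacobson R) [Module.Projective R M]
    (θ : M →ₗ[R] M) (hθ : ∀ x, x - θ x ∈ (I • ⊤ : Submodule R M)) (X : Finset M) :
    ∃ w : M ≃ₗ[R] M, (∀ x, x - w x ∈ (I • ⊤ : Submodule R M)) ∧ ∀ x ∈ X, w x = θ x := by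
  obtain ⟨T, a, b, hab⟩ := Module.Projective.exists_finite_factor (R := R) X
  let j : M →ₗ[R] M := LinearMap.id - θ
  have hj : ∀ x, j x ∈ (I • ⊤ : Submodule R M) := hθ
  obtain ⟨u, hu⟩ := Module.End.isUnit_one_sub hI (a ∘ₗ j ∘ₗ b : Module.End R (T →₀ R))
    fun x => a.apply_mem_ideal_smul_top (hj _)
  let v : Module.End R (T →₀ R) := ↑u⁻¹
  have h1 (x) : v x - a (j (b (v x))) = x := by
    have h : (u : Module.End R (T →₀ R)) * v = 1 := u.mul_inv
    rw [hu] at h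
    exact DFunLike.congr_fun h x
  have h2 (x) : v x - v (a (j (b x))) = x := by
    have h : v * (u : Module.End R (T →₀ R)) = 1 := u.inv_mul
    rw [hu] at h
    rw [← map_sub]
    exact DFunLike.congr_fun h x
  refine ⟨LinearEquiv.ofLinearMap (LinearMap.id - j ∘ₗ b ∘ₗ a) (LinearMap.id + j ∘ₗ b ∘ₗ v ∘ₗ a)
    ?_ ?_, fun x => ?_, fun x hx => ?_⟩
  · refine LinearMap.ext fun x => ?_
    have h := congrArg (fun y => j (b y)) (h1 (a x))
    simp only [map_sub] at h
    simp only [LinearMap.comp_apply, LinearMap.sub_apply, LinearMap.add_apply, LinearMap.id_apply,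
      map_add]
    rw [← h]
    abel
  · refine LinearMap.ext fun x => ?_
    have h := congrArg (fun y => j (b y)) (h2 (a x))
    simp only [map_sub] at h
    simp only [LinearMap.comp_apply, LinearMap.sub_apply, LinearMap.add_apply, LinearMap.id_apply,
      map_sub]
    rw [sub_eq_iff_eq_add.1 h]
    abel
  · simpa using hj _
  · simp [hab x hx, j]

end Congruence

section Countable

variable {R : Type*} [Ring R] {I : Ideal R}
variable {M N : Type*} [AddCommGroup M] [Module R M] [AddCommGroup N] [Module R N]

/-- A pointwise eventually constant sequence of linear maps has a linear limit. -/
theorem LinearMap.exists_limit_of_eventually_const (F : ℕ → M →ₗ[R] N)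
    (hF : ∀ x, ∃ n, ∀ m ≥ n, F m x = F n x) :
    ∃ G : M →ₗ[R] N, ∀ x, ∃ n, ∀ m ≥ n, F m x = G x := by
  choose n hn using hF
  refine ⟨{ toFun := fun x => F (n x) x, map_add' := fun x y => ?_, map_smul' := fun r x => ?_ },
    fun x => ⟨n x, hn x⟩⟩
  · let k := max (n (x + y)) (max (n x) (n y))
    rw [← hn (x + y) k (by simp [k]), ← hn x k (by simp [k]), ← hn y k (by simp [k]), map_add]
  · let k := max (n (r • x)) (n x)
    rw [← hn (r • x) k (by simp [k]), ← hn x k (by simp [k]), map_smul, RingHom.id_apply]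

/-- A lift of an isomorphism modulo the radical can be modified, without changing it on a given
finite set, to attain a given value. -/
theorem Module.Projective.exists_lift_eqOn_attaining (hI : I ≤ Ring.jacobson R)
    [Module.Projective R M] [Module.Projective R N] (f : M →ₗ[R] N) (g : N →ₗ[R] M)
    (hgf : ∀ x, x - g (f x) ∈ (I • ⊤ : Submodule R M))
    (hfg : ∀ y, y - f (g y) ∈ (I • ⊤ : Submodule R N)) (X : Finset M) (y : N) :
    ∃ f' : M →ₗ[R] N, (∀ x, f x - f' x ∈ (I • ⊤ : Submodule R N)) ∧ (∀ x ∈ X, f' x = f x) ∧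
      ∃ x, f' x = y := by
  classical
  obtain ⟨u, hu, huX⟩ := exists_equiv_eqOn hI (g ∘ₗ f) hgf X
  have hu' (x) : x - u.symm x ∈ (I • ⊤ : Submodule R M) := by
    have h := neg_mem (hu (u.symm x))
    simpa using h
  obtain ⟨w, hw, hwX⟩ := exists_equiv_eqOn hI (f ∘ₗ u.symm.toLinearMap ∘ₗ g) (fun z => by
    have h := add_mem (hfg z) (f.apply_mem_ideal_smul_top (hu' (g z)))
    simpa using h) (insert y (X.image f))
  refine ⟨w.symm.toLinearMap ∘ₗ f, fun x => ?_, fun x hx => ?_, u.symm (g y), ?_⟩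
  · have h := neg_mem (hw (w.symm (f x)))
    simpa using h
  · have h := hwX (f x) (Finset.mem_insert_of_mem (Finset.mem_image_of_mem f hx))
    have h' : u.symm (g (f x)) = x := by
      rw [LinearEquiv.symm_apply_eq]; exact (huX x hx).symm
    simp only [LinearMap.comp_apply, LinearEquiv.coe_coe, h'] at h
    simp only [LinearMap.comp_apply, LinearEquiv.coe_coe]
    rw [LinearEquiv.symm_apply_eq, h]
  · have h := hwX y (Finset.mem_insert_self _ _)
    simp only [LinearMap.comp_apply, LinearEquiv.coe_coe] at h ⊢
    rw [LinearEquiv.symm_apply_eq, h]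

/-- Countably generated projective modules that are isomorphic modulo an ideal inside the radical
are isomorphic. -/
theorem Module.Projective.nonempty_equiv_of_countable (hI : I ≤ Ring.jacobson R)
    [Module.Projective R M] [Module.Projective R N] (f : M →ₗ[R] N) (g : N →ₗ[R] M)
    (hgf : ∀ x, x - g (f x) ∈ (I • ⊤ : Submodule R M))
    (hfg : ∀ y, y - f (g y) ∈ (I • ⊤ : Submodule R N))
    {S : Set M} (hS : S.Countable) (hSspan : Submodule.span R S = ⊤)
    {T : Set N} (hT : T.Countable) (hTspan : Submodule.span R T = ⊤) :
    Nonempty (M ≃ₗ[R] N) := by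
  classical
  obtain ⟨p, hp⟩ := (hS.insert 0).exists_eq_range (Set.insert_nonempty _ _)
  obtain ⟨q, hq⟩ := (hT.insert 0).exists_eq_range (Set.insert_nonempty _ _)
  have hpspan : Submodule.span R (Set.range p) = ⊤ := by
    rw [← hp, Submodule.span_insert_zero, hSspan]
  have hqspan : Submodule.span R (Set.range q) = ⊤ := by
    rw [← hq, Submodule.span_insert_zero, hTspan]
  let Lift := { h : M →ₗ[R] N // ∀ x, f x - h x ∈ (I • ⊤ : Submodule R N) }
  have step (n : ℕ) (s : Lift × Finset M) : ∃ t : Lift × Finset M,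
      s.2 ⊆ t.2 ∧ (∀ x ∈ s.2, t.1.1 x = s.1.1 x) ∧ p n ∈ t.2 ∧ ∃ x ∈ t.2, t.1.1 x = q n := by
    obtain ⟨⟨h, hh⟩, X⟩ := s
    obtain ⟨h', hh', hX, x, hx⟩ := exists_lift_eqOn_attaining hI h g
      (fun x => by
        have := add_mem (hgf x) (g.apply_mem_ideal_smul_top (hh x))
        simpa using this)
      (fun y => by
        have := add_mem (hfg y) (hh (g y))
        simpa using this) X (q n)
    refine ⟨⟨⟨h', fun x => ?_⟩, insert (p n) (insert x X)⟩, ?_, hX, by simp, x, by simp, hx⟩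
    · have := add_mem (hh x) (hh' x)
      simpa using this
    · intro z hz
      simp only [Finset.mem_insert]
      exact Or.inr (Or.inr hz)
  choose next next_sub next_eq next_p next_q using step
  let seq : ℕ → Lift × Finset M := fun n => Nat.rec (⟨f, fun x => by simp⟩, ∅) next n
  have seq_succ (n) : seq (n + 1) = next n (seq n) := rfl
  have seq_const (n x) (hx : x ∈ (seq n).2) (m) (hm : n ≤ m) :
      x ∈ (seq m).2 ∧ (seq m).1.1 x = (seq n).1.1 x := by
    induction m, hm using Nat.le_induction with
    | base => exact ⟨hx, rfl⟩
    | succ m hm ih =>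
      rw [seq_succ]
      exact ⟨next_sub m _ ih.1, (next_eq m _ x ih.1).trans ih.2⟩
  obtain ⟨G, hG⟩ := LinearMap.exists_limit_of_eventually_const (fun n => (seq n).1.1) (by
    intro x
    have hx : x ∈ Submodule.span R (Set.range p) := hpspan ▸ Submodule.mem_top
    induction hx using Submodule.span_induction with
    | mem x hx =>
      obtain ⟨n, rfl⟩ := hx
      exact ⟨n + 1, fun m hm => (seq_const (n + 1) (p n) (next_p n _) m hm).2⟩
    | zero => exact ⟨0, by simp⟩
    | add x y _ _ hx hy =>
      obtain ⟨a, ha⟩ := hx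
      obtain ⟨b, hb⟩ := hy
      refine ⟨max a b, fun m hm => ?_⟩
      rw [map_add, map_add, ha m (le_of_max_le_left hm), hb m (le_of_max_le_right hm),
        ha _ (le_max_left a b), hb _ (le_max_right a b)]
    | smul r x _ hx =>
      obtain ⟨a, ha⟩ := hx
      exact ⟨a, fun m hm => by rw [map_smul, map_smul, ha m hm]⟩)
  have hGf (x) : f x - G x ∈ (I • ⊤ : Submodule R N) := by
    obtain ⟨n, hn⟩ := hG x
    rw [← hn n le_rfl]
    exact (seq n).1.2 x
  refine ⟨LinearEquiv.ofBijective G ⟨?_, ?_⟩⟩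
  · rw [← LinearMap.ker_eq_bot, LinearMap.ker_eq_bot']
    intro x hx
    obtain ⟨w, -, hw⟩ := exists_equiv_eqOn hI (g ∘ₗ G) (fun z => by
      have := add_mem (hgf z) (g.apply_mem_ideal_smul_top (hGf z))
      simpa using this) {x}
    have h := hw x (by simp)
    rw [LinearMap.comp_apply, hx, map_zero] at h
    exact (LinearEquiv.map_eq_zero_iff w).1 h
  · rw [← LinearMap.range_eq_top, eq_top_iff, ← hqspan, Submodule.span_le]
    rintro _ ⟨n, rfl⟩
    obtain ⟨x, hx, hxq⟩ := next_q n (seq n)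
    rw [← seq_succ] at hx hxq
    obtain ⟨k, hk⟩ := hG x
    refine ⟨x, ?_⟩
    rw [← hk (max k (n + 1)) (le_max_left _ _),
      (seq_const (n + 1) x hx _ (le_max_right _ _)).2, hxq]

end Countable

section Decomposition

open Submodule

variable {R : Type*} [Ring R] {I : Ideal R}
variable {M N : Type*} [AddCommGroup M] [Module R M] [AddCommGroup N] [Module R N]

/-- A set closed under a relation with countable fibres can be enlarged to a closed set containing
a given element by adding countably many elements. -/
theorem Set.exists_closed_insert {α : Type*} (succ : α → Set α) (hsucc : ∀ a, (succ a).Countable)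
    {C : Set α} (hC : ∀ a ∈ C, succ a ⊆ C) (c : α) :
    ∃ C' : Set α, C ⊆ C' ∧ c ∈ C' ∧ (∀ a ∈ C', succ a ⊆ C') ∧ (C' \ C).Countable := by
  let D : ℕ → Set α := fun n => Nat.rec {c} (fun _ E => ⋃ a ∈ E, succ a) n
  have hD (n) : (D n).Countable := by
    induction n with
    | zero => exact Set.countable_singleton c
    | succ n ih => exact ih.biUnion fun a _ => hsucc a
  refine ⟨C ∪ ⋃ n, D n, Set.subset_union_left, Or.inr (Set.mem_iUnion.2 ⟨0, rfl⟩), ?_,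
    (Set.countable_iUnion hD).mono fun x hx => hx.1.resolve_left hx.2⟩
  rintro a (ha | ha)
  · exact (hC a ha).trans Set.subset_union_left
  · obtain ⟨n, hn⟩ := Set.mem_iUnion.1 ha
    exact fun x hx => Or.inr (Set.mem_iUnion.2 ⟨n + 1, Set.mem_biUnion hn hx⟩)

/-- If `s` is a section of `Finsupp.linearCombination R id` and `A ⊆ B` are stable under `s`, then
`span A` has a complement in `span B` which is the range of a projection of the whole module. -/
theorem Submodule.exists_projection_of_closed (s : M →ₗ[R] M →₀ R)
    (hs : Function.LeftInverse (Finsupp.linearCombination R id) s) {A B : Set M} (hAB : A ⊆ B)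
    (hA : ∀ a ∈ A, ((s a).support : Set M) ⊆ A) (hB : ∀ b ∈ B, ((s b).support : Set M) ⊆ B) :
    ∃ q : M →ₗ[R] M, (∀ x, q (q x) = q x) ∧ (∀ x ∈ span R A, q x = 0) ∧
      (∀ x ∈ span R B, x - q x ∈ span R A) ∧ ∀ x, q x ∈ span R B := by
  classical
  let π (C : Set M) : M →ₗ[R] M := Finsupp.linearCombination R (C.indicator id) ∘ₗ s
  have π_mem (C : Set M) (x) : π C x ∈ span R C := by
    simp only [π, LinearMap.comp_apply, Finsupp.linearCombination_apply]
    refine sum_mem fun i _ => smul_mem _ _ ?_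
    by_cases hi : i ∈ C
    · rw [Set.indicator_of_mem hi]; exact subset_span hi
    · rw [Set.indicator_of_notMem hi]; exact zero_mem _
  have π_eq (C : Set M) (hC : ∀ a ∈ C, ((s a).support : Set M) ⊆ C) (x) (hx : x ∈ span R C) :
      π C x = x := by
    refine LinearMap.eqOn_span (f := π C) (g := LinearMap.id) (fun a ha => ?_) hx
    conv_rhs => rw [LinearMap.id_apply, ← hs a]
    simp only [π, LinearMap.comp_apply, Finsupp.linearCombination_apply]
    exact Finsupp.sum_congr fun i hi => by rw [Set.indicator_of_mem (hC a ha hi)]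
  have hle : span R A ≤ span R B := span_mono hAB
  have hBA (x) : π B (π A x) = π A x := π_eq B hB _ (hle (π_mem A x))
  have hAA (x) : π A (π A x) = π A x := π_eq A hA _ (π_mem A x)
  have hBB (x) : π B (π B x) = π B x := π_eq B hB _ (π_mem B x)
  refine ⟨π B - π A ∘ₗ π B, fun x => ?_, fun x hx => ?_, fun x hx => ?_, fun x => ?_⟩
  · simp [hBA, hAA, hBB]
  · simp [π_eq B hB x (hle hx), π_eq A hA x hx]
  · simp [π_eq B hB x hx, π_mem]
  · exact sub_mem (π_mem B x) (hle (π_mem A _))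

theorem Submodule.exists_countable_span_range (q : M →ₗ[R] M) (hqq : ∀ x, q (q x) = q x)
    {A B : Set M} (hqA : ∀ x ∈ span R A, q x = 0) (hqB : ∀ x, q x ∈ span R B)
    (hc : (B \ A).Countable) :
    ∃ S : Set (LinearMap.range q), S.Countable ∧ span R S = ⊤ := by
  refine ⟨q.rangeRestrict '' (B \ A), hc.image _, eq_top_iff.2 ?_⟩
  rintro ⟨_, x, rfl⟩ -
  have h : span R B ≤ (span R (q.rangeRestrict '' (B \ A))).comap q.rangeRestrict := by
    refine span_le.2 fun b hb => ?_
    by_cases hbA : b ∈ A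
    · have : q.rangeRestrict b = 0 := Subtype.ext (hqA b (subset_span hbA))
      exact mem_comap.2 (this ▸ zero_mem _)
    · exact subset_span (Set.mem_image_of_mem _ ⟨hb, hbA⟩)
  have hx := h (hqB x)
  rwa [mem_comap, show q.rangeRestrict (q x) = ⟨q x, x, rfl⟩ from Subtype.ext (hqq x)] at hx

theorem Submodule.span_sup_range_eq_span {A B : Set M} (hAB : A ⊆ B) (q : M →ₗ[R] M)
    (h : ∀ x ∈ span R B, x - q x ∈ span R A) (h' : ∀ x, q x ∈ span R B) :
    span R A ⊔ LinearMap.range q = span R B := by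
  refine le_antisymm (sup_le (span_mono hAB) ?_) fun x hx => ?_
  · rintro _ ⟨x, rfl⟩
    exact h' x
  · exact mem_sup.2 ⟨_, h x hx, _, ⟨x, rfl⟩, sub_add_cancel _ _⟩

theorem Module.Projective.range_of_idempotent [Module.Projective R M] (q : M →ₗ[R] M)
    (hqq : ∀ x, q (q x) = q x) : Module.Projective R (LinearMap.range q) := by
  refine .of_split (LinearMap.range q).subtype q.rangeRestrict ?_
  ext ⟨_, x, rfl⟩
  exact hqq x

/-- Projective modules that are isomorphic modulo an ideal inside the radical are isomorphic. -/
theorem Module.Projective.nonempty_equiv (hI : I ≤ Ring.jacobson R)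
    [Module.Projective R M] [Module.Projective R N] (f : M →ₗ[R] N) (g : N →ₗ[R] M)
    (hgf : ∀ x, x - g (f x) ∈ (I • ⊤ : Submodule R M))
    (hfg : ∀ y, y - f (g y) ∈ (I • ⊤ : Submodule R N)) :
    Nonempty (M ≃ₗ[R] N) := by
  obtain ⟨s, hs⟩ := Module.projective_def.1 ‹Module.Projective R M›
  obtain ⟨t, ht⟩ := Module.projective_def.1 ‹Module.Projective R N›
  let succ : M ⊕ N → Set (M ⊕ N) := Sum.elim
    (fun x => Sum.inl '' ((s x).support : Set M) ∪ Sum.inr '' ((t (f x)).support : Set N))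
    (fun y => Sum.inr '' ((t y).support : Set N) ∪ Sum.inl '' ((s (g y)).support : Set M))
  have hsucc (a) : (succ a).Countable := by
    rcases a with x | y <;>
    exact ((Finset.countable_toSet _).image _).union ((Finset.countable_toSet _).image _)
  let L (C : Set (M ⊕ N)) : Set M := Sum.inl ⁻¹' C
  let K (C : Set (M ⊕ N)) : Set N := Sum.inr ⁻¹' C
  have hLs (C) (hC : ∀ a ∈ C, succ a ⊆ C) (x) (hx : x ∈ L C) : ((s x).support : Set M) ⊆ L C :=
    fun z hz => hC _ hx (Or.inl (Set.mem_image_of_mem _ hz))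
  have hKt (C) (hC : ∀ a ∈ C, succ a ⊆ C) (y) (hy : y ∈ K C) : ((t y).support : Set N) ⊆ K C :=
    fun z hz => hC _ hy (Or.inl (Set.mem_image_of_mem _ hz))
  have hf (C) (hC : ∀ a ∈ C, succ a ⊆ C) (x) (hx : x ∈ span R (L C)) : f x ∈ span R (K C) := by
    refine (span_le (p := (span R (K C)).comap f)).2 (fun z hz => ?_) hx
    rw [SetLike.mem_coe, mem_comap, ← ht (f z), Finsupp.linearCombination_apply]
    exact sum_mem fun i hi => smul_mem _ _ <|
      subset_span (hC _ hz (Or.inr (Set.mem_image_of_mem _ hi)))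
  have hg (C) (hC : ∀ a ∈ C, succ a ⊆ C) (y) (hy : y ∈ span R (K C)) : g y ∈ span R (L C) := by
    refine (span_le (p := (span R (L C)).comap g)).2 (fun z hz => ?_) hy
    rw [SetLike.mem_coe, mem_comap, ← hs (g z), Finsupp.linearCombination_apply]
    exact sum_mem fun i hi => smul_mem _ _ <|
      subset_span (hC _ hz (Or.inr (Set.mem_image_of_mem _ hi)))
  -- Graphs of isomorphisms between the spans of the two halves of a closed set.
  let good : Set (Set (M ⊕ N) × Submodule R (M × N)) := { z | (∀ a ∈ z.1, succ a ⊆ z.1) ∧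
    z.2.map (LinearMap.fst R M N) = span R (L z.1) ∧
    z.2.map (LinearMap.snd R M N) = span R (K z.1) ∧ ∀ w ∈ z.2, w.1 = 0 ↔ w.2 = 0 }
  obtain ⟨⟨C, G⟩, ⟨hC, hG1, hG2, hG0⟩, hmax⟩ := zorn_le₀ good (by
    intro c hc hchain
    refine ⟨sSup c, ⟨?_, ?_, ?_, ?_⟩, fun z hz => le_sSup hz⟩
    · rintro a ⟨_, ⟨z, hz, rfl⟩, ha⟩
      exact ((hc hz).1 a ha).trans (le_sSup hz : z ≤ sSup c).1
    · have hL : L (sSup c).1 = ⋃ z : c, L z.1.1 := by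
        ext x; simp [L, Prod.fst_sSup]
      rw [hL, span_iUnion, Prod.snd_sSup, sSup_image', Submodule.map_iSup]
      exact iSup_congr fun z => (hc z.2).2.1
    · have hK : K (sSup c).1 = ⋃ z : c, K z.1.1 := by
        ext x; simp [K, Prod.fst_sSup]
      rw [hK, span_iUnion, Prod.snd_sSup, sSup_image', Submodule.map_iSup]
      exact iSup_congr fun z => (hc z.2).2.2.1
    · intro w hw
      rcases c.eq_empty_or_nonempty with rfl | hne
      · simp at hw
        simp [hw]
      · rw [Prod.snd_sSup, mem_sSup_of_directed (hne.image _)] at hw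
        · obtain ⟨_, ⟨z, hz, rfl⟩, hw⟩ := hw
          exact (hc hz).2.2.2 w hw
        · rintro _ ⟨z, hz, rfl⟩ _ ⟨z', hz', rfl⟩
          rcases hchain.total hz hz' with h | h
          · exact ⟨z'.2, ⟨z', hz', rfl⟩, h.2, le_rfl⟩
          · exact ⟨z.2, ⟨z, hz, rfl⟩, le_rfl, h.2⟩)
  have hCtop (c) : c ∈ C := by
    obtain ⟨C', hCC', hcC', hC', hcount⟩ := Set.exists_closed_insert succ hsucc hC c
    obtain ⟨p, hpp, hpC, hpC', hp⟩ := exists_projection_of_closed s hs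
      (Set.preimage_mono (f := Sum.inl) hCC') (hLs C hC) (hLs C' hC')
    obtain ⟨q, hqq, hqC, hqC', hq⟩ := exists_projection_of_closed t ht
      (Set.preimage_mono (f := Sum.inr) hCC') (hKt C hC) (hKt C' hC')
    obtain ⟨S, hS, hSspan⟩ := exists_countable_span_range p hpp hpC hp
      (hcount.preimage Sum.inl_injective)
    obtain ⟨T, hT, hTspan⟩ := exists_countable_span_range q hqq hqC hq
      (hcount.preimage Sum.inr_injective)
    have := range_of_idempotent p hpp
    have := range_of_idempotent q hqq
    obtain ⟨e⟩ := nonempty_equiv_of_countable hI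
      (q.rangeRestrict ∘ₗ f ∘ₗ (LinearMap.range p).subtype)
      (p.rangeRestrict ∘ₗ g ∘ₗ (LinearMap.range q).subtype)
      (by
        rintro ⟨_, x, rfl⟩
        have h := p.rangeRestrict.apply_mem_ideal_smul_top (hgf (p x))
        have h' := hpC _ (hg C hC _ (hqC' _ (hf C' hC' _ (hp x))))
        convert h using 1
        refine Subtype.ext ?_
        simp only [map_sub] at h'
        simp [hpp, ← sub_eq_zero.1 h'])
      (by
        rintro ⟨_, y, rfl⟩
        have h := q.rangeRestrict.apply_mem_ideal_smul_top (hfg (q y))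
        have h' := hqC _ (hf C hC _ (hpC' _ (hg C' hC' _ (hq y))))
        convert h using 1
        refine Subtype.ext ?_
        simp only [map_sub] at h'
        simp [hqq, ← sub_eq_zero.1 h'])
      hS hSspan hT hTspan
    let E : LinearMap.range p →ₗ[R] M × N :=
      (LinearMap.range p).subtype.prod ((LinearMap.range q).subtype ∘ₗ e.toLinearMap)
    have hE1 : (LinearMap.range E).map (LinearMap.fst R M N) = LinearMap.range p := by
      rw [← LinearMap.range_comp, LinearMap.fst_prod, range_subtype]
    have hE2 : (LinearMap.range E).map (LinearMap.snd R M N) = LinearMap.range q := by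
      rw [← LinearMap.range_comp, LinearMap.snd_prod, LinearEquiv.range_comp, range_subtype]
    refine (hmax (y := (C', G ⊔ LinearMap.range E)) ⟨hC', ?_, ?_, ?_⟩ ⟨hCC', le_sup_left⟩).1 hcC'
    · rw [Submodule.map_sup, hE1, hG1]
      exact span_sup_range_eq_span (Set.preimage_mono hCC') p hpC' hp
    · rw [Submodule.map_sup, hE2, hG2]
      exact span_sup_range_eq_span (Set.preimage_mono hCC') q hqC' hq
    · intro w hw
      obtain ⟨w, hwG, _, ⟨⟨_, x, rfl⟩, rfl⟩, rfl⟩ := mem_sup.1 hw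
      obtain ⟨y, hy⟩ := (e ⟨p x, x, rfl⟩).2
      have hw1 : p w.1 = 0 := hpC _ (hG1 ▸ mem_map_of_mem hwG)
      have hw2 : q w.2 = 0 := hqC _ (hG2 ▸ mem_map_of_mem hwG)
      have hE : E ⟨p x, x, rfl⟩ = (p x, q y) := Prod.ext rfl hy.symm
      rw [hE]
      constructor
      · intro h
        have hx : p x = 0 := by simpa [hw1, hpp] using congrArg p h
        have hy0 : q y = 0 := by
          rw [hy, show (⟨p x, x, rfl⟩ : LinearMap.range p) = 0 from Subtype.ext hx]; simp
        have h1 : w.1 = 0 := by simpa [hx] using h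
        simpa [hy0] using (hG0 w hwG).1 h1
      · intro h
        have hy0 : q y = 0 := by simpa [hw2, hqq] using congrArg q h
        have hx : p x = 0 := by
          have : e ⟨p x, x, rfl⟩ = 0 := Subtype.ext (hy.symm.trans hy0)
          exact congrArg Subtype.val ((LinearEquiv.map_eq_zero_iff e).1 this)
        have h2 : w.2 = 0 := by simpa [hy0] using h
        simpa [hx] using (hG0 w hwG).2 h2
  have hL : span R (L C) = ⊤ := by
    rw [show L C = Set.univ from Set.eq_univ_of_forall fun x => hCtop _, span_univ]
  have hK : span R (K C) = ⊤ := by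
    rw [show K C = Set.univ from Set.eq_univ_of_forall fun x => hCtop _, span_univ]
  have bij1 : Function.Bijective (LinearMap.fst R M N ∘ₗ G.subtype) := by
    refine ⟨?_, ?_⟩
    · rw [← LinearMap.ker_eq_bot, LinearMap.ker_eq_bot']
      exact fun w hw => Subtype.ext (Prod.ext hw ((hG0 w w.2).1 hw))
    · rw [← LinearMap.range_eq_top, LinearMap.range_comp, range_subtype, hG1, hL]
  have bij2 : Function.Bijective (LinearMap.snd R M N ∘ₗ G.subtype) := by
    refine ⟨?_, ?_⟩
    · rw [← LinearMap.ker_eq_bot, LinearMap.ker_eq_bot']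
      exact fun w hw => Subtype.ext (Prod.ext ((hG0 w w.2).2 hw) hw)
    · rw [← LinearMap.range_eq_top, LinearMap.range_comp, range_subtype, hG2, hK]
  exact ⟨(LinearEquiv.ofBijective _ bij1).symm.trans (LinearEquiv.ofBijective _ bij2)⟩

theorem Module.Projective.nonempty_equiv_iff_quotient (hI : I ≤ Ring.jacobson R)
    [Module.Projective R M] [Module.Projective R N] :
    Nonempty (M ≃ₗ[R] N) ↔
      Nonempty ((M ⧸ (I • ⊤ : Submodule R M)) ≃ₗ[R] (N ⧸ (I • ⊤ : Submodule R N))) := by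
  constructor
  · rintro ⟨e⟩
    refine ⟨Quotient.equiv _ _ e ?_⟩
    exact (map_smul'' I ⊤ e.toLinearMap).trans (by rw [Submodule.map_top, LinearEquiv.range])
  · rintro ⟨e⟩
    obtain ⟨f, hf⟩ := Module.projective_lifting_property (mkQ (I • ⊤ : Submodule R N))
      (e.toLinearMap ∘ₗ mkQ _) (mkQ_surjective _)
    obtain ⟨g, hg⟩ := Module.projective_lifting_property (mkQ (I • ⊤ : Submodule R M))
      (e.symm.toLinearMap ∘ₗ mkQ _) (mkQ_surjective _)
    have hf' (x) : mkQ _ (f x) = e (mkQ _ x) := DFunLike.congr_fun hf x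
    have hg' (y) : mkQ _ (g y) = e.symm (mkQ _ y) := DFunLike.congr_fun hg y
    refine nonempty_equiv hI f g (fun x => ?_) fun y => ?_
    · rw [← Submodule.Quotient.mk_eq_zero, ← mkQ_apply, map_sub, hg', hf',
        LinearEquiv.symm_apply_apply, sub_self]
    · rw [← Submodule.Quotient.mk_eq_zero, ← mkQ_apply, map_sub, hf', hg',
        LinearEquiv.apply_symm_apply, sub_self]

end Decomposition

theorem Finsupp.ideal_smul_top_eq_ker {R : Type*} [Ring R] (I : Ideal R) [I.IsTwoSided]
    (ι : Type*) :
    (I • ⊤ : Submodule R (ι →₀ R)) = LinearMap.ker (Finsupp.mapRange.linearMap (α := ι) I.mkQ) := by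
  apply le_antisymm
  · rw [Submodule.smul_le]
    intro r hr x _
    rw [LinearMap.mem_ker]
    ext i
    have h : I.mkQ (r * x i) = 0 :=
      (Submodule.Quotient.mk_eq_zero I).2 (I.mul_mem_right (x i) hr)
    exact h
  · intro x hx
    rw [← x.sum_single]
    refine sum_mem fun i _ => ?_
    have hi : x i ∈ I :=
      (Submodule.Quotient.mk_eq_zero I).1 (DFunLike.congr_fun (LinearMap.mem_ker.1 hx) i)
    have := Submodule.smul_mem_smul hi (Submodule.mem_top (x := Finsupp.single i (1 : R)))
    simpa using this

theorem Finsupp.nonempty_quotient_ideal_smul_top_equiv {R : Type*} [Ring R] (I : Ideal R)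
    [I.IsTwoSided] (ι : Type*) :
    Nonempty (((ι →₀ R) ⧸ (I • ⊤ : Submodule R (ι →₀ R))) ≃ₗ[R] (ι →₀ R ⧸ I)) :=
  ⟨(Submodule.quotEquivOfEq _ _ (ideal_smul_top_eq_ker I ι)).trans
    (LinearMap.quotKerEquivOfSurjective _
      (Finsupp.mapRange_surjective _ (map_zero _) I.mkQ_surjective))⟩

/-- **Bass's theorem.** Let `R` be a (possibly noncommutative) ring and `I` a two-sided
ideal of `R` contained in the Jacobson radical of `R` (the intersection of all maximal
left ideals, i.e. `Ideal.jacobson ⊥`).  Let `P` and `Q` be projective left `R`-modules.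
Then `P ≅ Q` as `R`-modules if and only if `P/IP ≅ Q/IQ` as `R/I`-modules; since the
`R/I`-module structure on the quotients is induced from the `R`-module structure, an
isomorphism of `R/I`-modules between them is the same thing as an `R`-linear isomorphism.
In particular, `P` is a free `R`-module if and only if `P/IP` is a free `R/I`-module,
i.e. iff `P/IP` is isomorphic to a direct sum of copies of `R/I`. -/
theorem bass_theorem {R : Type} [Ring R] (I : Ideal R)
    (hI_twoSided : ∀ a b : R, a ∈ I → a * b ∈ I)
    (hI_rad : I ≤ Ideal.jacobson ⊥)
    (P Q : Type) [AddCommGroup P] [Module R P] [AddCommGroup Q] [Module R Q]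
    (hP : Module.Projective R P) (hQ : Module.Projective R Q) :
    (Nonempty (P ≃ₗ[R] Q) ↔
      Nonempty ((P ⧸ (I • ⊤ : Submodule R P)) ≃ₗ[R] (Q ⧸ (I • ⊤ : Submodule R Q)))) ∧
    (Module.Free R P ↔
      ∃ (ι : Type), Nonempty ((P ⧸ (I • ⊤ : Submodule R P)) ≃ₗ[R] (ι →₀ R ⧸ I))) := by
  have : I.IsTwoSided := ⟨fun {a} b ha => hI_twoSided a b ha⟩
  have hI : I ≤ Ring.jacobson R := by
    rw [Ring.jacobson_eq_sInf_isMaximal]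
    exact hI_rad.trans (sInf_le_sInf fun J hJ => ⟨bot_le, hJ⟩)
  refine ⟨Module.Projective.nonempty_equiv_iff_quotient hI, ?_⟩
  have free_iff (ι : Type) : Nonempty (P ≃ₗ[R] (ι →₀ R)) ↔
      Nonempty ((P ⧸ (I • ⊤ : Submodule R P)) ≃ₗ[R] (ι →₀ R ⧸ I)) := by
    obtain ⟨e⟩ := Finsupp.nonempty_quotient_ideal_smul_top_equiv I ι
    rw [Module.Projective.nonempty_equiv_iff_quotient hI]
    exact ⟨fun ⟨h⟩ => ⟨h.trans e⟩, fun ⟨h⟩ => ⟨h.trans e.symm⟩⟩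
  constructor
  · intro h
    obtain ⟨⟨ι, b⟩⟩ := h.exists_basis
    exact ⟨ι, (free_iff ι).1 ⟨b.repr⟩⟩
  · rintro ⟨ι, h⟩
    obtain ⟨e⟩ := (free_iff ι).2 h
    exact Module.Free.of_equiv e.symm
end

section
/- Let S be a subring of a ring T and let φ : T → S be a ring homomorphism with φ(s) = s for every s ∈ S. Then T is 𝒫ℱ (every finitely generated projective left T-module is free) if and only if S is 𝒫ℱ and every finitely generated projective left T-module is extended from S. -/
universe u

/-- `M ≅ T ⊗_S M₀` expressed via the universal property of base change (Mathlib's tensor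
product requires a commutative base ring, so we use the universal property instead). -/
def IsTensorExtension {S T : Type u} [Ring S] [Ring T] (φ : S →+* T)
    (M₀ : Type u) [AddCommGroup M₀] [Module S M₀]
    (M : Type u) [AddCommGroup M] [Module T M] : Prop :=
  ∃ f : M₀ →+ M,
    (∀ (s : S) (m : M₀), f (s • m) = φ s • f m) ∧
    ∀ (N : Type u) (_ : AddCommGroup N) (_ : Module T N) (g : M₀ →+ N),
      (∀ (s : S) (m : M₀), g (s • m) = φ s • g m) →
      ∃! h : M →ₗ[T] N, ∀ m₀ : M₀, h (f m₀) = g m₀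

/-- A `T`-module `M` is extended from `S` (along the inclusion `φ : S →+* T`) if there
exists an `S`-module `M₀` with `M ≅ T ⊗_S M₀` as `T`-modules. -/
def ExtendedFrom {S T : Type u} [Ring S] [Ring T] (φ : S →+* T)
    (M : Type u) [AddCommGroup M] [Module T M] : Prop :=
  ∃ (M₀ : Type u) (_ : AddCommGroup M₀) (_ : Module S M₀), IsTensorExtension φ M₀ M

/-- A ring `B` is `𝒫ℱ` if every finitely generated projective left `B`-module is free. -/
def IsPF (B : Type u) [Ring B] : Prop :=
  ∀ (M : Type u) (_ : AddCommGroup M) (_ : Module B M),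
    Module.Finite B M → Module.Projective B M → Module.Free B M

section TensorExtension

variable {S T : Type u} [Ring S] [Ring T] {φ : S →+* T}
  {M₀ : Type u} [AddCommGroup M₀] [Module S M₀] {M : Type u} [AddCommGroup M] [Module T M]

theorem IsTensorExtension.projective (h : IsTensorExtension φ M₀ M) [Module.Projective S M₀] :
    Module.Projective T M := by
  obtain ⟨f, hf, huniv⟩ := h
  refine Module.Projective.of_lifting_property'' fun p hp => ?_
  let : Module S M := Module.compHom M φ
  let : Module S (M →₀ T) := Module.compHom (M →₀ T) φ
  let p' : (M →₀ T) →ₗ[S] M := { p with map_smul' := fun s x => p.map_smul (φ s) x }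
  let f' : M₀ →ₗ[S] M := { f with map_smul' := hf }
  obtain ⟨g, hg⟩ := Module.projective_lifting_property p' f' hp
  obtain ⟨k, hk, -⟩ := huniv (M →₀ T) _ _ g.toAddMonoidHom fun s m => g.map_smul s m
  obtain ⟨_, -, hu⟩ := huniv M _ _ f hf
  refine ⟨k, (hu _ fun m => ?_).trans (hu LinearMap.id fun _ => rfl).symm⟩
  exact (congrArg p (hk m)).trans (LinearMap.congr_fun hg m)

theorem IsTensorExtension.finite (h : IsTensorExtension φ M₀ M) [Module.Finite S M₀] :
    Module.Finite T M := by
  obtain ⟨f, hf, huniv⟩ := h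
  obtain ⟨G, hG⟩ := Module.Finite.fg_top (R := S) (M := M₀)
  let K : Submodule T M := Submodule.span T (f '' G)
  have hK : ∀ m, f m ∈ K := fun m => by
    have hm : m ∈ Submodule.span S (G : Set M₀) := hG ▸ Submodule.mem_top
    induction hm using Submodule.span_induction with
    | mem x hx => exact Submodule.subset_span ⟨x, hx, rfl⟩
    | zero => simp
    | add x y _ _ hx hy => simpa using K.add_mem hx hy
    | smul s x _ hx => simpa [hf] using K.smul_mem (φ s) hx
  obtain ⟨_, -, hu⟩ := huniv (M ⧸ K) _ _ 0 (by simp)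
  have hq : K.mkQ = 0 := (hu _ fun m => by simpa using hK m).trans (hu 0 fun _ => rfl).symm
  have htop : K = ⊤ := by rw [← K.ker_mkQ, hq, LinearMap.ker_zero]
  classical
  exact ⟨⟨G.image f, by simpa [K] using htop⟩⟩

theorem IsTensorExtension.free (h : IsTensorExtension φ M₀ M) [Module.Free S M₀] :
    Module.Free T M := by
  obtain ⟨f, hf, huniv⟩ := h
  let b := Module.Free.chooseBasis S M₀
  let I := Module.Free.ChooseBasisIndex S M₀
  let : Module S M := Module.compHom M φ
  let : Module S (I →₀ T) := Module.compHom (I →₀ T) φ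
  let f' : M₀ →ₗ[S] M := { f with map_smul' := hf }
  let g : M₀ →ₗ[S] (I →₀ T) := b.constr ℕ fun i => Finsupp.single i 1
  obtain ⟨k, hk, -⟩ := huniv (I →₀ T) _ _ g.toAddMonoidHom fun s m => g.map_smul s m
  have hk' : ∀ m, k (f m) = g m := hk
  let l : (I →₀ T) →ₗ[T] M := Finsupp.linearCombination T fun i => f (b i)
  let l' : (I →₀ T) →ₗ[S] M := { l with map_smul' := fun s x => l.map_smul (φ s) x }
  have hl : l' ∘ₗ g = f' := b.ext fun i => by
    change l (g (b i)) = f (b i)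
    simp [g, l]
  obtain ⟨_, -, hu⟩ := huniv M _ _ f hf
  refine Module.Free.of_equiv (LinearEquiv.ofLinearMap l k ?_ ?_)
  · refine (hu _ fun m => ?_).trans (hu LinearMap.id fun _ => rfl).symm
    exact (congrArg l (hk' m)).trans (LinearMap.congr_fun hl m)
  · refine Finsupp.lhom_ext' fun i => LinearMap.ext_ring ?_
    simp [l, hk', g]

/-- If `φ` is a retraction of `ι`, extending scalars along `ι` and then along `φ` recovers
the original module. -/
theorem IsTensorExtension.of_retraction {ι : S →+* T} {ρ : T →+* S}
    (hρ : ρ.comp ι = RingHom.id S) (h : IsTensorExtension ι M₀ M) :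
    IsTensorExtension ρ M M₀ := by
  obtain ⟨f, hf, huniv⟩ := h
  have hρ' : ∀ s, ρ (ι s) = s := fun s => RingHom.congr_fun hρ s
  let : Module T M₀ := Module.compHom M₀ ρ
  obtain ⟨p, hp, -⟩ := huniv M₀ _ ‹_› (AddMonoidHom.id M₀) fun s m => by
    change s • m = ρ (ι s) • m
    rw [hρ']
  have hp' : ∀ m, p (f m) = m := hp
  refine ⟨p.toAddMonoidHom, fun t m => p.map_smul t m, fun N _ _ g hg => ?_⟩
  let : Module T N := Module.compHom N ρ
  let k : M₀ →ₗ[S] N :=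
    { g.comp f with
      map_smul' := fun s m => by
        change g (f (s • m)) = s • g (f m)
        rw [hf, hg, hρ'] }
  let g' : M →ₗ[T] N := { g with map_smul' := hg }
  let k' : M₀ →ₗ[T] N := { k with map_smul' := fun t m => k.map_smul (ρ t) m }
  obtain ⟨_, -, hu⟩ := huniv N _ ‹_› (g.comp f) fun s m => by
    change g (f (s • m)) = ρ (ι s) • g (f m)
    rw [hf, hg]
  have hkg : k' ∘ₗ p = g' :=
    (hu _ fun m => congrArg (fun x => g (f x)) (hp' m)).trans (hu g' fun _ => rfl).symm
  refine ⟨k, fun m => LinearMap.congr_fun hkg m, fun q hq => LinearMap.ext fun m => ?_⟩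
  exact (congrArg q (hp' m)).symm.trans (hq (f m))

theorem extendedFrom_of_free (φ : S →+* T) [Module.Free T M] : ExtendedFrom φ M := by
  let b := Module.Free.chooseBasis T M
  let I := Module.Free.ChooseBasisIndex T M
  let : Module S M := Module.compHom M φ
  let f : (I →₀ S) →ₗ[S] M := Finsupp.linearCombination S b
  have hfs : ∀ i, f (Finsupp.single i 1) = b i := fun i => by simp [f]
  refine ⟨I →₀ S, _, _, f.toAddMonoidHom, fun s m => f.map_smul s m, fun N _ _ g hg => ?_⟩
  let : Module S N := Module.compHom N φ
  let g' : (I →₀ S) →ₗ[S] N := { g with map_smul' := hg }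
  let k : M →ₗ[T] N := b.constr ℕ fun i => g (Finsupp.single i 1)
  let k' : M →ₗ[S] N := { k with map_smul' := fun s m => k.map_smul (φ s) m }
  have hk : k' ∘ₗ f = g' := by
    refine Finsupp.lhom_ext' fun i => LinearMap.ext_ring ?_
    change k (f (Finsupp.single i 1)) = g (Finsupp.single i 1)
    rw [hfs]
    simp [k]
  refine ⟨k, fun m => LinearMap.congr_fun hk m, fun q hq => b.ext fun i => ?_⟩
  have hqi : q (f (Finsupp.single i 1)) = g (Finsupp.single i 1) := hq _
  rw [← hfs, hqi, hfs]
  simp [k]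

/-- The relations on the free `T`-module on `M₀` that define the extension of scalars. -/
noncomputable def extensionRelations (φ : S →+* T) (M₀ : Type u) [AddCommGroup M₀] [Module S M₀] :
    Submodule T (M₀ →₀ T) :=
  Submodule.span T
    ({x | ∃ m n : M₀, x = Finsupp.single (m + n) 1 - (Finsupp.single m 1 + Finsupp.single n 1)} ∪
      {x | ∃ (s : S) (m : M₀), x = Finsupp.single (s • m) 1 - φ s • Finsupp.single m 1})

theorem isTensorExtension_quotient (φ : S →+* T) :
    IsTensorExtension φ M₀ ((M₀ →₀ T) ⧸ extensionRelations φ M₀) := by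
  let K := extensionRelations φ M₀
  refine ⟨AddMonoidHom.mk' (fun m => K.mkQ (Finsupp.single m 1)) fun m n => ?_,
    fun s m => ?_, fun N _ _ g hg => ?_⟩
  · rw [← map_add]
    exact (Submodule.Quotient.eq K).2 (Submodule.subset_span (Or.inl ⟨m, n, rfl⟩))
  · change K.mkQ _ = φ s • K.mkQ _
    rw [← map_smul]
    exact (Submodule.Quotient.eq K).2 (Submodule.subset_span (Or.inr ⟨s, m, rfl⟩))
  · let k : (M₀ →₀ T) →ₗ[T] N := Finsupp.linearCombination T g
    have hK : K ≤ LinearMap.ker k := Submodule.span_le.2 <| by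
      rintro _ (⟨m, n, rfl⟩ | ⟨s, m, rfl⟩)
      · simp [k]
      · simp only [SetLike.mem_coe, LinearMap.mem_ker, map_sub, map_smul]
        simp [k, hg]
    refine ⟨K.liftQ k hK, fun m => ?_, fun q hq => ?_⟩
    · change k (Finsupp.single m 1) = g m
      simp [k]
    · refine Submodule.linearMap_qext _ (Finsupp.lhom_ext' fun m => LinearMap.ext_ring ?_)
      refine (hq m).trans ?_
      change g m = k (Finsupp.single m 1)
      simp [k]

end TensorExtension

/-- Let `S` be a subring of a ring `T` (inclusion `ι : S →+* T` injective) and let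
`φ : T →+* S` be a ring homomorphism with `φ(s) = s` for every `s ∈ S` (`φ ∘ ι = id`).
Then `T` is `𝒫ℱ` (every finitely generated projective left `T`-module is free) if and
only if `S` is `𝒫ℱ` and every finitely generated projective left `T`-module is extended
from `S`. -/
theorem isPF_iff_isPF_and_extended {S T : Type u} [Ring S] [Ring T]
    (ι : S →+* T) (hι : Function.Injective ι)
    (φ : T →+* S) (hretr : φ.comp ι = RingHom.id S) :
    IsPF T ↔
      (IsPF S ∧
        ∀ (M : Type u) (_ : AddCommGroup M) (_ : Module T M),
          Module.Finite T M → Module.Projective T M → ExtendedFrom ι M) := by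
  constructor
  · refine fun hT => ⟨fun P _ _ _ _ => ?_, fun M _ _ hfin hproj => ?_⟩
    · have h := isTensorExtension_quotient (M₀ := P) ι
      have := hT _ _ _ h.finite h.projective
      exact (h.of_retraction hretr).free
    · have := hT M _ _ hfin hproj
      exact extendedFrom_of_free ι
  · rintro ⟨hS, hext⟩ M _ _ hfin hproj
    obtain ⟨M₀, _, _, h⟩ := hext M _ _ hfin hproj
    have h' := h.of_retraction hretr
    have := hS M₀ _ _ h'.finite h'.projective
    exact h.free
end

section
/- Let B be a commutative ring and S a multiplicatively closed subset of B. Let F(X) ∈ M_{r×s}(B[x₁,…,xₙ]), G(X) ∈ M_{s×t}(B[x₁,…,xₙ]) and H(X) ∈ M_{r×t}(B[x₁,…,xₙ]) be matrices over the polynomial ring, and for a matrix L(X) let L̄(X) denote its image under the canonical ring homomorphism B[x₁,…,xₙ] → (S⁻¹B)[x₁,…,xₙ]. Suppose that F̄(X)·Ḡ(X) = H̄(X) over (S⁻¹B)[x₁,…,xₙ] and that F(0)·G(0) = H(0) over B. Then there exists s ∈ S such that F(sx₁,…,sxₙ)·G(sx₁,…,sxₙ) = H(sx₁,…,sxₙ)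 over B[x₁,…,xₙ]. -/
/-- Finitely many elements that vanish in a localization are killed by a common denominator. -/
theorem IsLocalization.exists_forall_mem_mul_eq_zero {ι R : Type*} [CommRing R] (S : Submonoid R)
    (A : Type*) [CommRing A] [Algebra R A] [IsLocalization S A] (T : Finset ι) (f : ι → R)
    (hf : ∀ i ∈ T, algebraMap R A (f i) = 0) : ∃ a ∈ S, ∀ i ∈ T, a * f i = 0 := by
  have h : ∀ i, ∃ c : S, i ∈ T → (c : R) * f i = 0 := fun i => by
    by_cases hi : i ∈ T
    · obtain ⟨c, hc⟩ := (IsLocalization.map_eq_zero_iff S A (f i)).1 (hf i hi)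
      exact ⟨c, fun _ => hc⟩
    · exact ⟨1, fun h => absurd h hi⟩
  choose c hc using h
  refine ⟨∏ i ∈ T, (c i : R), prod_mem fun i _ => (c i).2, fun i hi => ?_⟩
  obtain ⟨d, hd⟩ := Finset.dvd_prod_of_mem (fun i => (c i : R)) hi
  rw [hd, mul_right_comm, hc i hi, zero_mul]

/-- If `a` kills every coefficient of a polynomial without constant term, then substituting
`a * X i` for each variable `X i` gives zero. -/
theorem MvPolynomial.aeval_C_mul_X_eq_zero {σ R : Type*} [CommRing R] {a : R}
    {p : MvPolynomial σ R} (h0 : constantCoeff p = 0) (ha : ∀ d ∈ p.support, a * p.coeff d = 0) :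
    aeval (fun i => C a * X i : σ → MvPolynomial σ R) p = 0 := by
  rw [aeval_def, eval₂_eq]
  refine Finset.sum_eq_zero fun d hd => ?_
  have hd0 : d ≠ 0 := by
    rintro rfl
    exact mem_support_iff.1 hd h0
  obtain ⟨i, hi⟩ := Finsupp.support_nonempty_iff.2 hd0
  have hdvd : (C a : MvPolynomial σ R) ∣ ∏ i ∈ d.support, (C a * X i) ^ d i :=
    ((dvd_mul_right _ _).trans (dvd_pow_self _ (Finsupp.mem_support_iff.1 hi))).trans
      (Finset.dvd_prod_of_mem (fun i => (C a * X i : MvPolynomial σ R) ^ d i) hi)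
  obtain ⟨q, hq⟩ := hdvd
  rw [hq, algebraMap_eq, ← mul_assoc, ← C_mul, mul_comm _ a, ha d hd, C_0, zero_mul]


/-- Let `B` be a commutative ring and `S` a multiplicatively closed subset of `B`.
Let `F(X) ∈ M_{r×s}(B[x₁,…,xₙ])`, `G(X) ∈ M_{s×t}(B[x₁,…,xₙ])` and
`H(X) ∈ M_{r×t}(B[x₁,…,xₙ])`, and for a matrix `L(X)` let `L̄(X)` denote its image
under the canonical homomorphism `B[x₁,…,xₙ] → (S⁻¹B)[x₁,…,xₙ]`.  Suppose that
`F̄(X)·Ḡ(X) = H̄(X)` over `(S⁻¹B)[x₁,…,xₙ]` and that `F(0)·G(0) = H(0)` over `B`.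
Then there exists `s₀ ∈ S` such that
`F(s₀x₁,…,s₀xₙ)·G(s₀x₁,…,s₀xₙ) = H(s₀x₁,…,s₀xₙ)` over `B[x₁,…,xₙ]`. -/
theorem exists_smul_var_mul_eq {B : Type} [CommRing B] (S : Submonoid B) (n r s t : ℕ)
    (F : Matrix (Fin r) (Fin s) (MvPolynomial (Fin n) B))
    (G : Matrix (Fin s) (Fin t) (MvPolynomial (Fin n) B))
    (H : Matrix (Fin r) (Fin t) (MvPolynomial (Fin n) B))
    (hloc :
      F.map (MvPolynomial.map (algebraMap B (Localization S))) *
        G.map (MvPolynomial.map (algebraMap B (Localization S))) =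
      H.map (MvPolynomial.map (algebraMap B (Localization S))))
    (h0 :
      F.map MvPolynomial.constantCoeff * G.map MvPolynomial.constantCoeff =
        H.map MvPolynomial.constantCoeff) :
    ∃ s₀ ∈ S,
      F.map (MvPolynomial.aeval
          (fun i : Fin n => MvPolynomial.C s₀ * MvPolynomial.X i) :
          MvPolynomial (Fin n) B → MvPolynomial (Fin n) B) *
        G.map (MvPolynomial.aeval
          (fun i : Fin n => MvPolynomial.C s₀ * MvPolynomial.X i) :
          MvPolynomial (Fin n) B → MvPolynomial (Fin n) B) =
      H.map (MvPolynomial.aeval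
          (fun i : Fin n => MvPolynomial.C s₀ * MvPolynomial.X i) :
          MvPolynomial (Fin n) B → MvPolynomial (Fin n) B) := by
  let P : Fin r × Fin t → MvPolynomial (Fin n) B := fun k => (F * G - H) k.1 k.2
  have hP0 : ∀ k, MvPolynomial.constantCoeff (P k) = 0 := fun k => by
    have h := congrFun₂ h0 k.1 k.2
    rw [← Matrix.map_mul] at h
    simpa [P, sub_eq_zero] using h
  have hPS : ∀ k, MvPolynomial.map (algebraMap B (Localization S)) (P k) = 0 := fun k => by
    have h := congrFun₂ hloc k.1 k.2
    rw [← Matrix.map_mul] at h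
    simpa [P, sub_eq_zero] using h
  obtain ⟨a, haS, ha⟩ := IsLocalization.exists_forall_mem_mul_eq_zero S (Localization S)
    (Finset.univ.sigma fun k => (P k).support) (fun x => (P x.1).coeff x.2) fun x _ => by
      rw [← MvPolynomial.coeff_map, hPS, MvPolynomial.coeff_zero]
  refine ⟨a, haS, ?_⟩
  rw [← Matrix.map_mul]
  ext1 i j
  have h := MvPolynomial.aeval_C_mul_X_eq_zero (hP0 (i, j)) fun d hd =>
    ha ⟨(i, j), d⟩ (Finset.mem_sigma.2 ⟨Finset.mem_univ _, hd⟩)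
  rw [Matrix.map_apply, Matrix.map_apply, ← sub_eq_zero, ← map_sub]
  exact h
end

section
/- Let B be a ring (not necessarily commutative) and let F'_j →^{β_j} F_j →^{α_j} M_j → 0 (j = 1, 2) be exact sequences of left B-modules with F_j and F'_j free. Then M₁ ≅ M₂ as B-modules if and only if there exist an automorphism α of F₁ ⊕ F₂ and an automorphism β of F'₁ ⊕ F₂ ⊕ F₁ ⊕ F'₂ such that the square commutes whose top horizontal map F'₁ ⊕ F₂ ⊕ F₁ ⊕ F'₂ → F₁ ⊕ F₂ sends (a, b, c, d) ↦ (β₁(a), b), whose bottom horizontal map sends (a, b, c, d) ↦ (c, β₂(d)), and whose vertical maps are β on the left and α on the right. -/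
universe u

/-- A linear map out of a projective module lifts along any linear map whose range contains
its range. -/
theorem exists_comp_eq_of_range_le {B A D N : Type*} [Ring B]
    [AddCommGroup A] [Module B A] [AddCommGroup D] [Module B D] [AddCommGroup N] [Module B N]
    [Module.Projective B A] (p : A →ₗ[B] N) (q : D →ₗ[B] N)
    (h : LinearMap.range p ≤ LinearMap.range q) :
    ∃ f : A →ₗ[B] D, ∀ x, q (f x) = p x := by
  obtain ⟨f, hf⟩ := Module.projective_lifting_property q.rangeRestrict
    (p.codRestrict (LinearMap.range q) fun x => h ⟨x, rfl⟩) q.surjective_rangeRestrict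
  exact ⟨f, fun x => congrArg Subtype.val (LinearMap.congr_fun hf x)⟩

/-- Schanuel's lemma as an automorphism: two linear maps with the same range and projective
domains `A` and `D` are exchanged by an automorphism of `A × D`. -/
theorem exists_linearEquiv_prod_of_range_eq {B A D N : Type*} [Ring B]
    [AddCommGroup A] [Module B A] [AddCommGroup D] [Module B D] [AddCommGroup N] [Module B N]
    [Module.Projective B A] [Module.Projective B D] (p : A →ₗ[B] N) (q : D →ₗ[B] N)
    (h : LinearMap.range p = LinearMap.range q) :
    ∃ e : (A × D) ≃ₗ[B] (A × D), ∀ x, q (e x).2 = p x.1 := by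
  obtain ⟨f, hf⟩ := exists_comp_eq_of_range_le p q h.le
  obtain ⟨g, hg⟩ := exists_comp_eq_of_range_le q p h.ge
  refine ⟨LinearEquiv.prodComm B A D ≪≫ₗ
    (LinearEquiv.refl B D).skewProd (LinearEquiv.refl B A) (-g) ≪≫ₗ
    LinearEquiv.prodComm B D A ≪≫ₗ
    (LinearEquiv.refl B A).skewProd (LinearEquiv.refl B D) f, fun x => ?_⟩
  simp [hf, hg]

/-- Two surjective linear maps with the same kernel have isomorphic codomains. -/
theorem nonempty_linearEquiv_of_ker_eq {B Q M N : Type*} [Ring B]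
    [AddCommGroup Q] [Module B Q] [AddCommGroup M] [Module B M] [AddCommGroup N] [Module B N]
    (p : Q →ₗ[B] M) (q : Q →ₗ[B] N) (hp : Function.Surjective p) (hq : Function.Surjective q)
    (h : LinearMap.ker p = LinearMap.ker q) : Nonempty (M ≃ₗ[B] N) :=
  ⟨(p.quotKerEquivOfSurjective hp).symm ≪≫ₗ Submodule.quotEquivOfEq _ _ h ≪≫ₗ
    q.quotKerEquivOfSurjective hq⟩

/-- Let `B` be a (not necessarily commutative) ring and let
`F'_j →^{β_j} F_j →^{α_j} M_j → 0` (`j = 1, 2`) be exact sequences of left `B`-modules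
with `F_j` and `F'_j` free.  Then `M₁ ≅ M₂` if and only if there exist an automorphism
`α` of `F₁ ⊕ F₂` and an automorphism `β` of `F'₁ ⊕ F₂ ⊕ F₁ ⊕ F'₂` making the square
commute whose top horizontal map sends `(a, b, c, d) ↦ (β₁(a), b)`, whose bottom
horizontal map sends `(a, b, c, d) ↦ (c, β₂(d))`, and whose vertical maps are `β` on
the left and `α` on the right. -/
theorem iso_iff_exists_automorphisms {B : Type u} [Ring B]
    (F₁' F₁ M₁ F₂' F₂ M₂ : Type u)
    [AddCommGroup F₁'] [Module B F₁'] [AddCommGroup F₁] [Module B F₁]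
    [AddCommGroup M₁] [Module B M₁] [AddCommGroup F₂'] [Module B F₂']
    [AddCommGroup F₂] [Module B F₂] [AddCommGroup M₂] [Module B M₂]
    [Module.Free B F₁'] [Module.Free B F₁] [Module.Free B F₂'] [Module.Free B F₂]
    (β₁ : F₁' →ₗ[B] F₁) (α₁ : F₁ →ₗ[B] M₁)
    (hα₁ : Function.Surjective α₁) (hexact₁ : Function.Exact β₁ α₁)
    (β₂ : F₂' →ₗ[B] F₂) (α₂ : F₂ →ₗ[B] M₂)
    (hα₂ : Function.Surjective α₂) (hexact₂ : Function.Exact β₂ α₂) :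
    Nonempty (M₁ ≃ₗ[B] M₂) ↔
      ∃ (α : (F₁ × F₂) ≃ₗ[B] (F₁ × F₂))
        (β : (F₁' × F₂ × F₁ × F₂') ≃ₗ[B] (F₁' × F₂ × F₁ × F₂')),
        ∀ v : F₁' × F₂ × F₁ × F₂',
          α (β₁ v.1, v.2.1) = ((β v).2.2.1, β₂ (β v).2.2.2) := by
  constructor
  · rintro ⟨φ⟩
    obtain ⟨α, hα⟩ := exists_linearEquiv_prod_of_range_eq (φ.toLinearMap ∘ₗ α₁) α₂ <| by
      rw [LinearMap.range_eq_top.2 hα₂, LinearMap.range_eq_top]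
      exact φ.surjective.comp hα₁
    have mem_iff (y : F₁ × F₂) : α₁ (α.symm y).1 = 0 ↔ α₂ y.2 = 0 := by
      have := hα (α.symm y)
      simp only [LinearEquiv.apply_symm_apply, LinearMap.comp_apply, LinearEquiv.coe_coe] at this
      rw [this, map_eq_zero_iff φ φ.injective]
    obtain ⟨β, hβ⟩ := exists_linearEquiv_prod_of_range_eq
      (α.toLinearMap ∘ₗ β₁.prodMap (LinearMap.id : F₂ →ₗ[B] F₂))
      ((LinearMap.id : F₁ →ₗ[B] F₁).prodMap β₂) <| by
      ext y
      trans α₁ (α.symm y).1 = 0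
      · rw [hexact₁]
        constructor
        · rintro ⟨x, rfl⟩
          exact ⟨x.1, by simp⟩
        · rintro ⟨a, ha⟩
          refine ⟨(a, (α.symm y).2), ?_⟩
          simp [ha]
      · rw [mem_iff, hexact₂]
        constructor
        · rintro ⟨d, hd⟩
          exact ⟨(y.1, d), by simp [hd]⟩
        · rintro ⟨x, rfl⟩
          exact ⟨x.2, by simp⟩
    let assoc := LinearEquiv.prodAssoc B F₁' F₂ (F₁ × F₂')
    refine ⟨α, assoc.symm ≪≫ₗ β ≪≫ₗ assoc, fun v => ?_⟩
    exact (hβ (assoc.symm v)).symm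
  · rintro ⟨α, β, h⟩
    refine nonempty_linearEquiv_of_ker_eq (α₁ ∘ₗ LinearMap.fst B F₁ F₂)
      (α₂ ∘ₗ LinearMap.snd B F₁ F₂ ∘ₗ α.toLinearMap) (hα₁.comp Prod.fst_surjective)
      (hα₂.comp (Prod.snd_surjective.comp α.surjective)) ?_
    ext x
    change α₁ x.1 = 0 ↔ α₂ (α x).2 = 0
    rw [hexact₁, hexact₂]
    constructor
    · rintro ⟨a, ha⟩
      refine ⟨(β (a, x.2, 0, 0)).2.2.2, ?_⟩
      have := h (a, x.2, 0, 0)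
      rw [ha] at this
      exact (congrArg Prod.snd this).symm
    · rintro ⟨d, hd⟩
      refine ⟨(β.symm (0, 0, (α x).1, d)).1, ?_⟩
      have := h (β.symm (0, 0, (α x).1, d))
      rw [LinearEquiv.apply_symm_apply, hd] at this
      exact congrArg Prod.fst (α.injective this)
end

section
/- Let B be a ring (not necessarily commutative), and let M₁ and M₂ be finitely presented left B-modules with presentations B^{m'} →^{β₁} B^m → M₁ → 0 and B^{n'} →^{β₂} B^n → M₂ → 0, where (using row notation, so that homomorphisms of free modules act by right multiplication of row vectors by matrices) β₁ is given by a matrix B₁ ∈ M_{m'×m}(B) and β₂ by B₂ ∈ M_{n'×n}(B). Then M₁ ≅ M₂ if and only if the two (m'+n+m+n') × (m+n) block matrices F := [[B₁, 0], [0, I_n], [0, 0], [0, 0]] and G := [[0, 0], [0, 0], [I_m, 0], [0, B₂]] are equivalent over B, i.e., F = P G Q for some invertible P ∈ GL_{m'+n+m+n'}(B) and Q ∈ GL_{m+n}(B). -/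
universe u

open Matrix in
/-- Two matrices whose rows lie in each other's row space become equivalent, by row operations
only, after padding with zero rows. -/
theorem exists_units_mul_fromRows_zero {R k l c : Type*} [Ring R]
    [Fintype k] [Fintype l] [DecidableEq k] [DecidableEq l]
    (F : Matrix k c R) (G : Matrix l c R) (X : Matrix k l R) (Y : Matrix l k R)
    (hX : X * G = F) (hY : Y * F = G) :
    ∃ P : (Matrix (k ⊕ l) (k ⊕ l) R)ˣ,
      fromRows F (0 : Matrix l c R) = P.val * fromRows (0 : Matrix k c R) G := by
  let S : (Matrix (k ⊕ l) (k ⊕ l) R)ˣ :=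
    ⟨fromBlocks 1 X 0 1, fromBlocks 1 (-X) 0 1,
      by simp [fromBlocks_multiply], by simp [fromBlocks_multiply]⟩
  let T : (Matrix (k ⊕ l) (k ⊕ l) R)ˣ :=
    ⟨fromBlocks 1 0 (-Y) 1, fromBlocks 1 0 Y 1,
      by simp [fromBlocks_multiply], by simp [fromBlocks_multiply]⟩
  refine ⟨T * S, ?_⟩
  rw [Units.val_mul, Matrix.mul_assoc]
  simp [S, T, fromBlocks_mul_fromRows, hX, hY]

open Matrix in
/-- A matrix whose rows all lie in the row space of `G` is a left multiple of `G`. -/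
theorem exists_mul_eq_of_row_mem_range_vecMul {R k l c : Type*} [Ring R] [Fintype l]
    (F : Matrix k c R) (G : Matrix l c R) (h : ∀ i, ∃ w, w ᵥ* G = F i) :
    ∃ X : Matrix k l R, X * G = F := by
  choose X hX using h
  exact ⟨of X, by ext i j; rw [mul_apply_eq_vecMul]; exact congrFun (hX i) j⟩

open Matrix in
/-- A linear map from a finite free module lifts, as a matrix, along a surjection from a finite
free module. -/
theorem exists_matrix_lift {R k l M : Type*} [Ring R] [Fintype k] [DecidableEq k]
    [AddCommGroup M] [Module R M] (f : (k → R) →ₗ[R] M) (g : (l → R) →ₗ[R] M)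
    (hg : Function.Surjective g) :
    ∃ A : Matrix k l R, ∀ x, g (x ᵥ* A) = f x := by
  obtain ⟨h, hh⟩ := Module.projective_lifting_property g f hg
  refine ⟨LinearMap.toMatrixRight' h, fun x => ?_⟩
  rw [← hh, LinearMap.comp_apply, ← Matrix.toLinearMapRight'_apply]
  exact congrArg g (LinearMap.congr_fun (LinearMap.toMatrixRight'.symm_apply_apply h) x)

open Matrix in
/-- If `F = P G Q` with `P`, `Q` invertible then the cokernels of `F` and `G` are isomorphic. -/
theorem nonempty_linearEquiv_of_equivalent {R r c M N : Type*} [Ring R]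
    [Fintype r] [DecidableEq r] [Fintype c] [DecidableEq c]
    [AddCommGroup M] [Module R M] [AddCommGroup N] [Module R N]
    {F G : Matrix r c R} {p : (c → R) →ₗ[R] M} {q : (c → R) →ₗ[R] N}
    (hp : Function.Surjective p) (hq : Function.Surjective q)
    (hpF : Function.Exact F.vecMulLinear p) (hqG : Function.Exact G.vecMulLinear q)
    (P : (Matrix r r R)ˣ) (Q : (Matrix c c R)ˣ) (h : F = P.val * G * Q.val) :
    Nonempty (M ≃ₗ[R] N) := by
  have hQ : Function.Surjective (Q⁻¹.val.vecMulLinear) := fun v => ⟨v ᵥ* Q.val, by simp⟩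
  have hker : LinearMap.ker p = LinearMap.ker (q ∘ₗ Q⁻¹.val.vecMulLinear) := by
    ext v
    rw [LinearMap.mem_ker, LinearMap.mem_ker, LinearMap.comp_apply, hpF v, hqG]
    constructor
    · rintro ⟨w, rfl⟩
      exact ⟨w ᵥ* P.val, by simp [h, Matrix.mul_assoc _ Q.val]⟩
    · rintro ⟨w, hw⟩
      refine ⟨w ᵥ* P⁻¹.val, ?_⟩
      have := congrArg (· ᵥ* Q.val) hw
      simpa [h, ← Matrix.mul_assoc] using this
  exact ⟨(p.quotKerEquivOfSurjective hp).symm ≪≫ₗ Submodule.quotEquivOfEq _ _ hker ≪≫ₗ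
    (q ∘ₗ Q⁻¹.val.vecMulLinear).quotKerEquivOfSurjective (hq.comp hQ)⟩

open Matrix in
/-- If the cokernels of `F` and `G` are isomorphic through an isomorphism induced by an
invertible matrix `Q`, then `F` and `G`, padded with zero rows, are equivalent. -/
theorem exists_equivalent_of_intertwining {R k l c M N : Type*} [Ring R]
    [Fintype k] [DecidableEq k] [Fintype l] [DecidableEq l] [Fintype c] [DecidableEq c]
    [AddCommGroup M] [Module R M] [AddCommGroup N] [Module R N]
    {F : Matrix k c R} {G : Matrix l c R} {p : (c → R) →ₗ[R] M} {q : (c → R) →ₗ[R] N}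
    (hpF : Function.Exact F.vecMulLinear p) (hqG : Function.Exact G.vecMulLinear q)
    (e : M ≃ₗ[R] N) (Q : (Matrix c c R)ˣ) (h : ∀ v, e (p (v ᵥ* Q.val)) = q v) :
    ∃ P : (Matrix (k ⊕ l) (k ⊕ l) R)ˣ, fromRows F (0 : Matrix l c R) =
      P.val * fromRows (0 : Matrix k c R) G * Q.val := by
  obtain ⟨X, hX⟩ : ∃ X : Matrix k l R, X * (G * Q.val) = F := by
    refine exists_mul_eq_of_row_mem_range_vecMul _ _ fun i => ?_
    obtain ⟨w, hw⟩ := (hqG (F i ᵥ* Q⁻¹.val)).1 (by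
      rw [← h, vecMul_vecMul, Units.inv_mul, vecMul_one, (hpF (F i)).2, map_zero]
      exact ⟨Pi.single i 1, by simp [row]⟩)
    refine ⟨w, ?_⟩
    rw [vecMulLinear_apply] at hw
    rw [← vecMul_vecMul, hw, vecMul_vecMul, Units.inv_mul, vecMul_one]
  obtain ⟨Y, hY⟩ : ∃ Y : Matrix l k R, Y * F = G * Q.val := by
    refine exists_mul_eq_of_row_mem_range_vecMul _ _ fun i => ?_
    refine (hpF _).1 (e.map_eq_zero_iff.1 ?_)
    rw [show (G * Q.val) i = G i ᵥ* Q.val from mul_apply_eq_vecMul _ _ _, h]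
    exact (hqG _).2 ⟨Pi.single i 1, by simp [row]⟩
  obtain ⟨P, hP⟩ := exists_units_mul_fromRows_zero F (G * Q.val) X Y hX hY
  exact ⟨P, by rw [hP, Matrix.mul_assoc, fromRows_mul, Matrix.zero_mul]⟩

open Matrix in
/-- Lifting an isomorphism and its inverse to matrices and combining them into an invertible
matrix that exchanges the two projections. -/
theorem exists_intertwining_units {R k l M N : Type*} [Ring R]
    [Fintype k] [DecidableEq k] [Fintype l] [DecidableEq l]
    [AddCommGroup M] [Module R M] [AddCommGroup N] [Module R N]
    (a : (k → R) →ₗ[R] M) (b : (l → R) →ₗ[R] N)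
    (ha : Function.Surjective a) (hb : Function.Surjective b) (e : M ≃ₗ[R] N) :
    ∃ Q : (Matrix (k ⊕ l) (k ⊕ l) R)ˣ, ∀ v,
      e ((a ∘ₗ LinearMap.funLeft R R Sum.inl) (v ᵥ* Q.val)) =
        (b ∘ₗ LinearMap.funLeft R R Sum.inr) v := by
  obtain ⟨A, hA⟩ := exists_matrix_lift (e.toLinearMap ∘ₗ a) b hb
  obtain ⟨C, hC⟩ := exists_matrix_lift (e.symm.toLinearMap ∘ₗ b) a ha
  let U : (Matrix (k ⊕ l) (k ⊕ l) R)ˣ :=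
    ⟨fromBlocks 1 (-A) 0 1, fromBlocks 1 A 0 1,
      by simp [fromBlocks_multiply], by simp [fromBlocks_multiply]⟩
  let V : (Matrix (k ⊕ l) (k ⊕ l) R)ˣ :=
    ⟨fromBlocks 1 0 C 1, fromBlocks 1 0 (-C) 1,
      by simp [fromBlocks_multiply], by simp [fromBlocks_multiply]⟩
  refine ⟨U * V, fun v => ?_⟩
  obtain ⟨x, y, rfl⟩ : ∃ x y, v = Sum.elim x y := ⟨_, _, (Sum.elim_comp_inl_inr v).symm⟩
  have hU : Sum.elim x y ᵥ* U.val = Sum.elim x (y - x ᵥ* A) := by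
    simp [U, vecMul_fromBlocks, vecMul_neg, sub_eq_neg_add]
  have hV : Sum.elim x (y - x ᵥ* A) ᵥ* V.val =
      Sum.elim (x + (y - x ᵥ* A) ᵥ* C) (y - x ᵥ* A) := by
    simp [V, vecMul_fromBlocks]
  have hl (s : k → R) (t : l → R) : LinearMap.funLeft R R Sum.inl (Sum.elim s t) = s := rfl
  have hr (s : k → R) (t : l → R) : LinearMap.funLeft R R Sum.inr (Sum.elim s t) = t := rfl
  rw [Units.val_mul, ← vecMul_vecMul, hU, hV, LinearMap.comp_apply, LinearMap.comp_apply, hl, hr,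
    map_add, hC, map_add]
  simp [hA]

open Matrix in
theorem exact_vecMulLinear_fromBlocks_inl {R k k' l M : Type*} [Ring R]
    [Fintype k'] [Fintype l] [DecidableEq l] [AddCommGroup M] [Module R M]
    {D : Matrix k' k R} {a : (k → R) →ₗ[R] M} (h : Function.Exact D.vecMulLinear a) :
    Function.Exact (fromBlocks D 0 0 (1 : Matrix l l R)).vecMulLinear
      (a ∘ₗ LinearMap.funLeft R R Sum.inl) := by
  intro v
  rw [LinearMap.comp_apply, h]
  constructor
  · rintro ⟨w, hw⟩
    refine ⟨Sum.elim w (v ∘ Sum.inr), ?_⟩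
    rw [vecMulLinear_apply] at hw
    rw [vecMulLinear_apply, vecMul_fromBlocks]
    ext (i | i)
    · simp [hw, LinearMap.funLeft_apply]
    · simp
  · rintro ⟨w, rfl⟩
    refine ⟨w ∘ Sum.inl, ?_⟩
    ext i
    simp [vecMul_fromBlocks, LinearMap.funLeft_apply]

open Matrix in
theorem exact_vecMulLinear_fromBlocks_inr {R k l l' N : Type*} [Ring R]
    [Fintype l'] [Fintype k] [DecidableEq k] [AddCommGroup N] [Module R N]
    {D : Matrix l' l R} {b : (l → R) →ₗ[R] N} (h : Function.Exact D.vecMulLinear b) :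
    Function.Exact (fromBlocks (1 : Matrix k k R) 0 0 D).vecMulLinear
      (b ∘ₗ LinearMap.funLeft R R Sum.inr) := by
  intro v
  rw [LinearMap.comp_apply, h]
  constructor
  · rintro ⟨w, hw⟩
    refine ⟨Sum.elim (v ∘ Sum.inl) w, ?_⟩
    rw [vecMulLinear_apply] at hw
    rw [vecMulLinear_apply, vecMul_fromBlocks]
    ext (i | i)
    · simp
    · simp [hw, LinearMap.funLeft_apply]
  · rintro ⟨w, rfl⟩
    refine ⟨w ∘ Sum.inr, ?_⟩
    ext i
    simp [vecMul_fromBlocks, LinearMap.funLeft_apply]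

open Matrix in
theorem exact_vecMulLinear_fromRows_zero_right {R k l c M : Type*} [Ring R]
    [Fintype k] [Fintype l] [AddCommGroup M] [Module R M]
    {F : Matrix k c R} {p : (c → R) →ₗ[R] M} (h : Function.Exact F.vecMulLinear p) :
    Function.Exact (fromRows F (0 : Matrix l c R)).vecMulLinear p := by
  intro v
  rw [h]
  constructor
  · rintro ⟨w, rfl⟩
    exact ⟨Sum.elim w 0, by simp [vecMul_fromRows]⟩
  · rintro ⟨w, rfl⟩
    exact ⟨w ∘ Sum.inl, by simp [vecMul_fromRows]⟩

open Matrix in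
theorem exact_vecMulLinear_fromRows_zero_left {R k l c M : Type*} [Ring R]
    [Fintype k] [Fintype l] [AddCommGroup M] [Module R M]
    {G : Matrix l c R} {q : (c → R) →ₗ[R] M} (h : Function.Exact G.vecMulLinear q) :
    Function.Exact (fromRows (0 : Matrix k c R) G).vecMulLinear q := by
  intro v
  rw [h]
  constructor
  · rintro ⟨w, rfl⟩
    exact ⟨Sum.elim 0 w, by simp [vecMul_fromRows]⟩
  · rintro ⟨w, rfl⟩
    exact ⟨w ∘ Sum.inr, by simp [vecMul_fromRows]⟩

/-- Let `B` be a (not necessarily commutative) ring and let `M₁`, `M₂` be finitely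
presented left `B`-modules with presentations `B^{m'} →^{β₁} B^m → M₁ → 0` and
`B^{n'} →^{β₂} B^n → M₂ → 0`, where (row notation) `β₁` is right multiplication by the
matrix `B₁ ∈ M_{m'×m}(B)` and `β₂` by `B₂ ∈ M_{n'×n}(B)`.  Then `M₁ ≅ M₂` if and only
if the two `(m'+n+m+n') × (m+n)` block matrices
`F := [[B₁, 0], [0, I_n], [0, 0], [0, 0]]` and `G := [[0, 0], [0, 0], [I_m, 0], [0, B₂]]`
are equivalent over `B`, i.e. `F = P G Q` for invertible square matrices `P`, `Q`.
The row index type is realized as `(Fin m' ⊕ Fin n) ⊕ (Fin m ⊕ Fin n')` and the column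
index type as `Fin m ⊕ Fin n`. -/
theorem iso_iff_block_matrices_equivalent {B : Type u} [Ring B]
    (m' m n' n : ℕ) (M₁ M₂ : Type u)
    [AddCommGroup M₁] [Module B M₁] [AddCommGroup M₂] [Module B M₂]
    (B₁ : Matrix (Fin m') (Fin m) B) (B₂ : Matrix (Fin n') (Fin n) B)
    (β₁ : (Fin m' → B) →ₗ[B] (Fin m → B)) (α₁ : (Fin m → B) →ₗ[B] M₁)
    (hβ₁ : ∀ (v : Fin m' → B) (j : Fin m), β₁ v j = ∑ i, v i * B₁ i j)
    (hα₁ : Function.Surjective α₁) (hexact₁ : Function.Exact β₁ α₁)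
    (β₂ : (Fin n' → B) →ₗ[B] (Fin n → B)) (α₂ : (Fin n → B) →ₗ[B] M₂)
    (hβ₂ : ∀ (v : Fin n' → B) (j : Fin n), β₂ v j = ∑ i, v i * B₂ i j)
    (hα₂ : Function.Surjective α₂) (hexact₂ : Function.Exact β₂ α₂) :
    Nonempty (M₁ ≃ₗ[B] M₂) ↔
      ∃ (P : (Matrix ((Fin m' ⊕ Fin n) ⊕ (Fin m ⊕ Fin n'))
              ((Fin m' ⊕ Fin n) ⊕ (Fin m ⊕ Fin n')) B)ˣ)
        (Q : (Matrix (Fin m ⊕ Fin n) (Fin m ⊕ Fin n) B)ˣ),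
        Matrix.fromRows (Matrix.fromBlocks B₁ 0 0 (1 : Matrix (Fin n) (Fin n) B))
            (0 : Matrix (Fin m ⊕ Fin n') (Fin m ⊕ Fin n) B) =
          P.val *
            Matrix.fromRows (0 : Matrix (Fin m' ⊕ Fin n) (Fin m ⊕ Fin n) B)
              (Matrix.fromBlocks (1 : Matrix (Fin m) (Fin m) B) 0 0 B₂) *
          Q.val := by
  obtain rfl : β₁ = B₁.vecMulLinear := LinearMap.ext fun v => funext (hβ₁ v)
  obtain rfl : β₂ = B₂.vecMulLinear := LinearMap.ext fun v => funext (hβ₂ v)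
  have hF := exact_vecMulLinear_fromBlocks_inl (l := Fin n) hexact₁
  have hG := exact_vecMulLinear_fromBlocks_inr (k := Fin m) hexact₂
  constructor
  · rintro ⟨e⟩
    obtain ⟨Q, hQ⟩ := exists_intertwining_units α₁ α₂ hα₁ hα₂ e
    obtain ⟨P, hP⟩ := exists_equivalent_of_intertwining hF hG e Q hQ
    exact ⟨P, Q, hP⟩
  · rintro ⟨P, Q, h⟩
    refine nonempty_linearEquiv_of_equivalent ?_ ?_
      (exact_vecMulLinear_fromRows_zero_right hF)
      (exact_vecMulLinear_fromRows_zero_left hG) P Q h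
    · exact hα₁.comp (LinearMap.funLeft_surjective_of_injective B B Sum.inl Sum.inl_injective)
    · exact hα₂.comp (LinearMap.funLeft_surjective_of_injective B B Sum.inr Sum.inr_injective)
end

section
/- (Quillen's patching theorem) Let R be a commutative ring, A := R[x₁,…,xₙ] the polynomial ring, and M a finitely presented A-module. Then M is extended from R (i.e., M ≅ A ⊗_R M₀ for some R-module M₀) if and only if for every maximal ideal 𝔪 of R, the module M_𝔪 := R_𝔪[x₁,…,xₙ] ⊗_A M is extended from R_𝔪. -/
open TensorProduct

namespace QuillenPatching

section Presentation

variable {B : Type*} [CommRing B] {p q : Type*} [Fintype q]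

/-- `Φ` is the relation matrix of a finite presentation of `P`. -/
def Presents (Φ : Matrix p q B) (P : Type*) [AddCommGroup P] [Module B P] : Prop :=
  ∃ π : (p → B) →ₗ[B] P, Function.Surjective π ∧ Function.Exact Φ.mulVecLin π

/-- The cokernel of the linear map given by a matrix. -/
abbrev Coker (Φ : Matrix p q B) : Type _ := (p → B) ⧸ LinearMap.range Φ.mulVecLin

theorem presents_coker (Φ : Matrix p q B) : Presents Φ (Coker Φ) :=
  ⟨Submodule.mkQ _, Submodule.mkQ_surjective _, LinearMap.exact_iff.2 (Submodule.ker_mkQ _)⟩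

variable {P P' : Type*} [AddCommGroup P] [Module B P] [AddCommGroup P'] [Module B P']

theorem Presents.congr {Φ : Matrix p q B} (h : Presents Φ P) (e : P ≃ₗ[B] P') :
    Presents Φ P' := by
  obtain ⟨π, hs, he⟩ := h
  refine ⟨e.toLinearMap ∘ₗ π, e.surjective.comp hs, fun x => ?_⟩
  rw [← he x]
  simp

theorem Presents.equiv {Φ : Matrix p q B} (h : Presents Φ P) (h' : Presents Φ P') :
    Nonempty (P ≃ₗ[B] P') := by
  obtain ⟨π, hs, he⟩ := h
  obtain ⟨π', hs', he'⟩ := h'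
  have hk : LinearMap.ker π = LinearMap.ker π' :=
    (LinearMap.exact_iff.1 he).trans (LinearMap.exact_iff.1 he').symm
  exact ⟨(π.quotKerEquivOfSurjective hs).symm ≪≫ₗ Submodule.quotEquivOfEq _ _ hk ≪≫ₗ
    π'.quotKerEquivOfSurjective hs'⟩

theorem exists_presents [Module.FinitePresentation B P] :
    ∃ (k l : ℕ) (Φ : Matrix (Fin k) (Fin l) B), Presents Φ P := by
  obtain ⟨k, K, e, hK⟩ := Module.FinitePresentation.exists_fin B P
  obtain ⟨l, f, hf⟩ := (Submodule.fg_iff_exists_fin_linearMap B (Fin k → B)).1 hK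
  have hΦ : (LinearMap.toMatrix' f).mulVecLin = f := by
    rw [← Matrix.toLin'_apply', Matrix.toLin'_toMatrix']
  subst hf
  refine ⟨k, l, LinearMap.toMatrix' f, Presents.congr (P := Coker (LinearMap.toMatrix' f))
    (presents_coker _) (Submodule.quotEquivOfEq _ _ (by rw [hΦ]) ≪≫ₗ e.symm)⟩

theorem Presents.baseChange [Fintype p] [DecidableEq p] [DecidableEq q] {Φ : Matrix p q B}
    (h : Presents Φ P) (B' : Type*) [CommRing B'] [Algebra B B'] :
    Presents (Φ.map (algebraMap B B')) (B' ⊗[B] P) := by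
  obtain ⟨π, hs, he⟩ := h
  have hex := lTensor_exact B' he hs
  have hcomm : (Φ.map (algebraMap B B')).mulVecLin ∘ₗ
      (TensorProduct.piScalarRight B B' B' q).toLinearMap =
      (TensorProduct.piScalarRight B B' B' p).toLinearMap ∘ₗ
        LinearMap.baseChange B' Φ.mulVecLin := by
    ext j i
    simp [Matrix.mulVec, dotProduct, Pi.single_apply, TensorProduct.piScalarRight_apply,
      Algebra.smul_def]
  refine ⟨LinearMap.baseChange B' π ∘ₗ
    (TensorProduct.piScalarRight B B' B' p).symm.toLinearMap, ?_, fun x => ?_⟩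
  · exact (LinearMap.lTensor_surjective B' hs).comp
      (TensorProduct.piScalarRight B B' B' p).symm.surjective
  · refine (hex ((TensorProduct.piScalarRight B B' B' p).symm x)).trans ?_
    constructor
    · rintro ⟨y, hy⟩
      refine ⟨TensorProduct.piScalarRight B B' B' q y, ?_⟩
      have := LinearMap.congr_fun hcomm y
      simp only [LinearMap.comp_apply, LinearEquiv.coe_coe] at this
      rw [this, LinearMap.baseChange_eq_ltensor, hy, LinearEquiv.apply_symm_apply]
    · rintro ⟨y, rfl⟩
      refine ⟨(TensorProduct.piScalarRight B B' B' q).symm y, ?_⟩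
      have := LinearMap.congr_fun hcomm ((TensorProduct.piScalarRight B B' B' q).symm y)
      simp only [LinearMap.comp_apply, LinearEquiv.coe_coe,
        LinearEquiv.apply_symm_apply] at this
      rw [this, LinearEquiv.symm_apply_apply, LinearMap.baseChange_eq_ltensor]

theorem exists_eq_mul_of_comp_eq_zero {r : Type*} [Fintype r] [DecidableEq r]
    {Φ : Matrix p q B} {π : (p → B) →ₗ[B] P} (he : Function.Exact Φ.mulVecLin π)
    (W : Matrix p r B) (hW : π ∘ₗ W.mulVecLin = 0) : ∃ S : Matrix q r B, W = Φ * S := by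
  have hcol : ∀ k, ∃ v : q → B, Φ.mulVec v = W.col k := fun k => by
    have h0 : π (W.mulVec (Pi.single k 1)) = 0 := LinearMap.congr_fun hW (Pi.single k 1)
    rw [Matrix.mulVec_single_one] at h0
    exact (he _).1 h0
  choose v hv using hcol
  refine ⟨Matrix.of fun j k => v k j, ?_⟩
  ext i k
  exact (congrFun (hv k) i).symm

theorem exists_lift_matrix {r : Type*} [Fintype r] [DecidableEq r] {π : (p → B) →ₗ[B] P}
    (hs : Function.Surjective π) (f : (r → B) →ₗ[B] P) :
    ∃ W : Matrix p r B, π ∘ₗ W.mulVecLin = f := by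
  choose w hw using fun k => hs (f (Pi.single k 1))
  refine ⟨Matrix.of fun i k => w k i, ?_⟩
  refine LinearMap.pi_ext' fun k => LinearMap.ext_ring ?_
  simp only [LinearMap.comp_apply, LinearMap.single_apply, Matrix.mulVecLin_apply,
    Matrix.mulVec_single_one]
  exact hw k

/-- Matrices witnessing that two relation matrices have isomorphic cokernels. -/
theorem Presents.exists_matrices [Fintype p] [DecidableEq p] [DecidableEq q] {Φ Φ' : Matrix p q B}
    (h : Presents Φ P) (h' : Presents Φ' P) :
    ∃ (U V : Matrix p p B) (X Y : Matrix q q B) (S T : Matrix q p B),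
      U * Φ = Φ' * X ∧ V * Φ' = Φ * Y ∧ V * U = 1 + Φ * S ∧ U * V = 1 + Φ' * T := by
  obtain ⟨π, hs, he⟩ := h
  obtain ⟨π', hs', he'⟩ := h'
  obtain ⟨U, hU⟩ := exists_lift_matrix hs' π
  obtain ⟨V, hV⟩ := exists_lift_matrix hs π'
  obtain ⟨X, hX⟩ := exists_eq_mul_of_comp_eq_zero he' (U * Φ) (by
    rw [Matrix.mulVecLin_mul, ← LinearMap.comp_assoc, hU, he.linearMap_comp_eq_zero])
  obtain ⟨Y, hY⟩ := exists_eq_mul_of_comp_eq_zero he (V * Φ') (by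
    rw [Matrix.mulVecLin_mul, ← LinearMap.comp_assoc, hV, he'.linearMap_comp_eq_zero])
  have hsub : ∀ M N : Matrix p p B, (M - N).mulVecLin = M.mulVecLin - N.mulVecLin :=
    fun M N => LinearMap.ext fun v => Matrix.sub_mulVec M N v
  obtain ⟨S, hS⟩ := exists_eq_mul_of_comp_eq_zero he (V * U - 1) (by
    rw [hsub, Matrix.mulVecLin_mul, Matrix.mulVecLin_one, LinearMap.comp_sub,
      ← LinearMap.comp_assoc, hV, hU, LinearMap.comp_id, sub_self])
  obtain ⟨T, hT⟩ := exists_eq_mul_of_comp_eq_zero he' (U * V - 1) (by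
    rw [hsub, Matrix.mulVecLin_mul, Matrix.mulVecLin_one, LinearMap.comp_sub,
      ← LinearMap.comp_assoc, hU, hV, LinearMap.comp_id, sub_self])
  exact ⟨U, V, X, Y, S, T, hX, hY, by rw [← hS]; abel, by rw [← hT]; abel⟩

/-- The cokernel of `Φ` surjects onto the cokernel of `Ψ`. -/
def SurjectsOnto (Φ Ψ : Matrix p q B) : Prop :=
  ∃ f : Coker Φ →ₗ[B] Coker Ψ, Function.Surjective f

theorem SurjectsOnto.refl (Φ : Matrix p q B) : SurjectsOnto Φ Φ :=
  ⟨LinearMap.id, Function.surjective_id⟩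

theorem SurjectsOnto.trans {Φ Ψ Θ : Matrix p q B} (h : SurjectsOnto Φ Ψ)
    (h' : SurjectsOnto Ψ Θ) : SurjectsOnto Φ Θ := by
  obtain ⟨f, hf⟩ := h
  obtain ⟨g, hg⟩ := h'
  exact ⟨g ∘ₗ f, hg.comp hf⟩

theorem SurjectsOnto.antisymm [Fintype p] {Φ Ψ : Matrix p q B} (h : SurjectsOnto Φ Ψ)
    (h' : SurjectsOnto Ψ Φ) : Nonempty (Coker Φ ≃ₗ[B] Coker Ψ) := by
  obtain ⟨f, hf⟩ := h
  obtain ⟨g, hg⟩ := h'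
  have hgf : Function.Injective (g ∘ₗ f) :=
    OrzechProperty.injective_of_surjective_endomorphism (g ∘ₗ f) (hg.comp hf)
  exact ⟨LinearEquiv.ofBijective f ⟨Function.Injective.of_comp hgf, hf⟩⟩

theorem surjectsOnto_of_matrices [Fintype p] [DecidableEq p] {Φ Ψ : Matrix p q B}
    {U V : Matrix p p B} {X : Matrix q q B} {T : Matrix q p B} (hX : U * Φ = Ψ * X)
    (hT : U * V = 1 + Ψ * T) :
    SurjectsOnto Φ Ψ := by
  refine ⟨Submodule.mapQ _ _ U.mulVecLin ?_, ?_⟩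
  · rintro _ ⟨v, rfl⟩
    refine ⟨X.mulVec v, ?_⟩
    simp [Matrix.mulVec_mulVec, hX]
  · intro y
    obtain ⟨v, rfl⟩ := Submodule.mkQ_surjective _ y
    refine ⟨Submodule.mkQ _ (V.mulVec v), ?_⟩
    rw [Submodule.mkQ_apply, Submodule.mapQ_apply, Submodule.mkQ_apply, Submodule.Quotient.eq]
    refine ⟨T.mulVec v, ?_⟩
    simp [Matrix.mulVec_mulVec, hT, Matrix.add_mulVec]

end Presentation

section Transition

theorem map_map_of_comp_eq {B C D : Type*} [CommRing B] [CommRing C] [CommRing D] {r s : Type*}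
    {f : B →+* C} {g : C →+* D} {k : B →+* D} (h : g.comp f = k) (M : Matrix r s B) :
    (M.map f).map g = M.map k := by
  rw [Matrix.map_map, ← RingHom.coe_comp, h]

variable {B D : Type*} [CommRing B] [CommRing D] {p q : Type*} [Fintype p] [Fintype q]
  [DecidableEq p] [DecidableEq q]

theorem map_one_ringHom {B C n : Type*} [CommRing B] [CommRing C] [DecidableEq n] (f : B →+* C) :
    (1 : Matrix n n B).map f = 1 :=
  Matrix.map_one _ (map_zero f) (map_one f)

omit [DecidableEq q] in
theorem surjectsOnto_map {δ : D →+* B} {Φ Ψ : Matrix p q D} {U V : Matrix p p D}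
    {X : Matrix q q D} {T : Matrix q p D} (hX : U * Φ = Ψ * X) (hT : U * V = 1 + Ψ * T) :
    SurjectsOnto (Φ.map δ) (Ψ.map δ) := by
  refine surjectsOnto_of_matrices (U := U.map δ) (V := V.map δ) (X := X.map δ) (T := T.map δ) ?_ ?_
  · rw [← Matrix.map_mul, ← Matrix.map_mul, hX]
  · rw [← Matrix.map_mul, ← Matrix.map_mul, hT, Matrix.map_add _ (map_add δ), map_one_ringHom]

/-- If `Φ` is equivalent to a matrix `Φ₀` on which `α` and `β` agree, then the cokernels of the
images of `Φ` under `α` and `β` are related by matrices that are trivial after applying an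
idempotent endomorphism `ρ` identifying `α` and `β`. -/
theorem exists_transition_matrices {α β : B →+* D} {ρ : D →+* D} (hα : ρ.comp α = β)
    (hβ : ρ.comp β = β) (hρ : ρ.comp ρ = ρ) {Φ Φ₀ : Matrix p q B}
    (h₀ : Φ₀.map α = Φ₀.map β) {U V : Matrix p p B} {X Y : Matrix q q B} {S T : Matrix q p B}
    (hX : U * Φ = Φ₀ * X) (hY : V * Φ₀ = Φ * Y) (hS : V * U = 1 + Φ * S)
    (hT : U * V = 1 + Φ₀ * T) :
    ∃ (U' V' : Matrix p p D) (X' : Matrix q q D) (T' : Matrix q p D),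
      U' * Φ.map α = Φ.map β * X' ∧ U' * V' = 1 + Φ.map β * T' ∧
      U'.map ρ = 1 ∧ V'.map ρ = 1 ∧ X'.map ρ = 1 ∧ T'.map ρ = 0 := by
  have one_map : (1 : Matrix p p D).map ρ = 1 := Matrix.map_one _ (map_zero ρ) (map_one ρ)
  have one_map' : (1 : Matrix q q D).map ρ = 1 := Matrix.map_one _ (map_zero ρ) (map_one ρ)
  have image : ∀ γ : B →+* D, U.map γ * Φ.map γ = Φ₀.map γ * X.map γ ∧
      V.map γ * Φ₀.map γ = Φ.map γ * Y.map γ ∧ V.map γ * U.map γ = 1 + Φ.map γ * S.map γ ∧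
      U.map γ * V.map γ = 1 + Φ₀.map γ * T.map γ := fun γ => by
    have h1 : (1 : Matrix p p B).map γ = 1 := Matrix.map_one _ (map_zero γ) (map_one γ)
    refine ⟨?_, ?_, ?_, ?_⟩ <;>
      simp only [← Matrix.map_mul, hX, hY, hS, hT, Matrix.map_add _ (map_add γ), h1]
  obtain ⟨hXα, -, -, hTα⟩ := image α
  obtain ⟨hXβ, hYβ, hSβ, -⟩ := image β
  rw [h₀] at hXα hTα
  have hXα' (Z : Matrix q p D) : U.map α * (Φ.map α * Z) = Φ₀.map β * (X.map α * Z) := by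
    rw [← Matrix.mul_assoc, hXα, Matrix.mul_assoc]
  have hTα' (Z : Matrix p p D) : U.map α * (V.map α * Z) = Z + Φ₀.map β * (T.map α * Z) := by
    rw [← Matrix.mul_assoc, hTα, Matrix.add_mul, Matrix.one_mul, Matrix.mul_assoc]
  have hYβ' (Z : Matrix q p D) :
      V.map β * (Φ₀.map β * Z) = Φ.map β * (Y.map β * Z) := by
    rw [← Matrix.mul_assoc, hYβ, Matrix.mul_assoc]
  set U' := V.map β * U.map α - Φ.map β * S.map α with hU'
  set V' := V.map α * U.map β - Φ.map α * S.map β with hV'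
  have hU'X : U' * Φ.map α = Φ.map β * (Y.map β * X.map α - S.map α * Φ.map α) := by
    rw [hU', Matrix.sub_mul, Matrix.mul_sub, Matrix.mul_assoc, hXα, ← Matrix.mul_assoc, hYβ,
      Matrix.mul_assoc, Matrix.mul_assoc]
  have hU'V' : U' * V' = 1 + Φ.map β * (S.map β + Y.map β * (T.map α * U.map β) -
      Y.map β * (X.map α * S.map β) - S.map α * V') := by
    rw [hU', Matrix.sub_mul, Matrix.mul_assoc, hV', Matrix.mul_sub, hXα', hTα', Matrix.mul_sub,
      Matrix.mul_add, hYβ', hYβ', hSβ, ← hV']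
    simp only [Matrix.mul_sub, Matrix.mul_add, Matrix.mul_assoc]
    abel
  generalize Y.map β * X.map α - S.map α * Φ.map α = X₁ at hU'X
  generalize S.map β + Y.map β * (T.map α * U.map β) -
      Y.map β * (X.map α * S.map β) - S.map α * V' = T₁ at hU'V'
  have hU'ρ : U'.map ρ = 1 := by
    rw [hU', Matrix.map_sub _ (map_sub ρ), Matrix.map_mul, Matrix.map_mul]
    simp only [map_map_of_comp_eq hα, map_map_of_comp_eq hβ]
    rw [hSβ, add_sub_cancel_right]
  have hV'ρ : V'.map ρ = 1 := by
    rw [hV', Matrix.map_sub _ (map_sub ρ), Matrix.map_mul, Matrix.map_mul]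
    simp only [map_map_of_comp_eq hα, map_map_of_comp_eq hβ]
    rw [hSβ, add_sub_cancel_right]
  have hX₁ : Φ.map β = Φ.map β * X₁.map ρ := by
    have := congrArg (fun M => M.map ρ) hU'X
    simpa only [Matrix.map_mul, map_map_of_comp_eq hα, map_map_of_comp_eq hβ, hU'ρ,
      Matrix.one_mul] using this
  have hT₁ : Φ.map β * T₁.map ρ = 0 := by
    have := congrArg (fun M => M.map ρ) hU'V'
    simpa only [Matrix.map_mul, Matrix.map_add _ (map_add ρ), map_map_of_comp_eq hβ, hU'ρ, hV'ρ,
      one_map, Matrix.one_mul, left_eq_add] using this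
  refine ⟨U', V', X₁ + 1 - X₁.map ρ, T₁ - T₁.map ρ, ?_, ?_, hU'ρ, hV'ρ, ?_, ?_⟩
  · rw [hU'X, Matrix.mul_sub, Matrix.mul_add, Matrix.mul_one, ← hX₁, add_sub_cancel_right]
  · rw [hU'V', Matrix.mul_sub, hT₁, sub_zero]
  · rw [Matrix.map_sub _ (map_sub ρ), Matrix.map_add _ (map_add ρ), map_map_of_comp_eq hρ,
      one_map', add_sub_cancel_left]
  · rw [Matrix.map_sub _ (map_sub ρ), map_map_of_comp_eq hρ, sub_self]

end Transition

section Clearing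

open Polynomial

theorem exists_uniform_mem {Q ι : Type*} [CommRing Q] [Finite ι] {S : Submonoid Q}
    {p : ι → Q → Prop} (h : ∀ i, ∃ s ∈ S, ∀ u, s ∣ u → p i u) :
    ∃ s ∈ S, ∀ u, s ∣ u → ∀ i, p i u := by
  have := Fintype.ofFinite ι
  choose s hs hp using h
  exact ⟨∏ i, s i, S.prod_mem fun i _ => hs i,
    fun u hu i => hp i u ((Finset.dvd_prod_of_mem s (Finset.mem_univ i)).trans hu)⟩

/-- The substitution `X ↦ u * X`. -/
noncomputable def dilate {Q : Type*} [CommRing Q] (u : Q) : Q[X] →+* Q[X] :=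
  compRingHom (C u * X)

section

variable {Q : Type*} [CommRing Q]

@[simp] theorem dilate_C (u a : Q) : dilate u (C a) = C a := by simp [dilate]

@[simp] theorem dilate_X (u : Q) : dilate u X = C u * X := by simp [dilate]

theorem dilate_comp (u v : Q) : (dilate v).comp (dilate u) = dilate (v * u) := by
  refine Polynomial.ringHom_ext (by simp) ?_
  simp only [RingHom.comp_apply, dilate_X, map_mul, dilate_C]
  ring

theorem dilate_comp_map {Q' : Type*} [CommRing Q'] (f : Q →+* Q') (u : Q) :
    (mapRingHom f).comp (dilate u) = (dilate (f u)).comp (mapRingHom f) :=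
  Polynomial.ringHom_ext (by simp) (by simp)

theorem eval_zero_comp_dilate (u : Q) :
    (evalRingHom 0).comp (dilate u) = (evalRingHom 0 : Q[X] →+* Q) :=
  Polynomial.ringHom_ext (by simp) (by simp)

theorem eq_C_add_X_mul (w : Q[X]) : w = C (eval 0 w) + X * w.divX := by
  rw [← coeff_zero_eq_eval_zero, add_comm, X_mul_divX_add]

variable (S : Submonoid Q) {Q' : Type*} [CommRing Q'] [Algebra Q Q'] [IsLocalization S Q']

include S in
theorem exists_lift_dilate {w : Q'[X]} {a : Q} (hw : eval 0 w = algebraMap Q Q' a) :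
    ∃ s ∈ S, ∀ u, s ∣ u → ∃ v : Q[X], eval 0 v = a ∧
      mapRingHom (algebraMap Q Q') v = dilate (algebraMap Q Q' u) w := by
  let _ : Algebra Q[X] Q'[X] := Polynomial.algebra Q Q'
  have hloc : IsLocalization (S.map C) Q'[X] := Polynomial.isLocalization S Q'
  obtain ⟨⟨v, ⟨_, s, hs, rfl⟩⟩, hv⟩ := IsLocalization.surj (S.map (C : Q →+* Q[X])) w.divX
  simp only [Polynomial.algebraMap_def] at hv
  refine ⟨s, hs, ?_⟩
  rintro _ ⟨t, rfl⟩
  refine ⟨C a + X * C t * dilate (s * t) v, by simp, ?_⟩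
  have hcomm := RingHom.congr_fun (dilate_comp_map (algebraMap Q Q') (s * t)) v
  simp only [RingHom.comp_apply] at hcomm
  rw [map_add, map_mul, hcomm, ← hv]
  conv_rhs => rw [eq_C_add_X_mul w, hw]
  simp only [map_mul, map_add, dilate_C, dilate_X, coe_mapRingHom, map_C, map_X]
  ring

include S in
theorem exists_dilate_eq_zero {e : Q[X]} (he : eval 0 e = 0)
    (h : mapRingHom (algebraMap Q Q') e = 0) : ∃ s ∈ S, ∀ u, s ∣ u → dilate u e = 0 := by
  let _ : Algebra Q[X] Q'[X] := Polynomial.algebra Q Q'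
  have hloc : IsLocalization (S.map C) Q'[X] := Polynomial.isLocalization S Q'
  have hX : e = X * e.divX := by simpa [he] using eq_C_add_X_mul e
  have h0 : algebraMap Q[X] Q'[X] e.divX = 0 := by
    rw [hX, map_mul, coe_mapRingHom, map_X] at h
    rw [Polynomial.algebraMap_def]
    exact isRegular_X.left (by simpa using h)
  obtain ⟨⟨_, s, hs, rfl⟩, hsv⟩ := (IsLocalization.map_eq_zero_iff (S.map C) Q'[X] _).1 h0
  refine ⟨s, hs, ?_⟩
  rintro _ ⟨t, rfl⟩
  have := congrArg (dilate (s * t)) hsv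
  simp only [map_mul, dilate_C, map_zero] at this
  rw [hX, map_mul, dilate_X]
  calc _ = X * C t * (C s * dilate (s * t) e.divX) := by rw [C_mul]; ring
    _ = 0 := by rw [this, mul_zero]

variable {m n : Type*} [Finite m] [Finite n]

include S in
theorem exists_lift_dilate_matrix {W : Matrix m n Q'[X]} {M : Matrix m n Q}
    (hW : W.map (evalRingHom 0) = M.map (algebraMap Q Q')) :
    ∃ s ∈ S, ∀ u, s ∣ u → ∃ V : Matrix m n Q[X], V.map (evalRingHom 0) = M ∧
      V.map (mapRingHom (algebraMap Q Q')) = W.map (dilate (algebraMap Q Q' u)) := by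
  obtain ⟨s, hs, h⟩ := exists_uniform_mem fun i : m × n =>
    exists_lift_dilate S (congrFun (congrFun hW i.1) i.2)
  refine ⟨s, hs, fun u hu => ?_⟩
  choose V hV hV' using h u hu
  exact ⟨Matrix.of fun i j => V (i, j), Matrix.ext fun i j => hV (i, j),
    Matrix.ext fun i j => hV' (i, j)⟩

include S in
theorem exists_dilate_matrix_eq_zero {E : Matrix m n Q[X]} (hE : E.map (evalRingHom 0) = 0)
    (h : E.map (mapRingHom (algebraMap Q Q')) = 0) :
    ∃ s ∈ S, ∀ u, s ∣ u → E.map (dilate u) = 0 := by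
  obtain ⟨s, hs, h⟩ := exists_uniform_mem fun i : m × n =>
    exists_dilate_eq_zero S (congrFun (congrFun hE i.1) i.2) (congrFun (congrFun h i.1) i.2)
  exact ⟨s, hs, fun u hu => Matrix.ext fun i j => h u hu (i, j)⟩

end

/-- Matrix relations over `Q'[X]`, with `Q'` a localization of `Q`, that are trivial at `X = 0`
descend to `Q[X]` after a substitution `X ↦ h * X`. -/
theorem exists_descent {Q Q' : Type*} [CommRing Q] [CommRing Q'] [Algebra Q Q']
    (S : Submonoid Q) [IsLocalization S Q'] {p q : Type*} [Fintype p] [Fintype q]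
    [DecidableEq p] [DecidableEq q] {Φ Ψ : Matrix p q Q[X]}
    (hΦ : ∀ u, Φ.map (dilate u) = Φ) (hΨ : Φ.map (evalRingHom 0) = Ψ.map (evalRingHom 0))
    {U V : Matrix p p Q'[X]} {Y : Matrix q q Q'[X]} {T : Matrix q p Q'[X]}
    (hY : U * Φ.map (mapRingHom (algebraMap Q Q')) = Ψ.map (mapRingHom (algebraMap Q Q')) * Y)
    (hT : U * V = 1 + Ψ.map (mapRingHom (algebraMap Q Q')) * T)
    (hU₀ : U.map (evalRingHom 0) = 1) (hV₀ : V.map (evalRingHom 0) = 1)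
    (hY₀ : Y.map (evalRingHom 0) = 1) (hT₀ : T.map (evalRingHom 0) = 0) :
    ∃ h ∈ S, ∃ (U V : Matrix p p Q[X]) (Y : Matrix q q Q[X]) (T : Matrix q p Q[X]),
      U * Φ = Ψ.map (dilate h) * Y ∧ U * V = 1 + Ψ.map (dilate h) * T := by
  set j := algebraMap Q Q'
  obtain ⟨a, ha, hU⟩ := exists_lift_dilate_matrix S (hU₀.trans (map_one_ringHom j).symm)
  obtain ⟨b, hb, hV⟩ := exists_lift_dilate_matrix S (hV₀.trans (map_one_ringHom j).symm)
  obtain ⟨c, hc, hY'⟩ := exists_lift_dilate_matrix S (hY₀.trans (map_one_ringHom j).symm)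
  obtain ⟨d, hd, hT'⟩ := exists_lift_dilate_matrix (M := (0 : Matrix q p Q)) S
    (hT₀.trans (Matrix.map_zero _ (map_zero j)).symm)
  set u := a * b * c * d with hu
  obtain ⟨U₁, hU₁, hU₁'⟩ := hU u ⟨b * c * d, by rw [hu]; ring⟩
  obtain ⟨V₁, hV₁, hV₁'⟩ := hV u ⟨a * c * d, by rw [hu]; ring⟩
  obtain ⟨Y₁, hY₁, hY₁'⟩ := hY' u ⟨a * b * d, by rw [hu]; ring⟩
  obtain ⟨T₁, hT₁, hT₁'⟩ := hT' u ⟨a * b * c, by rw [hu]; ring⟩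
  have hΨu : (Ψ.map (dilate u)).map (evalRingHom 0) = Ψ.map (evalRingHom 0) :=
    map_map_of_comp_eq (eval_zero_comp_dilate u) Ψ
  have hcomm (M : Matrix p q Q[X]) : (M.map (dilate u)).map (mapRingHom j) =
      (M.map (mapRingHom j)).map (dilate (j u)) := by
    rw [map_map_of_comp_eq (dilate_comp_map j u), map_map_of_comp_eq rfl]
  have hcommΦ : Φ.map (mapRingHom j) = (Φ.map (mapRingHom j)).map (dilate (j u)) := by
    rw [← hcomm, hΦ]
  obtain ⟨s, hs, hE₁⟩ := exists_dilate_matrix_eq_zero (Q' := Q') S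
    (E := U₁ * Φ - Ψ.map (dilate u) * Y₁)
    (by simp only [Matrix.map_sub _ (map_sub (evalRingHom (0 : Q))), Matrix.map_mul, hΨu, hU₁,
          hY₁, Matrix.one_mul, Matrix.mul_one, hΨ, sub_self])
    (by
      rw [Matrix.map_sub _ (map_sub _), Matrix.map_mul, Matrix.map_mul, hU₁', hY₁', hcomm,
        hcommΦ, ← Matrix.map_mul, ← Matrix.map_mul, hY, sub_self])
  obtain ⟨t, ht, hE₂⟩ := exists_dilate_matrix_eq_zero (Q' := Q') S
    (E := U₁ * V₁ - (1 + Ψ.map (dilate u) * T₁))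
    (by simp only [Matrix.map_sub _ (map_sub (evalRingHom (0 : Q))), Matrix.map_mul,
          Matrix.map_add _ (map_add (evalRingHom (0 : Q))), map_one_ringHom, hU₁, hV₁, hT₁,
          Matrix.one_mul, Matrix.mul_zero, add_zero, sub_self])
    (by
      rw [Matrix.map_sub _ (map_sub _), Matrix.map_mul, Matrix.map_add _ (map_add _),
        map_one_ringHom, Matrix.map_mul, hU₁', hV₁', hT₁', hcomm, ← Matrix.map_mul,
        ← Matrix.map_mul, hT, Matrix.map_add _ (map_add _), map_one_ringHom, sub_self])
  have hΨst : (Ψ.map (dilate u)).map (dilate (s * t)) = Ψ.map (dilate (s * t * u)) :=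
    map_map_of_comp_eq (dilate_comp u (s * t)) Ψ
  refine ⟨s * t * u, S.mul_mem (S.mul_mem hs ht)
    (S.mul_mem (S.mul_mem (S.mul_mem ha hb) hc) hd), U₁.map (dilate (s * t)),
    V₁.map (dilate (s * t)), Y₁.map (dilate (s * t)), T₁.map (dilate (s * t)), ?_, ?_⟩
  · have := hE₁ (s * t) (dvd_mul_right s t)
    rwa [Matrix.map_sub _ (map_sub _), Matrix.map_mul, Matrix.map_mul, hΨst, hΦ,
      sub_eq_zero] at this
  · have := hE₂ (s * t) (dvd_mul_left t s)
    rwa [Matrix.map_sub _ (map_sub _), Matrix.map_mul, Matrix.map_add _ (map_add _),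
      map_one_ringHom, Matrix.map_mul, hΨst, sub_eq_zero] at this

end Clearing

section Scaling

variable {σ R B : Type*} [CommRing R] [CommRing B]

/-- The ring homomorphism that agrees with `i` on constants and maps each `x_k` to
`b * i x_k`. -/
noncomputable def scale (i : MvPolynomial σ R →+* B) (b : B) : MvPolynomial σ R →+* B :=
  MvPolynomial.eval₂Hom (i.comp MvPolynomial.C) fun k => b * i (MvPolynomial.X k)

@[simp] theorem scale_C (i : MvPolynomial σ R →+* B) (b : B) (r : R) :
    scale i b (MvPolynomial.C r) = i (MvPolynomial.C r) := by simp [scale]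

@[simp] theorem scale_X (i : MvPolynomial σ R →+* B) (b : B) (k : σ) :
    scale i b (MvPolynomial.X k) = b * i (MvPolynomial.X k) := by simp [scale]

theorem comp_scale {B' : Type*} [CommRing B'] (f : B →+* B') (i : MvPolynomial σ R →+* B)
    (b : B) : f.comp (scale i b) = scale (f.comp i) (f b) :=
  MvPolynomial.ringHom_ext (by simp) (by simp)

theorem scale_comp_map {K : Type*} [CommRing K] (j : R →+* K) (i : MvPolynomial σ K →+* B)
    (b : B) : scale (i.comp (MvPolynomial.map j)) b = (scale i b).comp (MvPolynomial.map j) :=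
  MvPolynomial.ringHom_ext (by simp) (by simp)

theorem map_map_scale {B' K m n : Type*} [CommRing B'] [CommRing K] {j : R →+* K}
    {f : B →+* B'} {i : MvPolynomial σ R →+* B} {i' : MvPolynomial σ K →+* B'}
    (h : f.comp i = i'.comp (MvPolynomial.map j)) (b : B) (Φ : Matrix m n (MvPolynomial σ R)) :
    (Φ.map (scale i b)).map f = (Φ.map (MvPolynomial.map j)).map (scale i' (f b)) := by
  rw [map_map_of_comp_eq (comp_scale f i b), h, scale_comp_map, map_map_of_comp_eq rfl]

theorem scale_one (i : MvPolynomial σ R →+* B) : scale i 1 = i :=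
  MvPolynomial.ringHom_ext (by simp) (by simp)

theorem scale_zero (i : MvPolynomial σ R →+* B) :
    scale i 0 = i.comp (MvPolynomial.C.comp MvPolynomial.constantCoeff) :=
  MvPolynomial.ringHom_ext (by simp) (by simp)

end Scaling

section Patching

open Polynomial

/-- The inclusion of `B` into `B[y][z]`. -/
noncomputable abbrev incl (B : Type*) [CommRing B] : B →+* B[X][X] := C.comp C

/-- The endomorphism of `B[y][z]` with `y ↦ y + z` and `z ↦ 0`. -/
noncomputable def shift (B : Type*) [CommRing B] : B[X][X] →+* B[X][X] :=
  eval₂RingHom (eval₂RingHom (incl B) (C X + X)) 0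

section

variable {B : Type*} [CommRing B]

@[simp] theorem shift_C_C (b : B) : shift B (C (C b)) = C (C b) := by simp [shift]

@[simp] theorem shift_C_X : shift B (C X) = C X + X := by simp [shift]

@[simp] theorem shift_X : shift B X = 0 := by simp [shift]

theorem ringHom_ext_two {D : Type*} [CommRing D] {f g : B[X][X] →+* D}
    (h : f.comp (incl B) = g.comp (incl B)) (hy : f (C X) = g (C X)) (hz : f X = g X) : f = g :=
  Polynomial.ringHom_ext' (Polynomial.ringHom_ext' h hy) hz

theorem shift_comp_incl : (shift B).comp (incl B) = incl B := RingHom.ext fun b => by simp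

theorem shift_comp_shift : (shift B).comp (shift B) = shift B :=
  ringHom_ext_two (RingHom.ext fun b => by simp) (by simp) (by simp)

theorem eval_zero_comp_shift :
    (evalRingHom 0).comp (shift B) = (evalRingHom 0 : B[X][X] →+* B[X]) :=
  ringHom_ext_two (RingHom.ext fun b => by simp) (by simp) (by simp)

theorem map_eval_zero_of_map_shift {m n : Type*} {M N : Matrix m n B[X][X]}
    (h : M.map (shift B) = N) : M.map (evalRingHom 0) = N.map (evalRingHom 0) := by
  rw [← h, map_map_of_comp_eq eval_zero_comp_shift]

end

variable {σ R : Type*} [CommRing R] {p q : Type*} [Fintype p] [Fintype q]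
  [DecidableEq p] [DecidableEq q]

/-- The matrix `Φ (a x)`. -/
noncomputable abbrev dilation (Φ : Matrix p q (MvPolynomial σ R)) (a : MvPolynomial σ R) :
    Matrix p q (MvPolynomial σ R) :=
  Φ.map (scale (RingHom.id _) a)

/-- If `Φ` becomes equivalent to its constant part over a localization of `R` at `S`, then there
is `r ∈ S` such that the cokernel of `Φ (a x)` surjects onto that of `Φ ((a + r c) x)` for all `a`
and `c`. -/
theorem exists_mem_surjective_coker_scale (S : Submonoid R) {K : Type*} [CommRing K] [Algebra R K]
    [IsLocalization S K] {Φ : Matrix p q (MvPolynomial σ R)} {Φ' Φ₀ : Matrix p q (MvPolynomial σ K)}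
    (hΦ' : Φ.map (MvPolynomial.map (algebraMap R K)) = Φ')
    (h₀ : Φ'.map (MvPolynomial.C.comp MvPolynomial.constantCoeff) = Φ₀)
    {U V : Matrix p p (MvPolynomial σ K)} {Y Z : Matrix q q (MvPolynomial σ K)}
    {W T : Matrix q p (MvPolynomial σ K)}
    (hY : U * Φ' = Φ₀ * Y) (hZ : V * Φ₀ = Φ' * Z) (hW : V * U = 1 + Φ' * W)
    (hT : U * V = 1 + Φ₀ * T) :
    ∃ r ∈ S, ∀ a c, SurjectsOnto (dilation Φ a) (dilation Φ (a + MvPolynomial.C r * c)) := by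
  let _ : Algebra (MvPolynomial σ R) (MvPolynomial σ K) := MvPolynomial.algebraMvPolynomial
  have hA : IsLocalization (S.map (MvPolynomial.C (σ := σ))) (MvPolynomial σ K) :=
    MvPolynomial.isLocalization S K
  let _ : Algebra (MvPolynomial σ R)[X] (MvPolynomial σ K)[X] := Polynomial.algebra _ _
  have hAX : IsLocalization ((S.map (MvPolynomial.C (σ := σ))).map
      (C : _ →+* (MvPolynomial σ R)[X])) (MvPolynomial σ K)[X] :=
    Polynomial.isLocalization _ _
  have hj : algebraMap (MvPolynomial σ R)[X] (MvPolynomial σ K)[X] =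
    mapRingHom (MvPolynomial.map (algebraMap R K)) := rfl
  have hΦ₀ (b : (MvPolynomial σ K)[X][X]) : Φ₀.map (scale (incl _) b) = Φ₀.map (incl _) := by
    rw [← h₀]
    ext
    simp
  obtain ⟨U₁, V₁, Y₁, T₁, hY₁, hT₁, hU₁ρ, hV₁ρ, hY₁ρ, hT₁ρ⟩ :=
    exists_transition_matrices (α := scale (incl (MvPolynomial σ K)) (C X))
      (β := scale (incl (MvPolynomial σ K)) (C X + X)) (ρ := shift _)
      (by rw [comp_scale, shift_comp_incl, shift_C_X])
      (by rw [comp_scale, shift_comp_incl, map_add, shift_C_X, shift_X, add_zero])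
      shift_comp_shift (by rw [hΦ₀, hΦ₀]) hY hZ hW hT
  have hinc : (mapRingHom (mapRingHom (MvPolynomial.map (algebraMap R K)))).comp
      (incl (MvPolynomial σ R)) =
      (incl (MvPolynomial σ K)).comp (MvPolynomial.map (algebraMap R K)) :=
    RingHom.ext fun a => by simp
  have hg (b : (MvPolynomial σ R)[X][X]) :
      (Φ.map (scale (incl _) b)).map
        (mapRingHom (mapRingHom (MvPolynomial.map (algebraMap R K)))) =
      Φ'.map (scale (incl _) (mapRingHom (mapRingHom (MvPolynomial.map (algebraMap R K))) b)) := by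
    rw [← hΦ']
    exact map_map_scale (B := (MvPolynomial σ R)[X][X]) (B' := (MvPolynomial σ K)[X][X]) hinc b Φ
  have hdil (u : (MvPolynomial σ R)[X]) :
      (dilate u).comp (incl (MvPolynomial σ R)) = incl _ := RingHom.ext fun a => by simp
  obtain ⟨_, ⟨_, ⟨r, hr, rfl⟩, rfl⟩, U₂, V₂, Y₂, T₂, hY₂, hT₂⟩ :=
    exists_descent (Q' := (MvPolynomial σ K)[X])
    ((S.map (MvPolynomial.C (σ := σ))).map (C : _ →+* (MvPolynomial σ R)[X]))
    (Φ := Φ.map (scale (incl _) (C X))) (Ψ := Φ.map (scale (incl _) (C X + X)))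
    (U := U₁) (V := V₁) (Y := Y₁) (T := T₁)
    (fun u => by rw [map_map_of_comp_eq (comp_scale _ _ _), hdil, dilate_C])
    (by
      rw [map_map_of_comp_eq (comp_scale _ _ _), map_map_of_comp_eq (comp_scale _ _ _)]
      simp)
    (by rw [hj, hg, hg]; simpa using hY₁)
    (by rw [hj, hg]; simpa using hT₁)
    ((map_eval_zero_of_map_shift hU₁ρ).trans (map_one_ringHom _))
    ((map_eval_zero_of_map_shift hV₁ρ).trans (map_one_ringHom _))
    ((map_eval_zero_of_map_shift hY₁ρ).trans (map_one_ringHom _))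
    ((map_eval_zero_of_map_shift hT₁ρ).trans (Matrix.map_zero _ (map_zero _)))
  refine ⟨r, hr, fun a c => ?_⟩
  let δ : (MvPolynomial σ R)[X][X] →+* MvPolynomial σ R := eval₂RingHom (evalRingHom a) c
  have hδi : δ.comp (incl _) = RingHom.id _ := RingHom.ext fun a => by simp [δ]
  have hδΦ : (Φ.map (scale (incl _) (C X))).map δ = Φ.map (scale (RingHom.id _) a) := by
    rw [map_map_of_comp_eq (comp_scale _ _ _), hδi]
    simp [δ]
  have hδΨ : ((Φ.map (scale (incl _) (C X + X))).map (dilate (C (MvPolynomial.C r)))).map δ =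
      Φ.map (scale (RingHom.id _) (a + MvPolynomial.C r * c)) := by
    rw [map_map_of_comp_eq (comp_scale _ _ _), hdil, map_map_of_comp_eq (comp_scale _ _ _), hδi]
    simp [δ]
  rw [dilation, dilation, ← hδΦ, ← hδΨ]
  exact surjectsOnto_map hY₂ hT₂

/-- Elements of `R` along which the cokernels of the dilations of `Φ` are related by
surjections. -/
def patchingIdeal (Φ : Matrix p q (MvPolynomial σ R)) : Ideal R where
  carrier := {r | ∀ a c, SurjectsOnto (dilation Φ a) (dilation Φ (a + MvPolynomial.C r * c))}
  zero_mem' a c := by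
    rw [MvPolynomial.C_0, zero_mul, add_zero]
    exact .refl _
  add_mem' {r s} hr hs a c := by
    rw [MvPolynomial.C_add, add_mul, ← add_assoc]
    exact (hr a c).trans (hs _ c)
  smul_mem' t r hr a c := by
    rw [smul_eq_mul, mul_comm t r, MvPolynomial.C_mul, mul_assoc]
    exact hr a _

omit [DecidableEq p] [DecidableEq q] in
theorem nonempty_equiv_of_patchingIdeal_eq_top {Φ : Matrix p q (MvPolynomial σ R)}
    (h : patchingIdeal Φ = ⊤) :
    Nonempty (Coker Φ ≃ₗ[MvPolynomial σ R]
      Coker (Φ.map ((MvPolynomial.C.comp MvPolynomial.constantCoeff :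
        MvPolynomial σ R →+* MvPolynomial σ R)))) := by
  have h1 : ∀ a c, SurjectsOnto (dilation Φ a) (dilation Φ (a + MvPolynomial.C 1 * c)) :=
    show (1 : R) ∈ patchingIdeal Φ from h ▸ Submodule.mem_top
  have h10 : SurjectsOnto (dilation Φ 1) (dilation Φ 0) := by simpa using h1 1 (-1)
  have h01 : SurjectsOnto (dilation Φ 0) (dilation Φ 1) := by simpa using h1 0 1
  have e₁ : dilation Φ 1 = Φ := by rw [dilation, scale_one]; rfl
  have e₀ : dilation Φ 0 = Φ.map (MvPolynomial.C.comp MvPolynomial.constantCoeff) := by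
    rw [dilation, scale_zero]; rfl
  rw [e₁, e₀] at h10 h01
  exact h10.antisymm h01

end Patching

section Extended

variable {σ K : Type*} [CommRing K] {p q : Type*} [Fintype p] [Fintype q]
  [DecidableEq p] [DecidableEq q] {N : Type*} [AddCommGroup N] [Module K N]

theorem Presents.constantCoeff {Φ : Matrix p q (MvPolynomial σ K)}
    (h : Presents Φ (MvPolynomial σ K ⊗[K] N)) :
    Presents (Φ.map (MvPolynomial.constantCoeff : MvPolynomial σ K →+* K)) N := by
  let _ : Algebra (MvPolynomial σ K) K := MvPolynomial.constantCoeff.toAlgebra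
  have : IsScalarTower K (MvPolynomial σ K) K :=
    .of_algebraMap_eq fun x => (MvPolynomial.constantCoeff_C σ x).symm
  exact (h.baseChange K).congr
    (TensorProduct.AlgebraTensorModule.cancelBaseChange K (MvPolynomial σ K) K K N ≪≫ₗ
      TensorProduct.lid K N)

theorem Presents.constantPart {Φ : Matrix p q (MvPolynomial σ K)}
    (h : Presents Φ (MvPolynomial σ K ⊗[K] N)) :
    Presents (Φ.map (MvPolynomial.C.comp MvPolynomial.constantCoeff :
      MvPolynomial σ K →+* MvPolynomial σ K)) (MvPolynomial σ K ⊗[K] N) := by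
  have h₀ := h.constantCoeff.baseChange (MvPolynomial σ K)
  rwa [map_map_of_comp_eq (k := MvPolynomial.C.comp MvPolynomial.constantCoeff) rfl] at h₀

variable {R : Type*} [CommRing R] {P : Type*} [AddCommGroup P] [Module (MvPolynomial σ R) P]

theorem exists_mem_patchingIdeal (S : Submonoid R) [Algebra R K] [IsLocalization S K]
    [Algebra (MvPolynomial σ R) (MvPolynomial σ K)]
    (halg : algebraMap (MvPolynomial σ R) (MvPolynomial σ K) =
      MvPolynomial.map (algebraMap R K))
    {Φ : Matrix p q (MvPolynomial σ R)} (hΦ : Presents Φ P)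
    (e : MvPolynomial σ K ⊗[MvPolynomial σ R] P ≃ₗ[MvPolynomial σ K]
      MvPolynomial σ K ⊗[K] N) : ∃ r ∈ S, r ∈ patchingIdeal Φ := by
  have h := (hΦ.baseChange (MvPolynomial σ K)).congr e
  rw [halg] at h
  obtain ⟨U, V, X, Y, W, T, hX, hY, hW, hT⟩ := h.exists_matrices h.constantPart
  exact exists_mem_surjective_coker_scale S rfl rfl hX hY hW hT

theorem nonempty_equiv_tensorProduct_coker {Φ : Matrix p q (MvPolynomial σ R)}
    (hΦ : Presents Φ P) (h : patchingIdeal Φ = ⊤) :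
    Nonempty (P ≃ₗ[MvPolynomial σ R] MvPolynomial σ R ⊗[R]
      Coker (Φ.map (MvPolynomial.constantCoeff : MvPolynomial σ R →+* R))) := by
  obtain ⟨e⟩ := nonempty_equiv_of_patchingIdeal_eq_top h
  obtain ⟨e'⟩ := hΦ.equiv (presents_coker Φ)
  have h₀ := (presents_coker (Φ.map (MvPolynomial.constantCoeff :
    MvPolynomial σ R →+* R))).baseChange (MvPolynomial σ R)
  rw [map_map_of_comp_eq (k := MvPolynomial.C.comp MvPolynomial.constantCoeff) rfl] at h₀
  obtain ⟨e''⟩ := (presents_coker _).equiv h₀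
  exact ⟨e' ≪≫ₗ e ≪≫ₗ e''⟩

theorem nonempty_equiv_baseChange_of_extended [Algebra R K]
    [Algebra (MvPolynomial σ R) (MvPolynomial σ K)]
    (halg : algebraMap (MvPolynomial σ R) (MvPolynomial σ K) =
      MvPolynomial.map (algebraMap R K))
    {M₀ : Type*} [AddCommGroup M₀] [Module R M₀]
    (e : P ≃ₗ[MvPolynomial σ R] MvPolynomial σ R ⊗[R] M₀) :
    Nonempty (MvPolynomial σ K ⊗[MvPolynomial σ R] P ≃ₗ[MvPolynomial σ K]
      MvPolynomial σ K ⊗[K] (K ⊗[R] M₀)) := by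
  have : IsScalarTower R (MvPolynomial σ R) (MvPolynomial σ K) :=
    .of_algebraMap_eq fun x => by
      rw [halg, MvPolynomial.algebraMap_eq, MvPolynomial.map_C]
      rfl
  exact ⟨e.baseChange (MvPolynomial σ R) (MvPolynomial σ K) _ _ ≪≫ₗ
    TensorProduct.AlgebraTensorModule.cancelBaseChange R (MvPolynomial σ R) (MvPolynomial σ K)
      (MvPolynomial σ K) M₀ ≪≫ₗ
    (TensorProduct.AlgebraTensorModule.cancelBaseChange R K (MvPolynomial σ K)
      (MvPolynomial σ K) M₀).symm⟩

end Extended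

end QuillenPatching

/-- **Quillen's patching theorem.** Let `R` be a commutative ring, `A := R[x₁,…,xₙ]`
the polynomial ring, and `M` a finitely presented `A`-module.  Then `M` is extended
from `R` (i.e. `M ≅ A ⊗_R M₀` for some `R`-module `M₀`) if and only if for every
maximal ideal `𝔪` of `R`, the module `M_𝔪 := R_𝔪[x₁,…,xₙ] ⊗_A M` is extended from
`R_𝔪`.  Here `R_𝔪[x₁,…,xₙ]` is viewed as an `A`-algebra via the canonical map
`R[x₁,…,xₙ] → R_𝔪[x₁,…,xₙ]`. -/
theorem quillen_patching {R : Type} [CommRing R] (n : ℕ)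
    (M : Type) [AddCommGroup M] [Module (MvPolynomial (Fin n) R) M]
    (hM : Module.FinitePresentation (MvPolynomial (Fin n) R) M) :
    (∃ (M₀ : Type) (_ : AddCommGroup M₀) (_ : Module R M₀),
        Nonempty (M ≃ₗ[MvPolynomial (Fin n) R] (MvPolynomial (Fin n) R ⊗[R] M₀))) ↔
    (∀ (𝔪 : Ideal R) (h𝔪 : 𝔪.IsMaximal),
      letI := h𝔪.isPrime;
      letI : Algebra (MvPolynomial (Fin n) R)
          (MvPolynomial (Fin n) (Localization.AtPrime 𝔪)) :=
        (MvPolynomial.map (algebraMap R (Localization.AtPrime 𝔪))).toAlgebra;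
      ∃ (N₀ : Type) (_ : AddCommGroup N₀) (_ : Module (Localization.AtPrime 𝔪) N₀),
        Nonempty
          ((MvPolynomial (Fin n) (Localization.AtPrime 𝔪) ⊗[MvPolynomial (Fin n) R] M)
            ≃ₗ[MvPolynomial (Fin n) (Localization.AtPrime 𝔪)]
          (MvPolynomial (Fin n) (Localization.AtPrime 𝔪)
            ⊗[Localization.AtPrime 𝔪] N₀))) := by
  constructor
  · rintro ⟨M₀, _, _, ⟨e⟩⟩ 𝔪 h𝔪
    have := h𝔪.isPrime
    let _ : Algebra (MvPolynomial (Fin n) R) (MvPolynomial (Fin n) (Localization.AtPrime 𝔪)) :=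
      (MvPolynomial.map (algebraMap R (Localization.AtPrime 𝔪))).toAlgebra
    exact ⟨Localization.AtPrime 𝔪 ⊗[R] M₀, inferInstance, inferInstance,
      QuillenPatching.nonempty_equiv_baseChange_of_extended rfl e⟩
  · intro h
    obtain ⟨k, l, Φ, hΦ⟩ := QuillenPatching.exists_presents (B := MvPolynomial (Fin n) R) (P := M)
    refine ⟨_, _, _, QuillenPatching.nonempty_equiv_tensorProduct_coker hΦ ?_⟩
    by_contra hne
    obtain ⟨𝔪, h𝔪, hle⟩ := Ideal.exists_le_maximal _ hne
    have := h𝔪.isPrime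
    obtain ⟨N₀, _, _, ⟨e⟩⟩ := h 𝔪 h𝔪
    let _ : Algebra (MvPolynomial (Fin n) R) (MvPolynomial (Fin n) (Localization.AtPrime 𝔪)) :=
      (MvPolynomial.map (algebraMap R (Localization.AtPrime 𝔪))).toAlgebra
    obtain ⟨r, hr, hrΦ⟩ := QuillenPatching.exists_mem_patchingIdeal 𝔪.primeCompl rfl hΦ e
    exact hr (hle hrΦ)
end

section
/- Let R be a commutative ring and A := R[x₁,…,xₙ] the polynomial ring. If for every maximal ideal 𝔪 of R every finitely generated projective R_𝔪[x₁,…,xₙ]-module is extended from R_𝔪, then every finitely generated projective A-module is extended from R. -/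
open TensorProduct

/-- Murray–von Neumann equivalence of two elements of a monoid (usually idempotents). -/
def MurrayVonNeumann {E : Type*} [Mul E] (e f : E) : Prop :=
  ∃ u v : E, u * v = e ∧ v * u = f

namespace MurrayVonNeumann

theorem trans {E : Type*} [Semigroup E] {e f g : E} (he : e * e = e) (hg : g * g = g)
    (hef : MurrayVonNeumann e f) (hfg : MurrayVonNeumann f g) : MurrayVonNeumann e g := by
  obtain ⟨u, v, rfl, rfl⟩ := hef
  obtain ⟨u', v', h, rfl⟩ := hfg
  refine ⟨u * u', v' * v, ?_, ?_⟩
  · rw [← he]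
    simp only [mul_assoc]
    rw [← mul_assoc u' v', h]
    simp only [mul_assoc]
  · rw [← hg]
    simp only [mul_assoc]
    rw [← mul_assoc v u, ← h]
    simp only [mul_assoc]

theorem map {E F G : Type*} [Mul E] [Mul F] [FunLike G E F] [MulHomClass G E F] (φ : G)
    {e f : E} (h : MurrayVonNeumann e f) : MurrayVonNeumann (φ e) (φ f) := by
  obtain ⟨u, v, rfl, rfl⟩ := h
  exact ⟨φ u, φ v, (map_mul φ u v).symm, (map_mul φ v u).symm⟩

end MurrayVonNeumann

/-- The idempotent matrix `P` presents the module `N`: the module is a retract of a finite free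
module, and `P` is the corresponding projector. -/
def Matrix.Presents {S ι : Type*} [CommRing S] [Fintype ι] [DecidableEq ι] (P : Matrix ι ι S)
    (N : Type*) [AddCommGroup N] [Module S N] : Prop :=
  ∃ (i : N →ₗ[S] ι → S) (p : (ι → S) →ₗ[S] N), p ∘ₗ i = .id ∧ i ∘ₗ p = Matrix.toLin' P

namespace Matrix.Presents

variable {S ι : Type*} [CommRing S] [Fintype ι] [DecidableEq ι] {P Q : Matrix ι ι S}
  {N N' : Type*} [AddCommGroup N] [Module S N] [AddCommGroup N'] [Module S N']

theorem mul_self (h : P.Presents N) : P * P = P := by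
  obtain ⟨i, p, hpi, hip⟩ := h
  apply Matrix.toLin'.injective
  rw [Matrix.toLin'_mul, ← hip, LinearMap.comp_assoc, ← LinearMap.comp_assoc p i p, hpi,
    LinearMap.id_comp]

theorem of_linearEquiv (h : P.Presents N) (e : N ≃ₗ[S] N') : P.Presents N' := by
  obtain ⟨i, p, hpi, hip⟩ := h
  refine ⟨i ∘ₗ e.symm.toLinearMap, e.toLinearMap ∘ₗ p, ?_, ?_⟩
  · ext x
    simpa using congr_arg e (LinearMap.congr_fun hpi (e.symm x))
  · rw [← hip]
    ext
    simp

theorem range (hP : P * P = P) : P.Presents (LinearMap.range (Matrix.toLin' P)) := by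
  refine ⟨Submodule.subtype _, LinearMap.rangeRestrict _, ?_, ?_⟩
  · ext ⟨_, x, rfl⟩ : 2
    simp [hP]
  · ext
    simp

theorem finite (h : P.Presents N) : Module.Finite S N := by
  obtain ⟨i, p, hpi, -⟩ := h
  exact Module.Finite.of_surjective p fun x ↦ ⟨i x, LinearMap.congr_fun hpi x⟩

theorem projective (h : P.Presents N) : Module.Projective S N := by
  obtain ⟨i, p, hpi, -⟩ := h
  exact Module.Projective.of_split i p hpi

theorem exists_of_projective (S N : Type*) [CommRing S] [AddCommGroup N] [Module S N]
    [Module.Finite S N] [Module.Projective S N] :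
    ∃ (k : ℕ) (P : Matrix (Fin k) (Fin k) S), P.Presents N := by
  obtain ⟨k, p, i, -, -, hpi⟩ := Module.Finite.exists_comp_eq_id_of_projective S N
  exact ⟨k, LinearMap.toMatrix' (i ∘ₗ p), i, p, hpi, by simp⟩

theorem murrayVonNeumann (hP : P.Presents N) (hQ : Q.Presents N) : MurrayVonNeumann P Q := by
  obtain ⟨i, p, hpi, hip⟩ := hP
  obtain ⟨j, q, hqj, hjq⟩ := hQ
  refine ⟨LinearMap.toMatrix' (i ∘ₗ q), LinearMap.toMatrix' (j ∘ₗ p), ?_, ?_⟩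
  · rw [← LinearMap.toMatrix'_comp, LinearMap.comp_assoc, ← LinearMap.comp_assoc p j q, hqj,
      LinearMap.id_comp, hip, LinearMap.toMatrix'_toLin']
  · rw [← LinearMap.toMatrix'_comp, LinearMap.comp_assoc, ← LinearMap.comp_assoc q i p, hpi,
      LinearMap.id_comp, hjq, LinearMap.toMatrix'_toLin']

theorem of_murrayVonNeumann (hP : P.Presents N) (h : MurrayVonNeumann Q P) (hQ : Q * Q = Q) :
    Q.Presents N := by
  have hPP := hP.mul_self
  obtain ⟨i, p, hpi, hip⟩ := hP
  obtain ⟨u, v, rfl, rfl⟩ := h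
  have hi : Matrix.toLin' (v * u) ∘ₗ i = i := by
    rw [← hip, LinearMap.comp_assoc, hpi, LinearMap.comp_id]
  refine ⟨Matrix.toLin' u ∘ₗ i, p ∘ₗ Matrix.toLin' v, ?_, ?_⟩
  · rw [LinearMap.comp_assoc, ← LinearMap.comp_assoc i, ← Matrix.toLin'_mul, hi, hpi]
  · rw [LinearMap.comp_assoc, ← LinearMap.comp_assoc _ p i, hip, ← Matrix.toLin'_mul,
      ← Matrix.toLin'_mul]
    congr 1
    rw [← hQ]
    simp only [mul_assoc]

theorem nonempty_linearEquiv (hP : P.Presents N) (hQ : P.Presents N') :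
    Nonempty (N ≃ₗ[S] N') := by
  obtain ⟨i, p, hpi, hip⟩ := hP
  obtain ⟨j, q, hqj, hjq⟩ := hQ
  refine ⟨LinearEquiv.ofLinearMap (q ∘ₗ i) (p ∘ₗ j) ?_ ?_⟩
  · rw [LinearMap.comp_assoc, ← LinearMap.comp_assoc j p i, hip, ← hjq, LinearMap.comp_assoc,
      hqj, LinearMap.comp_id, hqj]
  · rw [LinearMap.comp_assoc, ← LinearMap.comp_assoc i q j, hjq, ← hip, LinearMap.comp_assoc,
      hpi, LinearMap.comp_id, hpi]

theorem baseChange (T : Type*) [CommRing T] [Algebra S T] (h : P.Presents N) :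
    (P.map (algebraMap S T)).Presents (T ⊗[S] N) := by
  obtain ⟨i, p, hpi, hip⟩ := h
  let e := TensorProduct.piScalarRight S T T ι
  refine ⟨e.toLinearMap ∘ₗ i.baseChange T, p.baseChange T ∘ₗ e.symm.toLinearMap, ?_, ?_⟩
  · rw [LinearMap.comp_assoc, ← LinearMap.comp_assoc _ e.toLinearMap, LinearEquiv.symm_comp,
      LinearMap.id_comp, ← LinearMap.baseChange_comp, hpi, LinearMap.baseChange_id]
  · rw [LinearMap.comp_assoc, ← LinearMap.comp_assoc _ (p.baseChange T),
      ← LinearMap.baseChange_comp, hip]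
    refine LinearMap.pi_ext' fun k ↦ LinearMap.ext_ring ?_
    ext l
    simp [e, Algebra.algebraMap_eq_smul_one]

end Matrix.Presents

namespace MvPolynomial

/-- The substitution `Xᵢ ↦ r Xᵢ`. -/
noncomputable def scaleVars {σ A : Type*} [CommRing A] (r : A) :
    MvPolynomial σ A →ₐ[A] MvPolynomial σ A :=
  aeval fun i ↦ C r * X i

section scaleVars

variable {σ A B : Type*} [CommRing A] [CommRing B]

theorem scaleVars_C (r a : A) : scaleVars (σ := σ) r (C a) = C a :=
  aeval_C _ _

theorem scaleVars_monomial (r : A) (d : σ →₀ ℕ) (a : A) :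
    scaleVars r (monomial d a) = monomial d (r ^ d.degree * a) := by
  rw [scaleVars, aeval_monomial, monomial_eq (a := r ^ d.degree * a), algebraMap_eq]
  simp only [mul_pow, Finsupp.prod, Finset.prod_mul_distrib, map_pow, Finset.prod_pow_eq_pow_sum,
    map_mul, Finsupp.degree_apply]
  ring

theorem coeff_scaleVars (r : A) (f : MvPolynomial σ A) (d : σ →₀ ℕ) :
    coeff d (scaleVars r f) = r ^ d.degree * coeff d f := by
  classical
  induction f using MvPolynomial.induction_on' with
  | monomial e a =>
    rw [scaleVars_monomial, coeff_monomial, coeff_monomial]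
    split_ifs with h
    · rw [h]
    · rw [mul_zero]
  | add p q hp hq => rw [map_add, coeff_add, coeff_add, hp, hq, mul_add]

theorem map_scaleVars (φ : A →+* B) (r : A) (f : MvPolynomial σ A) :
    map φ (scaleVars r f) = scaleVars (φ r) (map φ f) := by
  ext d
  simp [coeff_map, coeff_scaleVars]

theorem constantCoeff_scaleVars (r : A) (f : MvPolynomial σ A) :
    constantCoeff (scaleVars r f) = constantCoeff f := by
  simp [constantCoeff_eq, coeff_scaleVars]

attribute [local instance] algebraMvPolynomial

/-- Denominators of polynomials without constant term are cleared by rescaling the variables. -/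
theorem exists_map_eq_scaleVars (M : Submonoid A) [Algebra A B] [IsLocalization M B]
    {κ : Type*} [Finite κ] (f : κ → MvPolynomial σ B) (hf : ∀ k, constantCoeff (f k) = 0) :
    ∃ s ∈ M, ∀ k, ∃ g : MvPolynomial σ A, constantCoeff g = 0 ∧
      map (algebraMap A B) g = scaleVars (algebraMap A B s) (f k) := by
  classical
  obtain ⟨⟨_, s, hs, rfl⟩, h⟩ :=
    IsLocalization.exist_integer_multiples_of_finite (M.map (C (σ := σ) (R := A))) f
  refine ⟨s, hs, fun k ↦ ?_⟩
  obtain ⟨g, hg⟩ := h k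
  have hc (d : σ →₀ ℕ) :
      algebraMap A B (coeff d g) = algebraMap A B s * coeff d (f k) := by
    have := congr_arg (coeff d) hg
    rwa [Algebra.smul_def, algebraMap_def, coeff_map, map_C, coeff_C_mul] at this
  refine ⟨∑ d ∈ g.support.erase 0, monomial d (s ^ (d.degree - 1) * coeff d g), ?_, ?_⟩
  · rw [constantCoeff_eq, coeff_sum]
    refine Finset.sum_eq_zero fun d hd ↦ ?_
    rw [coeff_monomial, if_neg (Finset.ne_of_mem_erase hd)]
  · ext d
    rw [coeff_map, coeff_sum, coeff_scaleVars]
    simp only [coeff_monomial, Finset.sum_ite_eq', Finset.mem_erase, mem_support_iff]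
    by_cases hd : d = 0
    · subst hd
      simpa [constantCoeff_eq] using (hf k).symm
    · have hd' : d.degree = d.degree - 1 + 1 :=
        (Nat.succ_pred_eq_of_ne_zero (mt (Finsupp.degree_eq_zero_iff d).1 hd)).symm
      have hgc : (if d ≠ 0 ∧ coeff d g ≠ 0 then s ^ (d.degree - 1) * coeff d g else 0) =
          s ^ (d.degree - 1) * coeff d g := by
        by_cases h0 : coeff d g = 0 <;> simp [h0, hd]
      rw [hgc, map_mul, hc, map_pow]
      conv_rhs => rw [hd', pow_succ]
      ring

/-- Polynomials without constant term that vanish in a localization vanish after rescaling the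
variables. -/
theorem exists_scaleVars_eq_zero (M : Submonoid A) [Algebra A B] [IsLocalization M B]
    {κ : Type*} [Finite κ] (f : κ → MvPolynomial σ A) (hf : ∀ k, constantCoeff (f k) = 0)
    (hf' : ∀ k, map (algebraMap A B) (f k) = 0) :
    ∃ s ∈ M, ∀ k, scaleVars s (f k) = 0 := by
  classical
  cases nonempty_fintype κ
  have h (k) : ∃ s ∈ M, C s * f k = 0 := by
    obtain ⟨⟨_, s, hs, rfl⟩, h⟩ := IsLocalization.exists_of_eq (M := M.map (C (σ := σ) (R := A)))
      (S := MvPolynomial σ B) (x := f k) (y := 0) (by rw [map_zero]; exact hf' k)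
    exact ⟨s, hs, by simpa using h⟩
  choose s hs h using h
  refine ⟨∏ k, s k, prod_mem fun k _ ↦ hs k, fun k ↦ ?_⟩
  ext d
  rw [coeff_scaleVars, coeff_zero]
  by_cases hd : d = 0
  · subst hd
    simpa [constantCoeff_eq] using hf k
  · have hd' : d.degree = d.degree - 1 + 1 :=
      (Nat.succ_pred_eq_of_ne_zero (mt (Finsupp.degree_eq_zero_iff d).1 hd)).symm
    have hz : s k * coeff d (f k) = 0 := by
      simpa using congr_arg (coeff d) (h k)
    obtain ⟨c, hc⟩ := Finset.dvd_prod_of_mem s (Finset.mem_univ k)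
    rw [hd', pow_succ, hc, mul_assoc, mul_right_comm, hz, zero_mul, mul_zero]

end scaleVars

end MvPolynomial

namespace MvPolynomial

section translate

variable {σ : Type*}

/-- The Taylor expansion `f(x) ↦ f(x + y)`, where the `y` are the outer variables. -/
noncomputable def translate (σ R : Type*) [CommRing R] :
    MvPolynomial σ R →ₐ[R] MvPolynomial σ (MvPolynomial σ R) :=
  aeval fun i ↦ C (X i) + X i

theorem constantCoeff_translate {R : Type*} [CommRing R] (f : MvPolynomial σ R) :
    constantCoeff (translate σ R f) = f := by
  suffices h : (constantCoeff (σ := σ)).comp (translate σ R).toRingHom = RingHom.id _ from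
    RingHom.congr_fun h f
  ext <;> simp [translate, algebraMap_apply]

theorem map_translate {R S : Type*} [CommRing R] [CommRing S] (φ : R →+* S)
    (f : MvPolynomial σ R) :
    map (map φ) (translate σ R f) = translate σ S (map φ f) := by
  suffices h : (map (map φ)).comp (translate σ R).toRingHom =
      (translate σ S).toRingHom.comp (map φ) from RingHom.congr_fun h f
  ext <;> simp [translate, algebraMap_apply]

theorem eval₂_scaleVars_translate {R D : Type*} [CommRing R] [CommRing D] [Algebra R D] (s t : R)
    (p q : σ → D) (f : MvPolynomial σ R) :
    eval₂Hom (aeval p).toRingHom q (scaleVars (C t) (scaleVars (C s) (translate σ R f))) =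
      aeval (p + (s * t) • q) f := by
  suffices h : (((eval₂Hom (aeval p).toRingHom q).comp (scaleVars (C t)).toRingHom).comp
      (scaleVars (C s)).toRingHom).comp (translate σ R).toRingHom =
      (aeval (p + (s * t) • q)).toRingHom from RingHom.congr_fun h f
  ext i
  · simp [translate, algebraMap_apply, scaleVars]
  · simp [translate, scaleVars, Algebra.smul_def, mul_assoc]

end translate

variable {R σ ι : Type*} [CommRing R] [Fintype ι] [DecidableEq ι]

/-- If an idempotent matrix of polynomials becomes equivalent, over a localization, to its
constant term, then some denominator `s` makes `P(p + s q)` and `P(p)` equivalent universally. -/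
theorem exists_murrayVonNeumann_aeval_of_isLocalization (M : Submonoid R) (S : Type*) [CommRing S]
    [Algebra R S] [IsLocalization M S] {P : Matrix ι ι (MvPolynomial σ R)} (hP : P * P = P)
    (h : MurrayVonNeumann ((map (algebraMap R S)).mapMatrix P)
      ((C.comp constantCoeff).mapMatrix ((map (algebraMap R S)).mapMatrix P))) :
    ∃ s ∈ M, ∀ (D : Type) [CommRing D] [Algebra R D] (p q : σ → D),
      MurrayVonNeumann ((aeval (R := R) (p + s • q)).mapMatrix P)
        ((aeval (R := R) p).mapMatrix P) := by
  let : Algebra (MvPolynomial σ R) (MvPolynomial σ S) := algebraMvPolynomial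
  have : IsLocalization (M.map (C (σ := σ) (R := R))) (MvPolynomial σ S) := isLocalization M S
  let φ : MvPolynomial σ R →+* MvPolynomial σ S := algebraMap _ _
  have hφ : φ = map (algebraMap R S) := rfl
  rw [← hφ] at h
  set P' := φ.mapMatrix P with hP'
  obtain ⟨u, v, huv, hvu⟩ := h
  have hPP' : P' * P' = P' := by rw [hP', ← map_mul, hP]
  let τ := (translate σ S).toRingHom.mapMatrix (m := ι)
  let γ := (C (σ := σ) (R := MvPolynomial σ S)).mapMatrix (m := ι)
  let ε := (constantCoeff (σ := σ) (R := MvPolynomial σ S)).mapMatrix (m := ι)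
  have hετ (Q) : ε (τ Q) = Q := by ext i j : 1; exact constantCoeff_translate _
  have hεγ (Q) : ε (γ Q) = Q := by ext i j : 1; exact constantCoeff_C _ _
  have hτγ : τ (v * u) = γ (v * u) := by
    rw [hvu]
    ext i j : 1
    simp [τ, γ, translate, algebraMap_apply]
  let a := τ u * γ v
  let b := γ u * τ v
  have hab : a * b = τ P' := by
    calc a * b = τ u * γ (v * u) * τ v := by simp only [a, b, map_mul, mul_assoc]
      _ = τ (u * v * (u * v)) := by rw [← hτγ]; simp only [map_mul, mul_assoc]
      _ = τ P' := by rw [huv, hPP']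
  have hba : b * a = γ P' := by
    calc b * a = γ u * τ (v * u) * γ v := by simp only [a, b, map_mul, mul_assoc]
      _ = γ (u * v * (u * v)) := by rw [hτγ]; simp only [map_mul, mul_assoc]
      _ = γ P' := by rw [huv, hPP']
  have hεa : ε a = P' := by rw [map_mul, hετ, hεγ, huv]
  have hεb : ε b = P' := by rw [map_mul, hετ, hεγ, huv]
  obtain ⟨_, ⟨s, hs, rfl⟩, hlift⟩ := exists_map_eq_scaleVars (M.map (C (σ := σ) (R := R)))
    (Sum.elim (fun k : ι × ι ↦ (a - γ P') k.1 k.2) (fun k : ι × ι ↦ (b - γ P') k.1 k.2)) (by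
      rintro (k | k)
      · change ε (a - γ P') k.1 k.2 = 0
        rw [map_sub, hεa, hεγ, sub_self, Matrix.zero_apply]
      · change ε (b - γ P') k.1 k.2 = 0
        rw [map_sub, hεb, hεγ, sub_self, Matrix.zero_apply])
  choose g hg0 hg using hlift
  let σs (t : R) := (scaleVars (σ := σ) (C (σ := σ) t)).toRingHom.mapMatrix (m := ι)
  let γ₀ := (C (σ := σ) (R := MvPolynomial σ R)).mapMatrix (m := ι)
  let τ₀ := (translate σ R).toRingHom.mapMatrix (m := ι)
  let ε₀ := (constantCoeff (σ := σ) (R := MvPolynomial σ R)).mapMatrix (m := ι)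
  let μ := (map (σ := σ) φ).mapMatrix (m := ι)
  let σs' := (scaleVars (σ := σ) (φ (C s))).toRingHom.mapMatrix (m := ι)
  have hετ₀ (Q) : ε₀ (τ₀ Q) = Q := by ext i j : 1; exact constantCoeff_translate _
  have hεγ₀ (Q) : ε₀ (γ₀ Q) = Q := by ext i j : 1; exact constantCoeff_C _ _
  have hεσ₀ (t Q) : ε₀ (σs t Q) = ε₀ Q := by ext i j : 1; exact constantCoeff_scaleVars _ _
  have hσγ₀ (t Q) : σs t (γ₀ Q) = γ₀ Q := by ext i j : 1; exact scaleVars_C _ _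
  have hσγ (Q) : σs' (γ Q) = γ Q := by ext i j : 1; exact scaleVars_C _ _
  have hμγ : μ (γ₀ P) = γ P' := by ext i j : 1; exact map_C _ _
  have hμσ (Q) : μ (σs s Q) = σs' (μ Q) := by ext i j : 1; exact map_scaleVars _ _ _
  have hμτ : μ (τ₀ P) = τ P' := by ext i j : 1; exact map_translate _ _
  let a₀ := γ₀ P + Matrix.of fun i j ↦ g (.inl (i, j))
  let b₀ := γ₀ P + Matrix.of fun i j ↦ g (.inr (i, j))
  have hεa₀ : ε₀ a₀ = P := by
    rw [map_add, hεγ₀, add_eq_left]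
    ext i j : 1
    exact hg0 (.inl (i, j))
  have hεb₀ : ε₀ b₀ = P := by
    rw [map_add, hεγ₀, add_eq_left]
    ext i j : 1
    exact hg0 (.inr (i, j))
  have hμa₀ : μ a₀ = σs' a := by
    have : μ (Matrix.of fun i j ↦ g (.inl (i, j))) = σs' (a - γ P') := by
      ext i j : 1
      exact hg (.inl (i, j))
    rw [map_add, this, map_sub, hσγ, hμγ, add_sub_cancel]
  have hμb₀ : μ b₀ = σs' b := by
    have : μ (Matrix.of fun i j ↦ g (.inr (i, j))) = σs' (b - γ P') := by
      ext i j : 1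
      exact hg (.inr (i, j))
    rw [map_add, this, map_sub, hσγ, hμγ, add_sub_cancel]
  have hε₁ : ε₀ (a₀ * b₀ - σs s (τ₀ P)) = 0 := by
    rw [map_sub, map_mul, hεa₀, hεb₀, hεσ₀, hετ₀, hP, sub_self]
  have hε₂ : ε₀ (b₀ * a₀ - γ₀ P) = 0 := by
    rw [map_sub, map_mul, hεa₀, hεb₀, hεγ₀, hP, sub_self]
  have hμ₁ : μ (a₀ * b₀ - σs s (τ₀ P)) = 0 := by
    rw [map_sub, map_mul, hμa₀, hμb₀, ← map_mul, hab, hμσ, hμτ, sub_self]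
  have hμ₂ : μ (b₀ * a₀ - γ₀ P) = 0 := by
    rw [map_sub, map_mul, hμa₀, hμb₀, ← map_mul, hba, hσγ, hμγ, sub_self]
  obtain ⟨_, ⟨t, ht, rfl⟩, hzero⟩ := exists_scaleVars_eq_zero (B := MvPolynomial σ S)
    (M.map (C (σ := σ) (R := R)))
    (Sum.elim (fun k : ι × ι ↦ (a₀ * b₀ - σs s (τ₀ P)) k.1 k.2)
      (fun k : ι × ι ↦ (b₀ * a₀ - γ₀ P) k.1 k.2))
    (by
      rintro (k | k)
      · exact congr_fun₂ hε₁ k.1 k.2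
      · exact congr_fun₂ hε₂ k.1 k.2)
    (by
      rintro (k | k)
      · exact congr_fun₂ hμ₁ k.1 k.2
      · exact congr_fun₂ hμ₂ k.1 k.2)
  have h₁ : σs t a₀ * σs t b₀ = σs t (σs s (τ₀ P)) := by
    rw [← map_mul, ← sub_eq_zero, ← map_sub]
    ext i j : 1
    exact hzero (.inl (i, j))
  have h₂ : σs t b₀ * σs t a₀ = γ₀ P := by
    rw [← hσγ₀ t P, ← map_mul, ← sub_eq_zero, ← map_sub]
    ext i j : 1
    exact hzero (.inr (i, j))
  refine ⟨s * t, mul_mem hs ht, fun D _ _ p q ↦ ?_⟩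
  let θ := (eval₂Hom (aeval (R := R) p).toRingHom q).mapMatrix (m := ι)
  have hθ₁ : θ (σs t (σs s (τ₀ P))) = (aeval (R := R) (p + (s * t) • q)).mapMatrix P := by
    ext i j : 1
    exact eval₂_scaleVars_translate s t p q _
  have hθ₂ : θ (γ₀ P) = (aeval (R := R) p).mapMatrix P := by
    ext i j : 1
    exact eval₂Hom_C _ _ _
  rw [← hθ₁, ← hθ₂]
  exact MurrayVonNeumann.map θ ⟨_, _, h₁, h₂⟩

/-- The Quillen ideal of an idempotent matrix of polynomials. -/
def quillenIdeal {P : Matrix ι ι (MvPolynomial σ R)} (hP : P * P = P) : Ideal R where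
  carrier := {a | ∀ (D : Type) [CommRing D] [Algebra R D] (p q : σ → D),
    MurrayVonNeumann ((aeval (R := R) (p + a • q)).mapMatrix P) ((aeval (R := R) p).mapMatrix P)}
  zero_mem' D _ _ p q := by
    rw [zero_smul, add_zero]
    exact MurrayVonNeumann.map (aeval (R := R) p).mapMatrix ⟨P, P, hP, hP⟩
  add_mem' {a b} ha hb D _ _ p q := by
    refine .trans (by rw [← map_mul, hP]) (by rw [← map_mul, hP]) ?_ (ha D p q)
    rw [add_smul, ← add_assoc]
    exact hb D _ q
  smul_mem' r a ha D _ _ p q := by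
    rw [smul_eq_mul, mul_comm, mul_smul]
    exact ha D p (r • q)

/-- An idempotent matrix of polynomials that is locally equivalent to its constant term is
equivalent to its constant term. -/
theorem murrayVonNeumann_constantCoeff_of_localization {R σ : Type} [CommRing R]
    {P : Matrix ι ι (MvPolynomial σ R)} (hP : P * P = P)
    (h : ∀ (𝔪 : Ideal R) [𝔪.IsMaximal],
      MurrayVonNeumann ((map (algebraMap R (Localization.AtPrime 𝔪))).mapMatrix P)
      ((C.comp constantCoeff).mapMatrix
        ((map (algebraMap R (Localization.AtPrime 𝔪))).mapMatrix P))) :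
    MurrayVonNeumann P ((C.comp constantCoeff).mapMatrix P) := by
  have h1 : (1 : R) ∈ quillenIdeal hP := by
    rw [← Ideal.eq_top_iff_one]
    by_contra hne
    obtain ⟨𝔪, h𝔪, hle⟩ := Ideal.exists_le_maximal _ hne
    obtain ⟨s, hs, hsP⟩ := exists_murrayVonNeumann_aeval_of_isLocalization 𝔪.primeCompl
      (Localization.AtPrime 𝔪) hP (h 𝔪)
    exact hs (hle hsP)
  convert h1 (MvPolynomial σ R) 0 X using 1
  · ext i j : 1
    simp
  · ext i j : 1
    simpa [algebraMap_eq] using (aeval_zero (R := R) (S₁ := MvPolynomial σ R) (P i j)).symm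

end MvPolynomial

/-- If a polynomial base change `S[x] ⊗ N₀` is presented by `P`, then `P` is equivalent to its
constant term. -/
theorem Matrix.Presents.murrayVonNeumann_constantCoeff {S σ ι : Type*} [CommRing S] [Fintype ι]
    [DecidableEq ι] {P : Matrix ι ι (MvPolynomial σ S)} {N₀ : Type*} [AddCommGroup N₀] [Module S N₀]
    (h : P.Presents (MvPolynomial σ S ⊗[S] N₀)) :
    MurrayVonNeumann P ((MvPolynomial.C.comp MvPolynomial.constantCoeff).mapMatrix P) := by
  let : Algebra (MvPolynomial σ S) S := MvPolynomial.constantCoeff.toAlgebra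
  have : IsScalarTower S (MvPolynomial σ S) S :=
    .of_algebraMap_eq fun x ↦ (MvPolynomial.constantCoeff_C σ x).symm
  have h₀ := (h.baseChange S).of_linearEquiv
    (AlgebraTensorModule.cancelBaseChange S (MvPolynomial σ S) S S N₀ ≪≫ₗ TensorProduct.lid S N₀)
  exact h.murrayVonNeumann (h₀.baseChange (MvPolynomial σ S))

/-- Let `R` be a commutative ring and `A := R[x₁,…,xₙ]` the polynomial ring.  If for
every maximal ideal `𝔪` of `R` every finitely generated projective
`R_𝔪[x₁,…,xₙ]`-module is extended from `R_𝔪`, then every finitely generated projective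
`A`-module is extended from `R`. -/
theorem extended_of_locally_extended {R : Type} [CommRing R] (n : ℕ)
    (H : ∀ (𝔪 : Ideal R) (h𝔪 : 𝔪.IsMaximal),
      letI := h𝔪.isPrime;
      ∀ (N : Type) (_ : AddCommGroup N)
        (_ : Module (MvPolynomial (Fin n) (Localization.AtPrime 𝔪)) N),
        Module.Finite (MvPolynomial (Fin n) (Localization.AtPrime 𝔪)) N →
        Module.Projective (MvPolynomial (Fin n) (Localization.AtPrime 𝔪)) N →
        ∃ (N₀ : Type) (_ : AddCommGroup N₀) (_ : Module (Localization.AtPrime 𝔪) N₀),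
          Nonempty (N ≃ₗ[MvPolynomial (Fin n) (Localization.AtPrime 𝔪)]
            (MvPolynomial (Fin n) (Localization.AtPrime 𝔪)
              ⊗[Localization.AtPrime 𝔪] N₀))) :
    ∀ (M : Type) (_ : AddCommGroup M) (_ : Module (MvPolynomial (Fin n) R) M),
      Module.Finite (MvPolynomial (Fin n) R) M →
      Module.Projective (MvPolynomial (Fin n) R) M →
      ∃ (M₀ : Type) (_ : AddCommGroup M₀) (_ : Module R M₀),
        Nonempty (M ≃ₗ[MvPolynomial (Fin n) R]
          (MvPolynomial (Fin n) R ⊗[R] M₀)) := by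
  intro M _ _ _ _
  obtain ⟨k, P, hPM⟩ := Matrix.Presents.exists_of_projective (MvPolynomial (Fin n) R) M
  have hP := hPM.mul_self
  have hconst := MvPolynomial.murrayVonNeumann_constantCoeff_of_localization hP fun 𝔪 h𝔪 ↦ by
    have hN := Matrix.Presents.range
      (P := (MvPolynomial.map (algebraMap R (Localization.AtPrime 𝔪))).mapMatrix P)
      (by rw [← map_mul, hP])
    obtain ⟨N₀, _, _, ⟨e⟩⟩ :=
      H 𝔪 h𝔪 _ (Submodule.addCommGroup _) (Submodule.module _) hN.finite hN.projective
    exact (hN.of_linearEquiv e).murrayVonNeumann_constantCoeff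
  have hM₀ := Matrix.Presents.range (P := MvPolynomial.constantCoeff.mapMatrix P)
    (by rw [← map_mul, hP])
  exact ⟨_, _, _, hPM.nonempty_linearEquiv
    ((hM₀.baseChange (MvPolynomial (Fin n) R)).of_murrayVonNeumann hconst hP)⟩
end

section
/- (Quillen–Suslin theorem) Let K be a field and A := K[x₁,…,xₙ] the polynomial ring in n variables over K. Then A is 𝒫ℱ, i.e., every finitely generated projective A-module is free. -/
section FreeResolution

open Function

universe u

/-- `HasFreeResolution R n M` says that `M` has a resolution of length at most `n` by finite free
`R`-modules. -/
def HasFreeResolution (R : Type u) [CommRing R] :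
    ℕ → ∀ (M : Type u) [AddCommGroup M] [Module R M], Prop
  | 0, M, _, _ => Module.Free R M ∧ Module.Finite R M
  | n + 1, M, _, _ => ∃ (K F : Type u) (_ : AddCommGroup K) (_ : AddCommGroup F) (_ : Module R K)
      (_ : Module R F) (f : K →ₗ[R] F) (g : F →ₗ[R] M),
      Injective f ∧ Exact f g ∧ Surjective g ∧ Module.Free R F ∧ Module.Finite R F ∧
        HasFreeResolution R n K

namespace HasFreeResolution

variable {R : Type u} [CommRing R] {A B C : Type u} [AddCommGroup A] [Module R A]
  [AddCommGroup B] [Module R B] [AddCommGroup C] [Module R C]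

theorem succ {n : ℕ} (h : HasFreeResolution R n A) : HasFreeResolution R (n + 1) A := by
  induction n generalizing A with
  | zero =>
    obtain ⟨_, _⟩ := h
    exact ⟨PUnit, A, _, _, inferInstance, _, 0, .id, injective_of_subsingleton _,
      fun x ↦ by simp [eq_comm], surjective_id, ‹_›, ‹_›, inferInstance, inferInstance⟩
  | succ n ih =>
    obtain ⟨K, F, _, _, _, _, f, g, hf, hfg, hg, hF, hF', hK⟩ := h
    exact ⟨K, F, _, _, _, _, f, g, hf, hfg, hg, hF, hF', ih hK⟩

theorem mono {m n : ℕ} (hmn : m ≤ n) (h : HasFreeResolution R m A) : HasFreeResolution R n A := by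
  induction hmn with
  | refl => exact h
  | step _ ih => exact ih.succ

/-- An extension of `C` by `A` with `C` projective is a direct sum. -/
theorem _root_.Function.Exact.nonempty_equiv_prod {f : A →ₗ[R] B} {g : B →ₗ[R] C}
    [Module.Projective R C] (hf : Injective f) (hfg : Exact f g) (hg : Surjective g) :
    Nonempty (B ≃ₗ[R] A × C) := by
  obtain ⟨l, hl⟩ := g.exists_rightInverse_of_surjective (LinearMap.range_eq_top.2 hg)
  exact ⟨(hfg.splitSurjectiveEquiv hf ⟨l, hl⟩).1⟩

/-- The horseshoe lemma. -/
theorem extension {n : ℕ} {f : A →ₗ[R] B} {g : B →ₗ[R] C} (hf : Injective f) (hfg : Exact f g)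
    (hg : Surjective g) (hA : HasFreeResolution R n A) (hC : HasFreeResolution R n C) :
    HasFreeResolution R n B := by
  induction n generalizing A B C with
  | zero =>
    obtain ⟨_, _⟩ := hA
    obtain ⟨_, _⟩ := hC
    obtain ⟨e⟩ := hfg.nonempty_equiv_prod hf hg
    exact ⟨.of_equiv e.symm, .equiv e.symm⟩
  | succ n ih =>
    obtain ⟨K, F, _, _, _, _, i, p, hi, hip, hp, _, _, hK⟩ := hA
    obtain ⟨K', F', _, _, _, _, i', p', hi', hip', hp', _, _, hK'⟩ := hC
    obtain ⟨q, hq⟩ := Module.projective_lifting_property g p' hg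
    have hq (x) : g (q x) = p' x := LinearMap.congr_fun hq x
    let r : F × F' →ₗ[R] B := (f ∘ₗ p).coprod q
    have hr (x : F × F') : r x = f (p x.1) + q x.2 := by simp [r]
    have hgf (x) : g (f x) = 0 := hfg.apply_apply_eq_zero x
    have hrs : Surjective r := fun b ↦ by
      obtain ⟨y, hy⟩ := hp' (g b)
      obtain ⟨a, ha⟩ := (hfg (b - q y)).1 (by simp [hq, hy])
      obtain ⟨x, rfl⟩ := hp a
      exact ⟨(x, y), by simp [hr, ha]⟩
    let j : K →ₗ[R] LinearMap.ker r := LinearMap.codRestrict _ (.inl R F F' ∘ₗ i) fun x ↦ by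
      simp [hr, hip.apply_apply_eq_zero]
    let s : LinearMap.ker r →ₗ[R] K' :=
      LinearMap.codRestrictOfInjective (.snd R F F' ∘ₗ (LinearMap.ker r).subtype) i' hi' fun x ↦ by
        have := congrArg g (x.2 : r x = 0)
        rw [hr, map_add, hgf, hq, zero_add, map_zero] at this
        exact (hip' _).1 this
    have hs (x) : i' (s x) = x.1.2 :=
      LinearMap.codRestrictOfInjective_comp_apply ..
    refine ⟨_, F × F', _, _, _, _, (LinearMap.ker r).subtype, r, Subtype.val_injective,
      LinearMap.exact_subtype_ker_map r, hrs, inferInstance, inferInstance,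
      ih (f := j) (g := s) ?_ ?_ ?_ hK hK'⟩
    · intro x y h
      exact hi (congrArg (fun z ↦ z.1.1) h)
    · intro x
      constructor
      · intro h
        have h2 : x.1.2 = 0 := by rw [← hs, h, map_zero]
        have h1 : p x.1.1 = 0 := hf (by
          have : r x = 0 := x.2
          rw [hr, h2] at this
          simpa using this)
        obtain ⟨k, hk⟩ := (hip _).1 h1
        exact ⟨k, Subtype.ext (Prod.ext hk h2.symm)⟩
      · rintro ⟨k, rfl⟩
        exact hi' (by rw [hs, map_zero]; rfl)
    · intro y
      obtain ⟨a, ha⟩ := (hfg (q (i' y))).1 (by simp [hq, hip'.apply_apply_eq_zero])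
      obtain ⟨x, rfl⟩ := hp a
      exact ⟨⟨(-x, i' y), by simp [hr, ha]⟩, hi' (by rw [hs])⟩

theorem quotient {n : ℕ} {f : A →ₗ[R] B} {g : B →ₗ[R] C} (hf : Injective f) (hfg : Exact f g)
    (hg : Surjective g) (hA : HasFreeResolution R n A) (hB : HasFreeResolution R n B) :
    HasFreeResolution R (n + 1) C := by
  obtain ⟨K, F, _, _, _, _, i, p, hi, hip, hp, _, _, hK⟩ := hB.succ
  let r : F →ₗ[R] C := g ∘ₗ p
  let j : K →ₗ[R] LinearMap.ker r := LinearMap.codRestrict _ i fun x ↦ by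
    simp [r, hip.apply_apply_eq_zero]
  let s : LinearMap.ker r →ₗ[R] A :=
    LinearMap.codRestrictOfInjective (p ∘ₗ (LinearMap.ker r).subtype) f hf fun x ↦ (hfg _).1 x.2
  have hs (x) : f (s x) = p x.1 := LinearMap.codRestrictOfInjective_comp_apply ..
  refine ⟨_, F, _, _, _, _, (LinearMap.ker r).subtype, r, Subtype.val_injective,
    LinearMap.exact_subtype_ker_map r, hg.comp hp, inferInstance, inferInstance,
    extension (f := j) (g := s) ?_ ?_ ?_ hK hA⟩
  · intro x y h
    exact hi (congrArg Subtype.val h)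
  · intro x
    constructor
    · intro h
      obtain ⟨k, hk⟩ := (hip x.1).1 (by rw [← hs, h, map_zero])
      exact ⟨k, Subtype.ext hk⟩
    · rintro ⟨k, rfl⟩
      exact hf (by rw [hs]; simp [j, hip.apply_apply_eq_zero])
  · intro a
    obtain ⟨x, hx⟩ := hp (f a)
    exact ⟨⟨x, by simp [r, hx, hfg.apply_apply_eq_zero]⟩, hf (by rw [hs, hx])⟩

open TensorProduct in
theorem baseChange {n : ℕ} (S : Type u) [CommRing S] [Algebra R S] [Module.Flat R S]
    (h : HasFreeResolution R n A) : HasFreeResolution S n (S ⊗[R] A) := by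
  induction n generalizing A with
  | zero =>
    obtain ⟨_, _⟩ := h
    exact ⟨inferInstance, inferInstance⟩
  | succ n ih =>
    obtain ⟨K, F, _, _, _, _, f, g, hf, hfg, hg, _, _, hK⟩ := h
    exact ⟨S ⊗[R] K, S ⊗[R] F, _, _, _, _, f.baseChange S, g.baseChange S,
      Module.Flat.lTensor_preserves_injective_linearMap f hf, lTensor_exact S hfg hg,
      LinearMap.lTensor_surjective S hg, inferInstance, inferInstance, ih hK⟩

theorem of_ringEquiv {n : ℕ} {S : Type u} [CommRing S] [Module S B] (σ : R ≃+* S) (e : A ≃+ B)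
    (he : ∀ (r : R) (a : A), e (r • a) = σ r • e a) (h : HasFreeResolution R n A) :
    HasFreeResolution S n B := by
  let := RingHomInvPair.of_ringEquiv σ
  let := RingHomInvPair.of_ringEquiv_symm σ
  induction n generalizing A B with
  | zero =>
    obtain ⟨_, _⟩ := h
    let e' : A ≃ₛₗ[(σ : R →+* S)] B := { e with map_smul' := he }
    exact ⟨.of_equiv e', .of_surjective e'.toLinearMap e.surjective⟩
  | succ n ih =>
    obtain ⟨K, F, _, _, _, _, f, g, hf, hfg, hg, _, _, hK⟩ := h
    let : Module S K := Module.compHom K (σ.symm : S →+* R)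
    let : Module S F := Module.compHom F (σ.symm : S →+* R)
    let eF : F ≃ₛₗ[(σ : R →+* S)] F := { AddEquiv.refl F with
      map_smul' := fun r x ↦ congrArg (· • x) (σ.symm_apply_apply r).symm }
    refine ⟨K, F, _, _, _, _, { f.toAddMonoidHom with map_smul' := fun s x ↦ f.map_smul _ x },
      { e.toAddMonoidHom.comp g.toAddMonoidHom with map_smul' := fun s x ↦ ?_ }, hf, fun x ↦ ?_,
      e.surjective.comp hg, .of_equiv eF, .of_surjective eF.toLinearMap eF.surjective,
      ih (.refl K) (fun r x ↦ congrArg (· • x) (σ.symm_apply_apply r).symm) hK⟩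
    · change e (g (σ.symm s • x)) = s • e (g x)
      rw [map_smul, he, σ.apply_symm_apply]
    · change e (g x) = 0 ↔ x ∈ Set.range f
      rw [← hfg x]
      simp

/-- A projective module with a finite resolution by finite free modules is stably free. -/
theorem isStablyFree {n : ℕ} [Module.Projective R A] (h : HasFreeResolution R n A) :
    Module.IsStablyFree R A := by
  induction n generalizing A with
  | zero =>
    obtain ⟨_, _⟩ := h
    infer_instance
  | succ n ih =>
    obtain ⟨K, F, _, _, _, _, f, g, hf, hfg, hg, _, _, hK⟩ := h
    obtain ⟨e⟩ := hfg.nonempty_equiv_prod hf hg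
    have : Module.Projective R K :=
      .of_split (e.symm.toLinearMap ∘ₗ .inl R K A) (.fst R K A ∘ₗ e.toLinearMap) (by ext; simp)
    have : Module.Finite R K :=
      .of_surjective (.fst R K A ∘ₗ e.toLinearMap) (Prod.fst_surjective.comp e.surjective)
    have := ih hK
    obtain ⟨N, _, _, _, _, _⟩ := Module.IsStablyFree.exist_free_prod R K
    have : Module.Free R (A × K × N) := .of_equiv <|
      ((e ≪≫ₗ .prodComm R K A).prodCongr (.refl R N)).trans (.prodAssoc R A K N)
    exact .of_free_prod R A (K × N)

end HasFreeResolution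

end FreeResolution

section PolynomialPresentation

open Polynomial TensorProduct LinearMap

universe u

variable {R M : Type u} [CommRing R] [AddCommGroup M] [Module R M]

namespace Submodule

variable {V : Submodule R M}

/-- The tensors `∑ Xⁱ ⊗ vᵢ` with `i ≤ d`. -/
noncomputable def tensorDegreeLE (V : Submodule R M) (d : ℕ) : Submodule R (R[X] ⊗[R] V) :=
  span R {z | ∃ i ≤ d, ∃ v : V, z = (X ^ i) ⊗ₜ v}

theorem tensorDegreeLE_mono : Monotone V.tensorDegreeLE := fun _ _ h ↦
  span_mono fun _ ⟨i, hi, v, hz⟩ ↦ ⟨i, hi.trans h, v, hz⟩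

theorem exists_mem_tensorDegreeLE (z : R[X] ⊗[R] V) : ∃ d, z ∈ V.tensorDegreeLE d := by
  induction z with
  | zero => exact ⟨0, zero_mem _⟩
  | add x y hx hy =>
    obtain ⟨d, hd⟩ := hx
    obtain ⟨e, he⟩ := hy
    exact ⟨max d e, add_mem (tensorDegreeLE_mono (le_max_left _ _) hd)
      (tensorDegreeLE_mono (le_max_right _ _) he)⟩
  | tmul p v =>
    refine ⟨p.natDegree, ?_⟩
    have h : p ⊗ₜ[R] v = ∑ i ∈ Finset.range (p.natDegree + 1), (C (p.coeff i) * X ^ i) ⊗ₜ v := by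
      conv_lhs => rw [p.as_sum_range_C_mul_X_pow, sum_tmul]
    rw [h]
    refine sum_mem fun i hi ↦ ?_
    rw [← smul_eq_C_mul, ← smul_tmul']
    exact smul_mem _ _ (subset_span ⟨i, by simpa [Nat.lt_succ_iff] using hi, v, rfl⟩)

end Submodule

variable [Module R[X] M] [IsScalarTower R R[X] M]

/-- Multiplication by the variable on an `R[X]`-module, as an `R`-linear map. -/
noncomputable def Polynomial.mulX (R M : Type u) [CommRing R] [AddCommGroup M] [Module R M]
    [Module R[X] M] [IsScalarTower R R[X] M] : M →ₗ[R] M :=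
  Algebra.lsmul R R M (X : R[X])

@[simp]
theorem Polynomial.mulX_apply (m : M) : mulX R M m = (X : R[X]) • m := rfl

theorem Polynomial.mulX_pow_apply (i : ℕ) (m : M) : (mulX R M ^ i) m = (X ^ i : R[X]) • m := by
  simp [mulX, ← map_pow]

namespace Submodule

variable (V : Submodule R M)

/-- The elements of `V` that multiplication by the variable maps to `V`. -/
noncomputable def interX : Submodule R M := V ⊓ V.comap (mulX R M)

theorem interX_le : V.interX ≤ V := inf_le_left

/-- The evaluation map `p ⊗ v ↦ p • v`. -/
noncomputable def polyEval : R[X] ⊗[R] V →ₗ[R[X]] M := V.subtype.liftBaseChange R[X]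

/-- The map `1 ⊗ w ↦ 1 ⊗ X w - X ⊗ w`, whose cokernel approximates `M`. -/
noncomputable def polyRel : R[X] ⊗[R] V.interX →ₗ[R[X]] R[X] ⊗[R] V :=
  (TensorProduct.mk R R[X] V 1 ∘ₗ ((mulX R M).restrict (p := V.interX) fun _ h ↦ h.2) -
    TensorProduct.mk R R[X] V X ∘ₗ inclusion V.interX_le).liftBaseChange R[X]

theorem polyEval_tmul (p : R[X]) (v : V) : V.polyEval (p ⊗ₜ v) = p • (v : M) := by
  simp [polyEval]

theorem polyRel_tmul (p : R[X]) (w : V.interX) :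
    V.polyRel (p ⊗ₜ w) = p ⊗ₜ ⟨(X : R[X]) • w.1, w.2.2⟩ - (p * X) ⊗ₜ ⟨w.1, w.2.1⟩ := by
  simp only [polyRel, liftBaseChange_tmul, LinearMap.sub_apply, coe_comp, Function.comp_apply,
    mk_apply, smul_sub, smul_tmul', smul_eq_mul, mul_one]
  rfl

theorem polyEval_polyRel (z : R[X] ⊗[R] V.interX) : V.polyEval (V.polyRel z) = 0 := by
  induction z with
  | zero => simp
  | add x y hx hy => simp [hx, hy]
  | tmul p w => simp [polyRel_tmul, polyEval_tmul, mul_smul]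

theorem polyRel_injective : Function.Injective V.polyRel := by
  rw [injective_iff_map_eq_zero]
  intro z hz
  let c (W : Submodule R M) : R[X] ⊗[R] W ≃ₗ[R] ℕ →₀ W :=
    equivFinsuppOfBasisLeft (Polynomial.basisMonomials R)
  have hc (W : Submodule R M) (p : R[X]) (w : W) (i : ℕ) : c W (p ⊗ₜ w) i = p.coeff i • w :=
    equivFinsuppOfBasisLeft_apply_tmul_apply _ _ _ _
  have key (z : R[X] ⊗[R] V.interX) (i : ℕ) :
      (c V (V.polyRel z) (i + 1) : M) = (X : R[X]) • (c _ z (i + 1) : M) - c _ z i := by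
    induction z with
    | zero => simp
    | add x y hx hy => simp only [map_add, Finsupp.add_apply, coe_add, hx, hy, smul_add]; abel
    | tmul p w =>
      rw [polyRel_tmul, map_sub, Finsupp.sub_apply, hc, hc, hc, hc, coeff_mul_X]
      rw [coe_smul, smul_comm]
      rfl
  have key' (i : ℕ) : (c _ z i : M) = (X : R[X]) • (c _ z (i + 1) : M) := by
    have := key z i
    rw [hz] at this
    simpa using (sub_eq_zero.1 (by simpa using this.symm)).symm
  have hzero (k i : ℕ) (hi : (c _ z).support.sup _root_.id < i + k) : (c _ z i : M) = 0 := by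
    induction k generalizing i with
    | zero =>
      have : i ∉ (c _ z).support := fun h ↦ by
        have := Finset.le_sup (f := _root_.id) h
        simp only [id_eq] at this
        omega
      simpa using this
    | succ k ih => rw [key', ih (i + 1) (by omega), smul_zero]
  apply (c _).injective
  ext i
  simpa using hzero _ i (by omega : _ < i + ((c _ z).support.sup _root_.id + 1))

variable {V}

theorem polyEval_surjective (hV : span R[X] (V : Set M) = ⊤) :
    Function.Surjective V.polyEval := by
  rw [← range_eq_top, eq_top_iff, ← hV, span_le]
  exact fun v hv ↦ ⟨1 ⊗ₜ ⟨v, hv⟩, by simp [polyEval_tmul]⟩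

/-- Over a Noetherian ring, every finitely generated `R[X]`-module is presented by `polyRel` and
`polyEval` for some finitely generated `R`-submodule. -/
theorem exists_exact_polyRel_polyEval [IsNoetherianRing R] [Module.Finite R[X] M] :
    ∃ V : Submodule R M, V.FG ∧ Function.Exact V.polyRel V.polyEval ∧
      Function.Surjective V.polyEval := by
  obtain ⟨s, hs⟩ := ‹Module.Finite R[X] M›.fg_top
  let V₀ : Submodule R M := span R s
  have : Module.Finite R V₀ := .span_finset R s
  have hV₀ : span R[X] (V₀ : Set M) = ⊤ :=
    eq_top_iff.2 (hs ▸ span_mono subset_span)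
  obtain ⟨T, hT⟩ := IsNoetherian.noetherian (ker V₀.polyEval)
  choose deg hdeg using fun z : R[X] ⊗[R] V₀ ↦ exists_mem_tensorDegreeLE z
  let d := T.sup deg
  let V : Submodule R M := ⨆ i : Fin (d + 1), V₀.map (mulX R M ^ i.1)
  have hV {i : ℕ} (hi : i ≤ d) {v : M} (hv : v ∈ V₀) : (X ^ i : R[X]) • v ∈ V := by
    exact mem_iSup_of_mem (⟨i, by omega⟩ : Fin (d + 1)) ⟨v, hv, mulX_pow_apply i v⟩
  have hV₀V : V₀ ≤ V := fun v hv ↦ by simpa using hV (Nat.zero_le d) hv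
  let I := range V.polyRel
  let ι : R[X] ⊗[R] V₀ →ₗ[R[X]] R[X] ⊗[R] V := (inclusion hV₀V).baseChange R[X]
  have hι (p : R[X]) (v : V₀) : ι (p ⊗ₜ v) = p ⊗ₜ inclusion hV₀V v := by simp [ι]
  have hιe (z) : V.polyEval (ι z) = V₀.polyEval z := by
    induction z with
    | zero => simp
    | add x y hx hy => simp [hx, hy]
    | tmul p v => simp [hι, polyEval_tmul]
  have hpow (v : V₀) (i : ℕ) (hi : i ≤ d) :
      ι ((X ^ i) ⊗ₜ v) - 1 ⊗ₜ ⟨(X ^ i : R[X]) • v.1, hV hi v.2⟩ ∈ I := by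
    induction i with
    | zero =>
      convert I.zero_mem
      rw [hι, sub_eq_zero]
      congr 1
      exact Subtype.ext (by simp)
    | succ i ih =>
      have h1 := I.smul_mem X (ih (by omega))
      have h2 : V.polyRel (1 ⊗ₜ ⟨(X ^ i : R[X]) • v.1, hV (by omega) v.2, by
        simpa [pow_succ', mul_smul] using hV hi v.2⟩) ∈ I := mem_range_self _ _
      have := I.sub_mem h1 h2
      convert this using 1
      simp only [hι, polyRel_tmul, smul_sub, smul_tmul', smul_eq_mul, mul_one, one_mul, smul_smul,
        pow_succ']
      abel
  have hdegree (z : R[X] ⊗[R] V₀) (hz : z ∈ V₀.tensorDegreeLE d) :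
      ∃ h : V₀.polyEval z ∈ V, ι z - 1 ⊗ₜ ⟨V₀.polyEval z, h⟩ ∈ I := by
    induction hz using span_induction with
    | mem z hz =>
      obtain ⟨i, hi, v, rfl⟩ := hz
      have := hpow v i hi
      simp only [polyEval_tmul]
      exact ⟨hV hi v.2, this⟩
    | zero =>
      refine ⟨by simp, ?_⟩
      convert I.zero_mem
      simp only [map_zero, zero_sub, neg_eq_zero]
      exact tmul_zero _ _
    | add x y _ _ hx hy =>
      obtain ⟨hx, hx'⟩ := hx
      obtain ⟨hy, hy'⟩ := hy
      refine ⟨by simpa using add_mem hx hy, ?_⟩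
      convert I.add_mem hx' hy' using 1
      rw [map_add, sub_add_sub_comm, ← tmul_add]
      congr
      simp
    | smul r x _ hx =>
      obtain ⟨hx, hx'⟩ := hx
      refine ⟨by simpa using V.smul_mem r hx, ?_⟩
      convert (I.restrictScalars R).smul_mem r hx' using 1
      rw [smul_sub, ← tmul_smul, map_smul_of_tower]
      simp
  have hker (z) (hz : V₀.polyEval z = 0) : ι z ∈ I := by
    have : ker V₀.polyEval ≤ I.comap ι := by
      rw [← hT, span_le]
      intro t ht
      have htk : V₀.polyEval t = 0 := by
        have : t ∈ ker V₀.polyEval := hT ▸ subset_span ht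
        exact this
      obtain ⟨h, h'⟩ := hdegree t (tensorDegreeLE_mono (Finset.le_sup ht) (hdeg t))
      have h0 : (⟨V₀.polyEval t, h⟩ : V) = 0 := Subtype.ext htk
      simpa [h0] using h'
    exact this hz
  have hsurj (z : R[X] ⊗[R] V) : z ∈ range ι ⊔ I := by
    induction z with
    | zero => exact zero_mem _
    | add x y hx hy => exact add_mem hx hy
    | tmul p v =>
      have hone (v : M) (hv : v ∈ V) :
          ∃ h : v ∈ V, (1 : R[X]) ⊗ₜ[R] (⟨v, h⟩ : V) ∈ range ι ⊔ I := by
        refine ⟨hv, ?_⟩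
        induction hv using iSup_induction' with
        | mem i x hx =>
          obtain ⟨v, hv, rfl⟩ := hx
          have h1 := hpow ⟨v, hv⟩ i (by omega)
          have h2 : ι ((X ^ i.1) ⊗ₜ ⟨v, hv⟩) ∈ range ι := mem_range_self _ _
          convert sub_mem (mem_sup_left h2) (mem_sup_right h1) using 1
          rw [sub_sub_cancel]
          congr
          exact mulX_pow_apply _ _
        | zero =>
          convert (range ι ⊔ I).zero_mem
          exact tmul_zero _ _
        | add x y _ _ hx hy =>
          convert add_mem hx hy using 1
          rw [← tmul_add]
          rfl
      have := (range ι ⊔ I).smul_mem p (hone v.1 v.2).2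
      simpa [smul_tmul'] using this
  refine ⟨V, ?_, fun z ↦ ⟨fun hz ↦ ?_, ?_⟩, ?_⟩
  · refine fg_iSup _ fun i ↦ FG.map _ ?_
    exact ⟨s, rfl⟩
  · obtain ⟨_, ⟨y, rfl⟩, i, hi, rfl⟩ := mem_sup.1 (hsurj z)
    obtain ⟨w, rfl⟩ := hi
    rw [map_add, polyEval_polyRel, add_zero, hιe] at hz
    exact I.add_mem (hker y hz) ⟨w, rfl⟩
  · rintro ⟨w, rfl⟩
    exact V.polyEval_polyRel w
  · exact polyEval_surjective (eq_top_iff.2 (hV₀ ▸ span_mono hV₀V))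

end Submodule

/-- Serre: finite free resolutions of finitely generated modules pass to polynomial rings. -/
theorem HasFreeResolution.polynomial {R : Type u} [CommRing R] [IsNoetherianRing R]
    (H : ∀ (M : Type u) [AddCommGroup M] [Module R M] [Module.Finite R M],
      ∃ n, HasFreeResolution R n M)
    (M : Type u) [AddCommGroup M] [Module R[X] M] [Module.Finite R[X] M] :
    ∃ n, HasFreeResolution R[X] n M := by
  let : Module R M := Module.compHom M (C : R →+* R[X])
  have : IsScalarTower R R[X] M := ⟨fun r p m ↦ by
    rw [smul_eq_C_mul, mul_smul]
    rfl⟩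
  obtain ⟨V, hV, hex, hsurj⟩ := Submodule.exists_exact_polyRel_polyEval (R := R) (M := M)
  have : Module.Finite R V := .of_fg hV
  have : Module.Finite R V.interX :=
    .of_injective (Submodule.inclusion V.interX_le) (Submodule.inclusion_injective _)
  obtain ⟨k, hk⟩ := H V.interX
  obtain ⟨l, hl⟩ := H V
  exact ⟨_, .quotient V.polyRel_injective hex hsurj ((hk.mono (le_max_left k l)).baseChange R[X])
    ((hl.mono (le_max_right k l)).baseChange R[X])⟩

end PolynomialPresentation

section Unimodular

open Matrix Polynomial

variable {ι R S : Type*} [Fintype ι] [CommRing R] [CommRing S]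

/-- A vector is unimodular if its entries generate the unit ideal. -/
def IsUnimodular (v : ι → R) : Prop := ∃ g : ι → R, g ⬝ᵥ v = 1

theorem IsUnimodular.map {v : ι → R} (hv : IsUnimodular v) (f : R →+* S) :
    IsUnimodular (f ∘ v) := by
  obtain ⟨g, hg⟩ := hv
  exact ⟨f ∘ g, by rw [← RingHom.map_dotProduct, hg, map_one]⟩

theorem IsUnimodular.exists_isUnit_coeff [IsLocalRing R] {v : ι → R[X]} (hv : IsUnimodular v)
    {i : ι} (hi : (v i).Monic) (hd : (v i).natDegree ≠ 0) :
    ∃ j ≠ i, ∃ m, IsUnit ((v j).coeff m) := by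
  by_contra! h
  let f := mapRingHom (IsLocalRing.residue R)
  obtain ⟨g, hg⟩ := hv.map f
  have hz (j) (hj : j ≠ i) : f (v j) = 0 := by
    ext m
    simpa [f, IsLocalRing.residue_eq_zero_iff, IsLocalRing.mem_maximalIdeal] using h j hj m
  rw [dotProduct, Fintype.sum_eq_single i fun j hj ↦ by simp [hz j hj]] at hg
  have h1 : ((v i).map (IsLocalRing.residue R)).natDegree = 0 :=
    natDegree_eq_zero_of_isUnit (IsUnit.of_mul_eq_one_right _ hg)
  rw [hi.natDegree_map] at h1
  exact hd h1

variable [DecidableEq ι]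

/-- Two column vectors are equivalent if an invertible matrix maps one to the other. -/
def VectorEquivalent (v w : ι → R) : Prop :=
  ∃ U : (Matrix ι ι R)ˣ, (U : Matrix ι ι R) *ᵥ v = w

/-- A vector is completable if it is equivalent to a standard basis vector. -/
def IsCompletable (v : ι → R) : Prop := ∃ i, VectorEquivalent v (Pi.single i 1)

namespace VectorEquivalent

variable {u v w : ι → R}

theorem refl (v : ι → R) : VectorEquivalent v v := ⟨1, by simp⟩

theorem symm : VectorEquivalent v w → VectorEquivalent w v := by
  rintro ⟨U, rfl⟩
  exact ⟨U⁻¹, by simp [mulVec_mulVec]⟩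

theorem trans : VectorEquivalent u v → VectorEquivalent v w → VectorEquivalent u w := by
  rintro ⟨U, rfl⟩ ⟨V, rfl⟩
  exact ⟨V * U, by simp [mulVec_mulVec]⟩

theorem map (f : R →+* S) (h : VectorEquivalent v w) : VectorEquivalent (f ∘ v) (f ∘ w) := by
  obtain ⟨U, rfl⟩ := h
  exact ⟨U.map (f.mapMatrix (m := ι)).toMonoidHom, by ext; simp [RingHom.map_mulVec]⟩

theorem isUnimodular (h : VectorEquivalent v w) (hv : IsUnimodular v) : IsUnimodular w := by
  obtain ⟨U, rfl⟩ := h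
  obtain ⟨g, hg⟩ := hv
  refine ⟨g ᵥ* (U⁻¹ : (Matrix ι ι R)ˣ), ?_⟩
  simp [← dotProduct_mulVec, mulVec_mulVec, hg]

theorem isCompletable (h : VectorEquivalent v w) : IsCompletable w → IsCompletable v :=
  fun ⟨i, hi⟩ ↦ ⟨i, h.trans hi⟩

theorem smul_unit (v : ι → R) (u : Rˣ) : VectorEquivalent v (u • v) :=
  ⟨u.map (algebraMap R (Matrix ι ι R)).toMonoidHom, by
    simp [Algebra.algebraMap_eq_smul_one, smul_mulVec, Units.smul_def]⟩

theorem add_smul (v : ι → R) {i : ι} {f : ι → R} (hf : f i = 0) :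
    VectorEquivalent v (v + v i • f) := by
  have key (f g : ι → R) (hg : g i = 0) (v : ι → R) :
      (1 + vecMulVec f (Pi.single i 1)) *ᵥ ((1 + vecMulVec g (Pi.single i 1)) *ᵥ v) =
        v + v i • (f + g) := by
    simp only [add_mulVec, one_mulVec, vecMulVec_mulVec]
    ext j
    simp [hg]
    ring
  have inv (f g : ι → R) (hg : g i = 0) (hfg : f + g = 0) :
      (1 + vecMulVec f (Pi.single i 1)) * (1 + vecMulVec g (Pi.single i 1)) = 1 := by
    apply Matrix.mulVec_injective
    ext1 v
    rw [← mulVec_mulVec, key _ _ hg, hfg]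
    simp
  refine ⟨⟨_, _, inv f (-f) (by simp [hf]) (by simp), inv (-f) f hf (by simp)⟩, ?_⟩
  simpa using key f 0 rfl v

end VectorEquivalent

namespace IsCompletable

theorem map {v : ι → R} (hv : IsCompletable v) (f : R →+* S) : IsCompletable (f ∘ v) := by
  obtain ⟨i, hi⟩ := hv
  refine ⟨i, ?_⟩
  convert hi.map f using 1
  ext j
  simp [Pi.single_apply, apply_ite f]

theorem of_isUnit {v : ι → R} {i : ι} (hi : IsUnit (v i)) : IsCompletable v := by
  obtain ⟨u, hu⟩ := hi
  refine ⟨i, (VectorEquivalent.smul_unit v u⁻¹).trans ?_⟩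
  have h1 : (u⁻¹ • v) i = 1 := by simp [← hu, Units.smul_def]
  convert VectorEquivalent.add_smul (u⁻¹ • v) (f := Pi.single i 1 - u⁻¹ • v) (i := i)
    (by simp [h1]) using 1
  simp [h1]

end IsCompletable

theorem IsUnimodular.isCompletable_of_isLocalRing [IsLocalRing R] {v : ι → R}
    (hv : IsUnimodular v) : IsCompletable v := by
  obtain ⟨g, hg⟩ := hv
  by_contra! h
  have : g ⬝ᵥ v ∈ IsLocalRing.maximalIdeal R := Ideal.sum_mem _ fun i _ ↦
    Ideal.mul_mem_left _ _ <| (IsLocalRing.mem_maximalIdeal _).2 fun hi ↦ h (.of_isUnit hi)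
  rw [hg] at this
  exact (IsLocalRing.maximalIdeal R).ne_top_iff_one.1 Ideal.IsPrime.ne_top' this

section Horrocks

theorem Polynomial.coeff_mem_map_lcoeff {f : R[X]} (hf : f.Monic) {d : ℕ}
    (hd : f.natDegree = d + 1) {I : Ideal R[X]} (hI : f ∈ I) {h : R[X]} (h₁ : h ∈ I)
    (h₂ : h ∈ degreeLT R (d + 1)) (m : ℕ) :
    h.coeff m ∈ (I.restrictScalars R ⊓ degreeLT R (d + 1)).map (lcoeff R d) := by
  by_cases hm : d < m
  · rw [coeff_eq_zero_of_degree_lt ((mem_degreeLT.1 h₂).trans_le (by exact_mod_cast hm))]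
    exact zero_mem _
  obtain ⟨t, ht⟩ := Nat.exists_eq_add_of_le' (not_lt.1 hm)
  induction t generalizing h m with
  | zero => exact ⟨h, ⟨h₁, h₂⟩, by simp [ht]⟩
  | succ t ih =>
    let J := (I.restrictScalars R ⊓ degreeLT R (d + 1)).map (lcoeff R d)
    have hd₀ : h.coeff d ∈ J := ⟨h, ⟨h₁, h₂⟩, rfl⟩
    have h₃ : X * h - C (h.coeff d) * f ∈ degreeLT R (d + 1) := by
      rw [mem_degreeLT, degree_lt_iff_coeff_zero]
      intro n hn
      obtain ⟨n, rfl⟩ : ∃ k, n = k + 1 := Nat.exists_eq_add_of_le' (by omega)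
      rw [coeff_sub, coeff_X_mul, coeff_C_mul]
      obtain rfl | hn := eq_or_ne n d
      · rw [← hd, hf.coeff_natDegree, mul_one, sub_self]
      · rw [coeff_eq_zero_of_natDegree_lt (p := f) (by omega),
          coeff_eq_zero_of_degree_lt (p := h) ((mem_degreeLT.1 h₂).trans_le
            (by exact_mod_cast (by omega : d + 1 ≤ n)))]
        simp
    have := ih (sub_mem (I.mul_mem_left X h₁) (I.mul_mem_left _ hI)) h₃ (m + 1) (by omega)
      (by omega)
    rw [coeff_sub, coeff_X_mul, coeff_C_mul, mul_comm (h.coeff d), ← smul_eq_mul] at this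
    simpa using add_mem this (J.smul_mem (f.coeff (m + 1)) hd₀)

theorem IsUnimodular.isCompletable_of_monic [IsLocalRing R] (hι : 3 ≤ Fintype.card ι)
    {v : ι → R[X]} (hv : IsUnimodular v) {i : ι} (hi : (v i).Monic) : IsCompletable v := by
  obtain ⟨d, hd⟩ : ∃ d, (v i).natDegree = d := ⟨_, rfl⟩
  induction d generalizing v i with
  | zero =>
    exact .of_isUnit (i := i) (by rw [hi.natDegree_eq_zero.1 hd]; exact isUnit_one)
  | succ d ih =>
    let w : ι → R[X] := v + v i • fun j ↦ if j = i then 0 else -(v j /ₘ v i)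
    have hvw : VectorEquivalent v w := .add_smul v (by simp)
    have hwi : w i = v i := by simp [w]
    have hw (j) (hj : j ≠ i) : w j ∈ degreeLT R (d + 1) := by
      have : w j = v j %ₘ v i := by simp [w, hj, modByMonic_eq_sub_mul_div, sub_eq_add_neg]
      rw [this, mem_degreeLT, ← hd, ← degree_eq_natDegree hi.ne_zero]
      exact degree_modByMonic_lt _ hi
    obtain ⟨j, hj, m, hm⟩ := (hvw.isUnimodular hv).exists_isUnit_coeff (hwi ▸ hi)
      (by rw [hwi]; omega)
    obtain ⟨k, hk⟩ : ∃ k, k ∉ ({i, j} : Finset ι) := by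
      obtain ⟨k, -, hk⟩ := Finset.exists_mem_notMem_of_card_lt_card
        (s := {i, j}) (t := Finset.univ) (Finset.card_le_two.trans_lt (by rwa [Finset.card_univ]))
      exact ⟨k, hk⟩
    have htop := Ideal.eq_top_of_isUnit_mem _ (coeff_mem_map_lcoeff hi hd
      (I := Ideal.span {v i, w j}) (Ideal.subset_span (by simp)) (Ideal.subset_span (by simp))
      (hw j hj) m) hm
    obtain ⟨h, ⟨h₁, h₂⟩, h₃⟩ := htop ▸ Submodule.mem_top (x := (1 : R))
    obtain ⟨p, q, rfl⟩ := Ideal.mem_span_pair.1 h₁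
    simp only [Finset.mem_insert, Finset.mem_singleton, not_or] at hk
    obtain ⟨hki, hkj⟩ := hk
    let a : R[X] := C (1 - (w k).coeff d)
    let y := w + w i • Pi.single k (a * p)
    let z := y + y j • Pi.single k (a * q)
    have hwz : VectorEquivalent w z := .trans (.add_smul w (by simp [Ne.symm hki]))
      (.add_smul y (by simp [Ne.symm hkj]))
    have hzk : z k = w k + a * (p * v i + q * w j) := by
      simp [z, y, hwi, Ne.symm hkj]
      ring
    have hdeg : z k ∈ degreeLT R (d + 1) := by
      rw [hzk, ← smul_eq_C_mul]
      exact add_mem (hw k hki) (Submodule.smul_mem _ _ h₂)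
    have hcoeff : (z k).coeff d = 1 := by
      rw [hzk, coeff_add, coeff_C_mul]
      simp only [lcoeff_apply] at h₃
      simp [h₃]
    have hnat : (z k).natDegree = d := by
      refine le_antisymm ?_ (le_natDegree_of_ne_zero (by simp [hcoeff]))
      rw [mem_degreeLT] at hdeg
      exact natDegree_le_iff_degree_le.2 (Order.le_of_lt_succ (by exact_mod_cast hdeg))
    exact (hvw.trans hwz).isCompletable <| ih ((hvw.trans hwz).isUnimodular hv) (i := k)
      (by rw [Monic, leadingCoeff, hnat, hcoeff]) hnat

end Horrocks

section LocalGlobal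

theorem Polynomial.sub_dvd_comp_sub (p s t : R[X]) : s - t ∣ p.comp s - p.comp t := by
  simpa only [comp, eval₂_eq_eval_map] using sub_dvd_eval_sub s t (p.map C)

namespace VectorEquivalent

/-- If a vector of polynomials becomes equivalent to a constant vector over `Rₚ[X]`, then
translations by multiples of a suitable `c ∉ p` do not change its equivalence class. -/
theorem exists_comp_add_of_localization [IsDomain R] (P : Ideal R) [P.IsPrime] {f : ι → R[X]}
    {w : ι → Localization.AtPrime P}
    (h : VectorEquivalent (mapRingHom (algebraMap R (Localization.AtPrime P)) ∘ f) (C ∘ w)) :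
    ∃ c ∉ P, ∀ s t : R[X],
      VectorEquivalent (fun i ↦ (f i).comp s) (fun i ↦ (f i).comp (s + C c * t)) := by
  let φ : R[X] →+* (Localization.AtPrime P)[X] :=
    mapRingHom (algebraMap R (Localization.AtPrime P))
  have hφ : Function.Injective φ := map_injective _ <|
    IsLocalization.injective _ P.primeCompl_le_nonZeroDivisors
  have hφ' : Function.Injective (φ.mapMatrix (m := ι)) := Matrix.map_injective hφ
  obtain ⟨U, hU⟩ := h
  obtain ⟨b, c, hcP, hb, N, M, hN, hM⟩ : ∃ b : R[X], ∃ c ∉ P, b = C c ∧ ∃ N M : Matrix ι ι R[X],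
      φ.mapMatrix N = φ b • ((U⁻¹ : (Matrix ι ι _)ˣ) : Matrix ι ι _) ∧
      φ.mapMatrix M = φ b • (U : Matrix ι ι _) := by
    let : Algebra R[X] (Localization.AtPrime P)[X] := φ.toAlgebra
    have := isLocalization P.primeCompl (Localization.AtPrime P)
    obtain ⟨⟨b, c, hc, hcb⟩, hb⟩ := IsLocalization.exist_integer_multiples
      (P.primeCompl.map C) (Finset.univ : Finset ((ι × ι) ⊕ (ι × ι)))
      (Sum.elim (fun ij ↦ (U⁻¹ : (Matrix ι ι _)ˣ).1 ij.1 ij.2) (fun ij ↦ U.1 ij.1 ij.2))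
    choose g hg using fun k ↦ hb k (Finset.mem_univ k)
    refine ⟨b, c, hc, hcb.symm, .of fun i j ↦ g (.inl (i, j)), .of fun i j ↦ g (.inr (i, j)),
      ?_, ?_⟩
    · ext1 i j
      exact hg (.inl (i, j))
    · ext1 i j
      exact hg (.inr (i, j))
  let σ (s : R[X]) : Matrix ι ι R[X] →+* Matrix ι ι R[X] := (compRingHom s).mapMatrix
  let τ (s : R[X]) : Matrix ι ι (Localization.AtPrime P)[X] →+*
    Matrix ι ι (Localization.AtPrime P)[X] := (compRingHom (φ s)).mapMatrix
  have hστ (s : R[X]) (A) : φ.mapMatrix (σ s A) = τ s (φ.mapMatrix A) := by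
    ext1 i j
    simp [σ, τ, φ, Polynomial.map_comp]
  have hτ (s : R[X]) (A) : τ s (φ b • A) = φ b • τ s A := by
    ext1 i j
    simp [τ, φ, hb]
  have hsub (s t : R[X]) (A) : ∃ B, σ (s + b ^ 2 * t) A - σ s A = b ^ 2 • B := by
    have hdvd (i j) : b ^ 2 ∣ (σ (s + b ^ 2 * t) A - σ s A) i j :=
      (Dvd.intro _ (by simp : b ^ 2 * t = s + b ^ 2 * t - s)).trans (sub_dvd_comp_sub _ _ _)
    choose B hB using hdvd
    exact ⟨.of B, by ext1 i j; simpa using hB i j⟩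
  have hb₀ : IsUnit (φ b) := by
    rw [hb, coe_mapRingHom, map_C]
    exact (IsLocalization.map_units (Localization.AtPrime P) (⟨c, hcP⟩ : P.primeCompl)).map C
  /- `V (s + b² t) V(s)⁻¹` is integral, both for `V = U` and `V = U⁻¹`. -/
  have key {A B V W} (hV : φ.mapMatrix A = φ b • V) (hW : φ.mapMatrix B = φ b • W)
      (hVW : V * W = 1) (s t : R[X]) : ∃ Q, φ.mapMatrix Q = τ (s + b ^ 2 * t) V * τ s W := by
    obtain ⟨D, hD⟩ := hsub s t A
    refine ⟨1 + D * σ s B, ?_⟩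
    have h1 : φ b • (τ (s + b ^ 2 * t) V - τ s V) = φ b • (φ b • φ.mapMatrix D) := by
      rw [smul_sub, ← hτ, ← hτ, ← hV, ← hστ, ← hστ, ← map_sub, hD]
      ext1 i j
      simp [pow_two, mul_assoc]
    rw [hb₀.smul_left_cancel] at h1
    rw [map_add, map_mul, map_one, hστ, hW, hτ, mul_smul_comm, ← smul_mul_assoc, ← h1, sub_mul,
      ← map_mul (τ s), hVW, map_one, add_sub_cancel]
  refine ⟨c ^ 2, fun h ↦ hcP (Ideal.IsPrime.mem_of_pow_mem ‹_› _ h), fun s t ↦ ?_⟩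
  rw [C_pow, ← hb]
  obtain ⟨Q, hQ⟩ := key hN hM (by simp) s t
  obtain ⟨Q', hQ'⟩ := key hN hM (by simp) (s + b ^ 2 * t) (-t)
  rw [mul_neg, add_neg_cancel_right] at hQ'
  have hmul {x y : R[X]} : τ x (U⁻¹ : (Matrix ι ι _)ˣ) * τ y U * (τ y (U⁻¹ : (Matrix ι ι _)ˣ) *
      τ x U) = 1 := by
    rw [mul_assoc, ← mul_assoc (τ y _), ← map_mul (τ y)]
    simp [← map_mul]
  have hf (x : R[X]) : τ x U *ᵥ (fun i ↦ φ ((f i).comp x)) = C ∘ w := by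
    ext1 i
    simpa [τ, φ, RingHom.map_mulVec, Polynomial.map_comp, Function.comp_def] using
      congr(compRingHom (φ x) ($hU i))
  refine ⟨⟨Q, Q', hφ' ?_, hφ' ?_⟩, ?_⟩
  · rw [map_mul, hQ, hQ', hmul, map_one]
  · rw [map_mul, hQ, hQ', hmul, map_one]
  · have : φ.mapMatrix Q *ᵥ (fun i ↦ φ ((f i).comp s)) =
        fun i ↦ φ ((f i).comp (s + b ^ 2 * t)) := by
      rw [hQ, ← mulVec_mulVec, hf, ← hf (s + b ^ 2 * t), mulVec_mulVec, ← map_mul]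
      simp
    ext1 i
    apply hφ
    rw [RingHom.map_mulVec]
    exact congr_fun this i

/-- A vector of polynomials that is locally equivalent to constants is equivalent to its value
at zero. -/
theorem of_localization [IsDomain R] {f : ι → R[X]}
    (h : ∀ (P : Ideal R) [P.IsMaximal], ∃ w : ι → Localization.AtPrime P,
      VectorEquivalent (mapRingHom (algebraMap R (Localization.AtPrime P)) ∘ f) (C ∘ w)) :
    VectorEquivalent f (fun i ↦ C ((f i).eval 0)) := by
  let J : Ideal R :=
    { carrier := {c | ∀ s t : R[X],
        VectorEquivalent (fun i ↦ (f i).comp s) (fun i ↦ (f i).comp (s + C c * t))}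
      zero_mem' s t := by simpa using refl _
      add_mem' {c d} hc hd s t := by
        simpa [add_mul, add_assoc] using (hc s t).trans (hd (s + C c * t) t)
      smul_mem' a c hc s t := by
        simpa [mul_assoc, mul_left_comm] using hc s (C a * t) }
  have hJ : J = ⊤ := by
    by_contra hJ
    obtain ⟨P, hP, hJP⟩ := J.exists_le_maximal hJ
    obtain ⟨w, hw⟩ := h P
    obtain ⟨c, hcP, hc⟩ := exists_comp_add_of_localization P hw
    exact hcP (hJP hc)
  have h1 : (1 : R) ∈ J := hJ ▸ Submodule.mem_top
  simpa [comp_zero] using (h1 0 X).symm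

end VectorEquivalent

/-- A unimodular vector of polynomials with a monic entry is equivalent to its value at zero. -/
theorem IsUnimodular.vectorEquivalent_eval_zero [IsDomain R] (hι : 3 ≤ Fintype.card ι)
    {f : ι → R[X]} (hf : IsUnimodular f) {i : ι} (hi : (f i).Monic) :
    VectorEquivalent f (fun i ↦ C ((f i).eval 0)) := by
  refine .of_localization fun P _ ↦ ?_
  obtain ⟨j, hj⟩ := (hf.map (mapRingHom (algebraMap R (Localization.AtPrime P)))
    ).isCompletable_of_monic hι (i := i) (hi.map _)
  refine ⟨Pi.single j 1, ?_⟩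
  convert hj using 1
  ext1 k
  simp [Pi.single_apply, apply_ite C]

end LocalGlobal

end Unimodular

section Nagata

open Polynomial MvPolynomial Nat List

namespace MvPolynomial

variable {k : Type*} [Field k] {n : ℕ}

/-- The substitution `Xᵢ ↦ Xᵢ + c X₀ ^ bⁱ` for `i ≠ 0`, fixing `X₀`. -/
noncomputable def nagataHom (n b : ℕ) (c : k) :
    MvPolynomial (Fin (n + 1)) k →ₐ[k] MvPolynomial (Fin (n + 1)) k :=
  aeval fun i ↦ if i = 0 then X 0 else X i + c • X 0 ^ (b ^ i.1)

theorem nagataHom_comp_neg (b : ℕ) (c : k) :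
    (nagataHom n b c).comp (nagataHom n b (-c)) = AlgHom.id _ _ := by
  rw [nagataHom, nagataHom, comp_aeval, ← MvPolynomial.aeval_X_left]
  ext i v
  cases i using Fin.cases <;> simp

variable (k n) in
/-- The change of variables `Xᵢ ↦ Xᵢ + X₀ ^ bⁱ` for `i ≠ 0`. -/
noncomputable def nagataEquiv (b : ℕ) :
    MvPolynomial (Fin (n + 1)) k ≃ₐ[k] MvPolynomial (Fin (n + 1)) k :=
  .ofAlgHom (nagataHom n b 1) (nagataHom n b (-1)) (nagataHom_comp_neg b 1)
    (by simpa using nagataHom_comp_neg b (-1 : k))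

theorem finSuccEquiv_nagataEquiv_X (b : ℕ) (i : Fin n) :
    finSuccEquiv k n (nagataEquiv k n b (X i.succ)) =
      Polynomial.X ^ b ^ (i.1 + 1) + Polynomial.C (X i) := by
  simp [nagataEquiv, nagataHom, finSuccEquiv_X_succ, finSuccEquiv_X_zero, add_comm]

theorem finSuccEquiv_nagataEquiv_monomial {b : ℕ} (hb : b ≠ 0) (v : Fin (n + 1) →₀ ℕ)
    (a : k) :
    ∃ p : (MvPolynomial (Fin n) k)[X], p.Monic ∧
      p.natDegree = ∑ i : Fin (n + 1), b ^ i.1 * v i ∧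
      finSuccEquiv k n (nagataEquiv k n b (monomial v a)) = Polynomial.C (C a) * p := by
  let q (i : Fin (n + 1)) := finSuccEquiv k n (nagataEquiv k n b (X i))
  have hq (i) : (q i).Monic ∧ (q i).natDegree = b ^ i.1 := by
    cases i using Fin.cases with
    | zero =>
      have : q 0 = Polynomial.X := by
        simp [q, nagataEquiv, nagataHom, finSuccEquiv_X_zero]
      simp [this, monic_X]
    | succ i =>
      simp only [q, finSuccEquiv_nagataEquiv_X]
      exact ⟨monic_X_pow_add_C _ (pow_ne_zero _ hb), by simp⟩
  refine ⟨∏ i, q i ^ v i, monic_prod_of_monic _ _ fun i _ ↦ (hq i).1.pow _, ?_, ?_⟩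
  · rw [natDegree_prod_of_monic _ _ fun i _ ↦ (hq i).1.pow _]
    simp [(hq _).1.natDegree_pow, hq, mul_comm]
  · rw [monomial_eq, Finsupp.prod_fintype _ _ (by simp)]
    simp only [map_mul, map_prod, map_pow, q, ← algebraMap_eq, AlgEquiv.commutes]
    rfl

theorem sum_pow_mul_ne {b : ℕ} (hb : 1 < b) {v w : Fin n →₀ ℕ} (hv : ∀ i, v i < b)
    (hw : ∀ i, w i < b) (ne : v ≠ w) :
    ∑ x : Fin n, b ^ x.1 * v x ≠ ∑ x : Fin n, b ^ x.1 * w x := by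
  intro h
  refine ne <| Finsupp.ext <| congrFun <| ofFn_inj.mp ?_
  apply ofDigits_inj_of_len_eq hb (by simp) (by simpa [List.mem_ofFn] using hv)
    (by simpa [List.mem_ofFn] using hw)
  simpa only [ofDigits_eq_sum_mapIdx, mapIdx_eq_ofFn, get_ofFn, length_ofFn,
    Fin.val_cast, mul_comm, sum_ofFn] using! h

/-- After a change of variables, a nonzero polynomial over a field has invertible leading
coefficient in the first variable. -/
theorem exists_isUnit_leadingCoeff {f : MvPolynomial (Fin (n + 1)) k} (hf : f ≠ 0) :
    ∃ e : MvPolynomial (Fin (n + 1)) k ≃ₐ[k] MvPolynomial (Fin (n + 1)) k,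
      IsUnit (finSuccEquiv k n (e f)).leadingCoeff := by
  let b := 2 + f.totalDegree
  refine ⟨nagataEquiv k n b, ?_⟩
  choose p hp hdeg heq using fun v : Fin (n + 1) →₀ ℕ ↦
    finSuccEquiv_nagataEquiv_monomial (b := b) (by omega) v (f.coeff v)
  obtain ⟨v, hv, hmax⟩ := Finset.exists_max_image f.support (fun v ↦ (p v).natDegree)
    (support_nonempty.2 hf)
  have hlt (w) (hw : w ∈ f.support) (i) : w i < b :=
    ((monomial_le_degreeOf i hw).trans (degreeOf_le_totalDegree f i)).trans_lt (by omega)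
  have hmax' (w) (hw : w ∈ f.support \ {v}) : (p w).natDegree < (p v).natDegree := by
    obtain ⟨hw, hwv⟩ := Finset.mem_sdiff.1 hw
    refine (hmax w hw).lt_of_ne ?_
    rw [hdeg, hdeg]
    exact sum_pow_mul_ne (by omega) (hlt w hw) (hlt v hv) (by simpa using hwv)
  have hc (w) (hw : w ∈ f.support) : IsUnit (C (f.coeff w) : MvPolynomial (Fin n) k) :=
    (mem_support_iff.1 hw).isUnit.map C
  have hlead : (Polynomial.C (C (f.coeff v)) * p v).leadingCoeff = C (f.coeff v) := by
    rw [leadingCoeff_mul_monic (hp v), leadingCoeff_C]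
  have : finSuccEquiv k n (nagataEquiv k n b f) = ∑ w ∈ f.support \ {v},
      Polynomial.C (C (f.coeff w)) * p w + Polynomial.C (C (f.coeff v)) * p v := by
    conv_lhs => rw [← f.support_sum_monomial_coeff]
    rw [map_sum, map_sum, ← Finset.sum_sdiff (Finset.singleton_subset_iff.2 hv)]
    simp [heq]
  rw [this, leadingCoeff_add_of_degree_lt, hlead]
  · exact hc v hv
  · have hdegree (w) (hw : w ∈ f.support) :
        (Polynomial.C (C (f.coeff w)) * p w).degree = ((p w).natDegree : WithBot ℕ) := by
      rw [degree_C_mul (hc w hw).ne_zero, degree_eq_natDegree (hp w).ne_zero]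
    rw [hdegree v hv]
    refine (degree_sum_le _ _).trans_lt ((Finset.sup_lt_iff (WithBot.bot_lt_coe _)).2 fun w hw ↦ ?_)
    rw [hdegree w (Finset.mem_sdiff.1 hw).1]
    exact_mod_cast hmax' w hw

end MvPolynomial

end Nagata

section Completion

open MvPolynomial Polynomial

/-- Unimodular vectors over polynomial rings over fields are completable. -/
theorem IsUnimodular.isCompletable_mvPolynomial {K ι : Type*} [Field K] [Fintype ι]
    [DecidableEq ι] (hι : 3 ≤ Fintype.card ι) {n : ℕ} {v : ι → MvPolynomial (Fin n) K}
    (hv : IsUnimodular v) : IsCompletable v := by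
  induction n with
  | zero =>
    let e := isEmptyRingEquiv K (Fin 0)
    have := (hv.map e.toRingHom).isCompletable_of_isLocalRing.map e.symm.toRingHom
    simpa [Function.comp_def] using this
  | succ n ih =>
    obtain ⟨i, hi⟩ : ∃ i, v i ≠ 0 := by
      by_contra! h
      obtain ⟨g, hg⟩ := hv
      obtain rfl : v = 0 := funext h
      simp at hg
    obtain ⟨T, u, hu⟩ := exists_isUnit_leadingCoeff hi
    let e := (T.trans (finSuccEquiv K n)).toRingEquiv
    let U := u⁻¹.map (Polynomial.C : MvPolynomial (Fin n) K →+* _).toMonoidHom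
    have h1 := VectorEquivalent.smul_unit (e ∘ v) U
    have h2 : ((U • (e ∘ v)) i).Monic := by
      have : (U • (e ∘ v)) i = Polynomial.C (u⁻¹ : (MvPolynomial (Fin n) K)ˣ).1 *
        finSuccEquiv K n (T (v i)) := rfl
      rw [this, Monic, leadingCoeff_mul, leadingCoeff_C, ← hu]
      simp
    have h3 := h1.isUnimodular (hv.map e.toRingHom)
    have h4 := h1.trans (h3.vectorEquivalent_eval_zero hι h2)
    have h5 := h4.isCompletable ((ih (h3.map (evalRingHom 0))).map Polynomial.C)
    have := h5.map e.symm.toRingHom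
    simpa [Function.comp_def] using this

end Completion

section Cancellation

variable {R M : Type*} [CommRing R] [AddCommGroup M] [Module R M]

open Matrix

theorem IsCompletable.free_of_equiv {ι : Type*} [Fintype ι] [DecidableEq ι]
    (e : (M × R) ≃ₗ[R] (ι → R)) (h : IsCompletable (e (0, 1))) : Module.Free R M := by
  obtain ⟨i, U, hU⟩ := h
  let f : (M × R) ≃ₗ[R] (ι → R) := e ≪≫ₗ Matrix.toLinearEquiv' U.1 U.invertible
  have hf (r : R) : f (0, r) = Pi.single i r := by
    have h1 : f (0, 1) = Pi.single i 1 := hU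
    rw [show ((0 : M), r) = r • (0, 1) by simp, map_smul, h1, ← Pi.single_smul, smul_eq_mul,
      mul_one]
  let g : M →ₗ[R] ({j // j ≠ i} → R) :=
    LinearMap.funLeft R R Subtype.val ∘ₗ f.toLinearMap ∘ₗ LinearMap.inl R M R
  refine .of_equiv (LinearEquiv.ofBijective g ⟨?_, fun y ↦ ?_⟩).symm
  · rw [injective_iff_map_eq_zero]
    intro m hm
    have : f (m, 0) = f (0, f (m, 0) i) := by
      rw [hf]
      ext j
      obtain rfl | hj := eq_or_ne j i
      · simp
      · simpa [g, hj] using congr_fun hm ⟨j, hj⟩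
    simpa using congr_arg Prod.fst (f.injective this)
  · obtain ⟨⟨m, r⟩, hmr⟩ := f.surjective fun j ↦ if h : j = i then 0 else y ⟨j, h⟩
    refine ⟨m, funext fun ⟨j, hj⟩ ↦ ?_⟩
    have : f (m, r) = f (m, 0) + f (0, r) := by rw [← map_add]; simp
    have := congr_fun (this.symm.trans hmr) j
    simpa [g, hf, hj] using this

theorem isUnimodular_of_equiv {ι : Type*} [Fintype ι] (e : (M × R) ≃ₗ[R] (ι → R)) :
    IsUnimodular (e (0, 1)) := by
  classical
  refine ⟨fun i ↦ (e.symm (Pi.single i 1)).2, ?_⟩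
  have h (x : ι → R) : x = ∑ i, x i • Pi.single i (1 : R) := by
    simp [← Pi.single_smul, Finset.univ_sum_single]
  have := congr((e.symm $(h (e (0, 1)))).2)
  simpa [dotProduct, mul_comm, Prod.snd_sum] using this.symm

theorem IsUnimodular.isCompletable_of_le_two [Nontrivial R] {m : ℕ} (hm : m ≤ 2) {v : Fin m → R}
    (hv : IsUnimodular v) : IsCompletable v := by
  obtain ⟨g, hg⟩ := hv
  interval_cases m
  · simp at hg
  · rw [dotProduct, Fin.sum_univ_one] at hg
    exact .of_isUnit (.of_mul_eq_one_right _ hg)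
  · rw [dotProduct, Fin.sum_univ_two] at hg
    refine ⟨0, ⟨!![g 0, g 1; -v 1, v 0], !![v 0, -g 1; v 1, g 0], ?_, ?_⟩, ?_⟩
    · ext i j
      fin_cases i <;> fin_cases j <;> simp [mul_apply] <;> first | linear_combination hg | ring
    · ext i j
      fin_cases i <;> fin_cases j <;> simp [mul_apply] <;> first | linear_combination hg | ring
    · ext i
      fin_cases i <;> simp [mulVec, dotProduct] <;> first | linear_combination hg | ring

/-- If unimodular vectors are completable, then stably free modules are free. -/
theorem Module.IsStablyFree.free_of_isCompletable [Nontrivial R] [Module.Finite R M]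
    [Module.IsStablyFree R M] (H : ∀ {m : ℕ} {v : Fin m → R}, IsUnimodular v → IsCompletable v) :
    Module.Free R M := by
  obtain ⟨N, _, _, _, _, hN⟩ := Module.IsStablyFree.exist_free_prod R M
  have step (k : ℕ) (h : Module.Free R (M × (Fin k → R))) : Module.Free R M := by
    induction k with
    | zero => exact .of_equiv (LinearEquiv.prodUnique (R := R) (M := M) (M₂ := Fin 0 → R))
    | succ k ih =>
      let e : ((M × (Fin k → R)) × R) ≃ₗ[R] M × (Fin (k + 1) → R) :=
        .prodAssoc R M (Fin k → R) R ≪≫ₗ .prodCongr (.refl R M)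
          (.prodComm R (Fin k → R) R ≪≫ₗ Fin.consLinearEquiv R fun _ ↦ R)
      have e' := e ≪≫ₗ (Module.finBasis R (M × (Fin (k + 1) → R))).equivFun
      exact ih <| IsCompletable.free_of_equiv e' (H (isUnimodular_of_equiv e'))
  have e := (LinearEquiv.refl R M).prodCongr (Module.finBasis R N).equivFun
  exact step _ (.of_equiv e)

end Cancellation

section MvPolynomialResolution

universe u

theorem HasFreeResolution.exists_of_ringEquiv {R S : Type u} [CommRing R] [CommRing S]
    (σ : R ≃+* S)
    (H : ∀ (M : Type u) [AddCommGroup M] [Module R M] [Module.Finite R M],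
      ∃ n, HasFreeResolution R n M)
    (M : Type u) [AddCommGroup M] [Module S M] [Module.Finite S M] :
    ∃ n, HasFreeResolution S n M := by
  let : Module R M := Module.compHom M σ.toRingHom
  have : RingHomSurjective σ.symm.toRingHom := ⟨σ.symm.surjective⟩
  have : Module.Finite R M := .of_surjective
    ({ AddMonoidHom.id M with
      map_smul' r m := congr_arg (· • m) (σ.apply_symm_apply r).symm } : M →ₛₗ[σ.symm.toRingHom] M)
    Function.surjective_id
  obtain ⟨n, hn⟩ := H M
  exact ⟨n, hn.of_ringEquiv σ (.refl M) fun _ _ ↦ rfl⟩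

/-- Hilbert's syzygy theorem: finitely generated modules over polynomial rings over fields have
finite free resolutions. -/
theorem HasFreeResolution.mvPolynomial {K : Type u} [Field K] (n : ℕ) (M : Type u)
    [AddCommGroup M] [Module (MvPolynomial (Fin n) K) M]
    [Module.Finite (MvPolynomial (Fin n) K) M] :
    ∃ k, HasFreeResolution (MvPolynomial (Fin n) K) k M := by
  induction n generalizing M with
  | zero =>
    exact exists_of_ringEquiv (MvPolynomial.isEmptyRingEquiv K (Fin 0)).symm
      (fun M _ _ _ ↦ ⟨0, inferInstance, ‹_›⟩) M
  | succ n ih =>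
    exact exists_of_ringEquiv (MvPolynomial.finSuccEquiv K n).symm.toRingEquiv
      (fun M _ _ _ ↦ HasFreeResolution.polynomial (fun M _ _ _ ↦ ih M) M) M

end MvPolynomialResolution

/-- **Quillen–Suslin theorem.** Let `K` be a field and `A := K[x₁,…,xₙ]` the polynomial
ring in `n` variables over `K`.  Then `A` is `𝒫ℱ`, i.e. every finitely generated
projective `A`-module is free. -/
theorem quillen_suslin {K : Type} [Field K] (n : ℕ)
    (M : Type) [AddCommGroup M] [Module (MvPolynomial (Fin n) K) M]
    (hfg : Module.Finite (MvPolynomial (Fin n) K) M)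
    (hproj : Module.Projective (MvPolynomial (Fin n) K) M) :
    Module.Free (MvPolynomial (Fin n) K) M := by
  obtain ⟨k, hk⟩ := HasFreeResolution.mvPolynomial (K := K) n M
  have := hk.isStablyFree
  refine Module.IsStablyFree.free_of_isCompletable fun {m v} hv ↦ ?_
  obtain hm | hm := le_or_gt m 2
  · exact hv.isCompletable_of_le_two hm
  · exact hv.isCompletable_mvPolynomial (by rwa [Fintype.card_fin])
end
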